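/- Let (x̄^1(t),…,x̄^N(t)) solve d/dt x̄^i = (N^3/4)((x̄^{i+1}−x̄^i)^2 − (x̄^i−x̄^{i−1})^2) with x̄^0 := −x̄^1, x̄^{N+1} := 2−x̄^N, and let X(t,θ) solve ∂_t X = (1/2)∂_θX ∂²_{θθ}X on (0,1) with X(t,0)=0, X(t,1)=1, starting from X_0 ∈ C^{4,α}([0,1]). Set X^i(t) := X(t,(i−1/2)/N). Assume there are positive constants c_0, C_0 with c_0/N ≤ x̄^i(0)−x̄^{i−1}(0) ≤ C_0/N for all i and c_0 ≤ ∂_θX_0 ≤ C_0. Then there exist constants c̄, C̄ > 0, depending only on c_0, such that for all t ≥ 0: (1/N)Σ_{i=1}^N (x̄^i(t)−X^i(t))^2 ≤ e^{−c̄ t}·(1/N)Σ_{i=1}^N (x̄^i(0)−X^i(0))^2 + C̄ (Ĉ/N^2)^2, where Ĉ is a constant depending only on c_0 and ‖X_0‖_{C^{4,α}([0,1])} (the consistency constant satisfying |∂_t X^i − (N^3/4)((X^{i+1}−X^i)^2−(X^i−X^{i−1})^2)| ≤ Ĉ/N^2). -/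

import Mathlib

/-- The reference grid points `(i - 1/2)/N`. -/
noncomputable def grid (N i : ℕ) : ℝ := ((i : ℝ) - 1 / 2) / N

/-- Extension of a finite family `v 1, …, v N` by the boundary conventions
`v 0 := -v 1` and `v (N+1) := 2 - v N`. -/
noncomputable def pad (N : ℕ) (v : ℕ → ℝ) : ℕ → ℝ :=
  fun i => if i = 0 then -v 1 else if i = N + 1 then 2 - v N else v i

/-- `f` is of class `C^{4,α}` on `[0,1]` with all relevant norms bounded by `K`. -/
def C4HolderBound (α K : ℝ) (f : ℝ → ℝ) : Prop :=
  ContDiff ℝ 4 f ∧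
    (∀ k : ℕ, k ≤ 4 → ∀ θ ∈ Set.Icc (0 : ℝ) 1, |iteratedDeriv k f θ| ≤ K) ∧
    ∀ θ ∈ Set.Icc (0 : ℝ) 1, ∀ θ' ∈ Set.Icc (0 : ℝ) 1,
      |iteratedDeriv 4 f θ - iteratedDeriv 4 f θ'| ≤ K * |θ - θ'| ^ α

section

open Set Filter Topology

theorem hasDerivWithinAt_nonneg_of_le_right {a t d : ℝ} {g : ℝ → ℝ} (hat : a < t)
    (hd : HasDerivWithinAt g d (Icc a t) t) (hg : ∀ s ∈ Icc a t, g s ≤ g t) : 0 ≤ d := by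
  have h1 : Icc a t \ {t} = Ico a t := by
    ext x
    simp only [Set.mem_sdiff, mem_Icc, mem_singleton_iff, mem_Ico, and_assoc, lt_iff_le_and_ne]
  rw [hasDerivWithinAt_iff_tendsto_slope, h1] at hd
  have : (𝓝[Ico a t] t).NeBot := by
    rw [nhdsWithin_Ico_eq_nhdsLT hat]; infer_instance
  refine ge_of_tendsto hd ?_
  filter_upwards [self_mem_nhdsWithin] with s hs
  rw [slope_def_field]
  exact div_nonneg_of_nonpos (by linarith [hg s ⟨hs.1, hs.2.le⟩]) (by linarith [hs.2])

/-- Maximum principle: a family indexed by a compact space stays below `B` if its maximum does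
not increase while it lies in the band `(B, B')`. -/
theorem le_of_deriv_nonpos_at_max {κ : Type*} [TopologicalSpace κ] [CompactSpace κ]
    {a b B B' : ℝ} {f : ℝ → κ → ℝ} (hB : B < B')
    (hf : ContinuousOn (Function.uncurry f) (Icc a b ×ˢ univ)) (h0 : ∀ k, f a k ≤ B)
    (h : ∀ t ∈ Ioc a b, ∀ k, B < f t k → f t k < B' → (∀ j, f t j ≤ f t k) →
      ∃ d ≤ 0, HasDerivWithinAt (fun s => f s k) d (Icc a t) t) :
    ∀ t ∈ Icc a b, ∀ k, f t k ≤ B := by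
  intro t1 ht1 k1
  by_contra! hlt
  obtain ⟨B2, hB2, hB2'⟩ := exists_between (lt_min hB hlt)
  obtain ⟨hB2a, hB2b⟩ := lt_min_iff.1 hB2'
  have hsub : Icc a t1 ×ˢ (univ : Set κ) ⊆ Icc a b ×ˢ univ :=
    prod_mono (Icc_subset_Icc_right ht1.2) subset_rfl
  have hc : IsCompact (Icc a t1 ×ˢ (univ : Set κ)) := isCompact_Icc.prod isCompact_univ
  have hS : IsCompact ((Icc a t1 ×ˢ (univ : Set κ)) ∩ Function.uncurry f ⁻¹' Ici B2) := by
    have := (hf.mono hsub).preimage_isClosed_of_isClosed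
      (isClosed_Icc.prod isClosed_univ) (isClosed_Ici (a := B2))
    exact hc.of_isClosed_subset this inter_subset_left
  obtain ⟨s, ⟨⟨s', ks⟩, ⟨hs1, hs2⟩, rfl⟩, hleast⟩ := (hS.image continuous_fst).exists_isLeast
    ⟨t1, (t1, k1), ⟨⟨⟨ht1.1, le_rfl⟩, mem_univ _⟩, hB2b.le⟩, rfl⟩
  simp only [mem_prod, mem_univ, and_true, mem_preimage, mem_Ici, Function.uncurry] at hs1 hs2
  simp only at hleast
  have has : a < s' := by
    rcases hs1.1.lt_or_eq with h | h
    · exact h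
    · rw [← h] at hs2; linarith [h0 ks]
  have hbelow : ∀ t ∈ Ico a s', ∀ k, f t k < B2 := by
    intro t ht k
    by_contra! hcon
    have := hleast ⟨(t, k), ⟨⟨⟨ht.1, ht.2.le.trans hs1.2⟩, mem_univ _⟩, hcon⟩, rfl⟩
    exact absurd ht.2 (not_lt.2 this)
  have hats : ∀ t ∈ Icc a s', ∀ k, f t k ≤ B2 := by
    intro t ht k
    rcases ht.2.lt_or_eq with h | rfl
    · exact (hbelow t ⟨ht.1, h⟩ k).le
    · have hcont : ContinuousWithinAt (fun s => f s k) (Ico a t) t := by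
        have h1 := hf (t, k) ⟨⟨ht.1, hs1.2.trans ht1.2⟩, mem_univ _⟩
        have h2 : ContinuousWithinAt (fun s => (s, k)) (Ico a t) t := by fun_prop
        exact ContinuousWithinAt.comp (g := Function.uncurry f) (f := fun s => (s, k)) h1 h2
          (fun x hx => ⟨⟨hx.1, hx.2.le.trans (hs1.2.trans ht1.2)⟩, mem_univ _⟩)
      have : (𝓝[Ico a t] t).NeBot := by
        rw [nhdsWithin_Ico_eq_nhdsLT has]; infer_instance
      refine le_of_tendsto hcont ?_
      filter_upwards [self_mem_nhdsWithin] with x hx using (hbelow x hx k).le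
  obtain ⟨ε, hε, hε2⟩ : ∃ ε > 0, ε * (s' - a) < B2 - B := by
    refine ⟨(B2 - B) / (2 * (s' - a)), by apply div_pos <;> linarith, ?_⟩
    have : s' - a ≠ 0 := by linarith
    field_simp
    linarith
  have hsub2 : Icc a s' ×ˢ (univ : Set κ) ⊆ Icc a b ×ˢ univ :=
    prod_mono (Icc_subset_Icc_right (hs1.2.trans ht1.2)) subset_rfl
  obtain ⟨⟨t, k⟩, ⟨ht, -⟩, hmax⟩ := (isCompact_Icc.prod isCompact_univ).exists_isMaxOn
    (s := Icc a s' ×ˢ (univ : Set κ)) (f := fun p => f p.1 p.2 - ε * (p.1 - a))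
    ⟨(s', ks), ⟨⟨has.le, le_rfl⟩, mem_univ _⟩⟩
    ((hf.mono hsub2).sub (by fun_prop))
  simp only [isMaxOn_iff, mem_prod, mem_univ, and_true, Prod.forall] at hmax ht
  have hv := hmax s' ks ⟨has.le, le_rfl⟩
  have hta : 0 ≤ ε * (t - a) := mul_nonneg hε.le (by linarith [ht.1])
  have htB : B < f t k := by linarith
  have hat : a < t := by
    rcases ht.1.lt_or_eq with h | h
    · exact h
    · rw [← h] at htB; linarith [h0 k]
  obtain ⟨d, hd, hder⟩ := h t ⟨hat, ht.2.trans (hs1.2.trans ht1.2)⟩ k htB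
    ((hats t ht k).trans_lt hB2a) (fun j => by linarith [hmax t j ht])
  have hder2 : HasDerivWithinAt (fun s => f s k - ε * (s - a)) (d - ε * 1) (Icc a t) t :=
    hder.sub ((((hasDerivAt_id t).sub_const a).const_mul ε).hasDerivWithinAt)
  have := hasDerivWithinAt_nonneg_of_le_right hat hder2
    (fun s hs => hmax s k ⟨hs.1, hs.2.trans ht.2⟩)
  linarith

theorem deriv_deriv_nonpos_of_isLocalMax {f : ℝ → ℝ} {x : ℝ} (hf : Continuous f)
    (h : IsLocalMax f x) : deriv (deriv f) x ≤ 0 := by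
  by_contra! hpos
  have hmin := isLocalMin_of_deriv_deriv_pos hpos h.deriv_eq_zero hf.continuousAt
  have hconst : f =ᶠ[𝓝 x] fun _ => f x := by
    filter_upwards [h, hmin] with y h1 h2 using le_antisymm h1 h2
  have := hconst.deriv.deriv_eq
  simp at this
  linarith

theorem deriv_eq_of_isLocalMax_mul_sub {g h : ℝ → ℝ} {σ x : ℝ} (hg : ContDiff ℝ 2 g)
    (hh : ContDiff ℝ 2 h) (hσ : σ ≠ 0) (hx : IsLocalMax (fun y => σ * (g y - h y)) x) :
    deriv g x = deriv h x ∧ σ * (deriv (deriv g) x - deriv (deriv h) x) ≤ 0 := by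
  have hg1 : Differentiable ℝ g := hg.differentiable (by norm_num)
  have hh1 : Differentiable ℝ h := hh.differentiable (by norm_num)
  have hg2 : Differentiable ℝ (deriv g) :=
    ((contDiff_succ_iff_deriv (n := 1)).1 hg).2.2.differentiable (by norm_num)
  have hh2 : Differentiable ℝ (deriv h) :=
    ((contDiff_succ_iff_deriv (n := 1)).1 hh).2.2.differentiable (by norm_num)
  have e1 : deriv (fun y => σ * (g y - h y)) = fun y => σ * (deriv g y - deriv h y) := by
    ext y
    exact (((hg1 y).hasDerivAt.sub (hh1 y).hasDerivAt).const_mul σ).deriv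
  have e2 : deriv (deriv (fun y => σ * (g y - h y))) x =
      σ * (deriv (deriv g) x - deriv (deriv h) x) := by
    rw [e1]
    exact (((hg2 x).hasDerivAt.sub (hh2 x).hasDerivAt).const_mul σ).deriv
  have h1 := hx.deriv_eq_zero
  have h2 := deriv_deriv_nonpos_of_isLocalMax
    ((hg1.continuous.sub hh1.continuous).const_mul σ) hx
  have h2' : σ * (deriv (deriv g) x - deriv (deriv h) x) ≤ 0 := e2 ▸ h2
  rw [e1] at h1
  refine ⟨?_, h2'⟩
  have := (mul_eq_zero.1 h1).resolve_left hσ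
  linarith

/-- A solution of `∂ₜX = ½ ∂_θX ∂²_θθX` on `[a,b] × [0,1]` with constant Dirichlet data. -/
structure IsSol (a b : ℝ) (X : ℝ → ℝ → ℝ) : Prop where
  smooth : ∀ t ∈ Icc a b, ContDiff ℝ 2 (X t)
  pde : ∀ t ∈ Icc a b, ∀ θ ∈ Icc (0 : ℝ) 1, HasDerivWithinAt (fun s => X s θ)
    ((1 / 2) * deriv (X t) θ * deriv (deriv (X t)) θ) (Icc a b) t
  left : ∀ t ∈ Icc a b, X t 0 = X a 0
  right : ∀ t ∈ Icc a b, X t 1 = X a 1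

namespace IsSol

variable {a b : ℝ} {X : ℝ → ℝ → ℝ}

theorem mono (h : IsSol a b X) {a' b' : ℝ} (ha : a ≤ a') (hb : b' ≤ b) : IsSol a' b' X := by
  have hs : Icc a' b' ⊆ Icc a b := Icc_subset_Icc ha hb
  refine ⟨fun t ht => h.smooth t (hs ht), fun t ht θ hθ => (h.pde t (hs ht) θ hθ).mono hs, ?_, ?_⟩
  · intro t ht
    rw [h.left t (hs ht), h.left a' (hs ⟨le_rfl, ht.1.trans ht.2⟩)]
  · intro t ht
    rw [h.right t (hs ht), h.right a' (hs ⟨le_rfl, ht.1.trans ht.2⟩)]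

theorem reverse (h : IsSol a b X) : IsSol a b (fun t θ => -X (a + b - t) θ) := by
  have hm : ∀ t ∈ Icc a b, a + b - t ∈ Icc a b := fun t ht => ⟨by linarith [ht.2], by linarith [ht.1]⟩
  refine ⟨fun t ht => (h.smooth _ (hm t ht)).neg, ?_, ?_, ?_⟩
  · intro t ht θ hθ
    have h1 := h.pde _ (hm t ht) θ hθ
    have h2 : HasDerivWithinAt (fun s => a + b - s) (-1) (Icc a b) t :=
      ((hasDerivAt_id t).const_sub (a + b)).hasDerivWithinAt
    have h3 := (h1.scomp t h2 (fun s hs => hm s hs)).neg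
    have e1 : deriv (fun θ => -X (a + b - t) θ) = fun θ => - deriv (X (a + b - t)) θ := by
      ext y; exact deriv.fun_neg
    have e2 : deriv (fun θ => - deriv (X (a + b - t)) θ) θ = - deriv (deriv (X (a + b - t))) θ :=
      deriv.fun_neg
    rw [e1, e2]
    refine h3.congr_deriv ?_
    simp
  · intro t ht
    rw [h.left _ (hm t ht), h.left _ (hm a ⟨le_rfl, ht.1.trans ht.2⟩)]
  · intro t ht
    rw [h.right _ (hm t ht), h.right _ (hm a ⟨le_rfl, ht.1.trans ht.2⟩)]

theorem flux_eq_zero_left (h : IsSol a b X) (hab : a < b) {t : ℝ} (ht : t ∈ Icc a b) :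
    (1 / 2) * deriv (X t) 0 * deriv (deriv (X t)) 0 = 0 := by
  have h1 := h.pde t ht 0 ⟨le_rfl, zero_le_one⟩
  have h2 : HasDerivWithinAt (fun s => X s 0) 0 (Icc a b) t :=
    (hasDerivWithinAt_const t (Icc a b) (X a 0)).congr (fun s hs => h.left s hs) (h.left t ht)
  exact (uniqueDiffOn_Icc hab t ht).eq_deriv _ h1 h2

theorem flux_eq_zero_right (h : IsSol a b X) (hab : a < b) {t : ℝ} (ht : t ∈ Icc a b) :
    (1 / 2) * deriv (X t) 1 * deriv (deriv (X t)) 1 = 0 := by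
  have h1 := h.pde t ht 1 ⟨zero_le_one, le_rfl⟩
  have h2 : HasDerivWithinAt (fun s => X s 1) 0 (Icc a b) t :=
    (hasDerivWithinAt_const t (Icc a b) (X a 1)).congr (fun s hs => h.right s hs) (h.right t ht)
  exact (uniqueDiffOn_Icc hab t ht).eq_deriv _ h1 h2

theorem slope_le (h : IsSol a b X) (hc : ContinuousOn (Function.uncurry X) (Icc a b ×ˢ Icc 0 1))
    {σ k : ℝ} (hk : 0 ≤ k)
    (h0 : ∀ x y, 0 ≤ x → x ≤ y → y ≤ 1 → σ * (X a y - X a x - k * (y - x)) ≤ 0) :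
    ∀ t ∈ Icc a b, ∀ x y, 0 ≤ x → x ≤ y → y ≤ 1 → σ * (X t y - X t x - k * (y - x)) ≤ 0 := by
  rcases eq_or_ne σ 0 with rfl | hσ
  · intros; simp
  have hcl : IsCompact {p : ℝ × ℝ | 0 ≤ p.1 ∧ p.1 ≤ p.2 ∧ p.2 ≤ 1} := by
    refine (isCompact_Icc (a := (0 : ℝ)) (b := 1)).prod (isCompact_Icc (a := (0 : ℝ)) (b := 1))
      |>.of_isClosed_subset ?_ ?_
    · exact (isClosed_le continuous_const continuous_fst).inter
        ((isClosed_le continuous_fst continuous_snd).inter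
          (isClosed_le continuous_snd continuous_const))
    · rintro p ⟨h1, h2, h3⟩
      exact ⟨⟨h1, h2.trans h3⟩, h1.trans h2, h3⟩
  have : CompactSpace {p : ℝ × ℝ | 0 ≤ p.1 ∧ p.1 ≤ p.2 ∧ p.2 ≤ 1} :=
    isCompact_iff_compactSpace.1 hcl
  have key := le_of_deriv_nonpos_at_max (κ := {p : ℝ × ℝ | 0 ≤ p.1 ∧ p.1 ≤ p.2 ∧ p.2 ≤ 1})
    (a := a) (b := b) (B := 0) (B' := 1)
    (f := fun t p => σ * (X t p.1.2 - X t p.1.1 - k * (p.1.2 - p.1.1))) zero_lt_one ?_ ?_ ?_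
  · intro t ht x y hx hxy hy
    exact key t ht ⟨(x, y), hx, hxy, hy⟩
  · have c1 : ContinuousOn (fun q : ℝ × {p : ℝ × ℝ | 0 ≤ p.1 ∧ p.1 ≤ p.2 ∧ p.2 ≤ 1} =>
        X q.1 q.2.1.1) (Icc a b ×ˢ univ) := by
      refine hc.comp (f := fun q : ℝ × {p : ℝ × ℝ | 0 ≤ p.1 ∧ p.1 ≤ p.2 ∧ p.2 ≤ 1} =>
        (q.1, q.2.1.1)) (by fun_prop) ?_
      rintro ⟨t, ⟨p, h1, h2, h3⟩⟩ ⟨ht, -⟩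
      exact ⟨ht, h1, h2.trans h3⟩
    have c2 : ContinuousOn (fun q : ℝ × {p : ℝ × ℝ | 0 ≤ p.1 ∧ p.1 ≤ p.2 ∧ p.2 ≤ 1} =>
        X q.1 q.2.1.2) (Icc a b ×ˢ univ) := by
      refine hc.comp (f := fun q : ℝ × {p : ℝ × ℝ | 0 ≤ p.1 ∧ p.1 ≤ p.2 ∧ p.2 ≤ 1} =>
        (q.1, q.2.1.2)) (by fun_prop) ?_
      rintro ⟨t, ⟨p, h1, h2, h3⟩⟩ ⟨ht, -⟩
      exact ⟨ht, h1.trans h2, h3⟩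
    exact continuousOn_const.mul ((c2.sub c1).sub (by fun_prop))
  · rintro ⟨⟨x, y⟩, h1, h2, h3⟩
    exact h0 x y h1 h2 h3
  · rintro t ht ⟨⟨x, y⟩, hx, hxy, hy⟩ hpos - hmax
    simp only [Subtype.forall, mem_ofPred_eq, Prod.forall] at hx hxy hy hpos hmax
    have hab : a < b := ht.1.trans_le ht.2
    have ht' : t ∈ Icc a b := ⟨ht.1.le, ht.2⟩
    have hlt : x < y := by
      rcases hxy.lt_or_eq with h | h
      · exact h
      · subst h; simp at hpos
    have hlin : ContDiff ℝ 2 (fun z : ℝ => k * z) := by fun_prop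
    have dlin : deriv (fun z : ℝ => k * z) = fun _ => k := by
      ext z; simp
    have hDy : σ * ((1 / 2) * deriv (X t) y * deriv (deriv (X t)) y) ≤ 0 := by
      rcases hy.lt_or_eq with hy | rfl
      · have := deriv_eq_of_isLocalMax_mul_sub (x := y) (h.smooth t ht') hlin hσ (by
          filter_upwards [Ioo_mem_nhds hlt hy] with z hz
          have := hmax x z ⟨hx, hz.1.le, hz.2.le⟩
          nlinarith)
        rw [dlin] at this
        simp only [deriv_const, sub_zero] at this
        rw [this.1]
        nlinarith [this.2]
      · rw [h.flux_eq_zero_right hab ht']; simp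
    have hDx : 0 ≤ σ * ((1 / 2) * deriv (X t) x * deriv (deriv (X t)) x) := by
      rcases hx.lt_or_eq with hx | rfl
      · have := deriv_eq_of_isLocalMax_mul_sub (x := x) (h.smooth t ht') hlin (neg_ne_zero.2 hσ) (by
          filter_upwards [Ioo_mem_nhds hx hlt] with z hz
          have := hmax z y ⟨hz.1.le, hz.2.le, hy⟩
          nlinarith)
        rw [dlin] at this
        simp only [deriv_const, sub_zero] at this
        rw [this.1]
        nlinarith [this.2]
      · rw [h.flux_eq_zero_left hab ht']; simp
    refine ⟨σ * ((1 / 2) * deriv (X t) y * deriv (deriv (X t)) y -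
      (1 / 2) * deriv (X t) x * deriv (deriv (X t)) x), by nlinarith, ?_⟩
    have hm : Icc a t ⊆ Icc a b := Icc_subset_Icc_right ht.2
    exact ((((h.pde t ht' y ⟨hx.trans hxy, hy⟩).mono hm).sub
      ((h.pde t ht' x ⟨hx, hxy.trans hy⟩).mono hm)).sub_const _).const_mul σ

end IsSol

theorem continuousOn_uncurry_of_monotone {S : Set ℝ} {Z : ℝ → ℝ → ℝ}
    (hm : ∀ t ∈ S, Monotone (Z t)) (hc : ∀ t ∈ S, Continuous (Z t))
    (ht : ∀ θ, ContinuousOn (fun t => Z t θ) S) :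
    ContinuousOn (Function.uncurry Z) (S ×ˢ univ) := by
  rintro ⟨t0, θ0⟩ ⟨ht0, -⟩
  simp only at ht0
  rw [ContinuousWithinAt, Metric.tendsto_nhds]
  intro ε hε
  obtain ⟨δ, hδ, h1⟩ := Metric.continuous_iff.1 (hc t0 ht0) θ0 (ε / 2) (half_pos hε)
  have hl := h1 (θ0 - δ / 2) (by rw [Real.dist_eq]; rw [abs_lt]; constructor <;> linarith)
  have hr := h1 (θ0 + δ / 2) (by rw [Real.dist_eq]; rw [abs_lt]; constructor <;> linarith)
  have e1 := Metric.tendsto_nhds.1 (ht (θ0 - δ / 2) t0 ht0) (ε / 2) (half_pos hε)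
  have e2 := Metric.tendsto_nhds.1 (ht (θ0 + δ / 2) t0 ht0) (ε / 2) (half_pos hε)
  have e3 : ∀ᶠ θ in 𝓝 θ0, θ ∈ Ioo (θ0 - δ / 2) (θ0 + δ / 2) :=
    Ioo_mem_nhds (by linarith) (by linarith)
  rw [nhdsWithin_prod_eq, nhdsWithin_univ]
  filter_upwards [((e1.and e2).and self_mem_nhdsWithin).prod_mk e3]
  rintro ⟨t, θ⟩ ⟨⟨⟨h2, h3⟩, hS⟩, h4, h5⟩
  simp only at h2 h3 hS h4 h5
  have m1 := hm t hS h4.le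
  have m2 := hm t hS h5.le
  simp only [Real.dist_eq, abs_lt, Function.uncurry] at hl hr h2 h3 ⊢
  constructor <;> linarith

theorem continuousOn_uncurry_of_monotoneOn {S : Set ℝ} {Z : ℝ → ℝ → ℝ}
    (hm : ∀ t ∈ S, MonotoneOn (Z t) (Icc 0 1)) (hc : ∀ t ∈ S, Continuous (Z t))
    (ht : ∀ θ ∈ Icc (0 : ℝ) 1, ContinuousOn (fun t => Z t θ) S) :
    ContinuousOn (Function.uncurry Z) (S ×ˢ Icc 0 1) := by
  have h01 : (0 : ℝ) ≤ 1 := zero_le_one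
  have key := continuousOn_uncurry_of_monotone (S := S)
    (Z := fun t θ => Z t (projIcc 0 1 h01 θ)) ?_ ?_ ?_
  · refine (key.mono (prod_mono_right (subset_univ _))).congr ?_
    rintro ⟨t, θ⟩ ⟨_, hθ⟩
    simp [Function.uncurry, projIcc_of_mem h01 hθ]
  · intro t htS x y hxy
    exact hm t htS (projIcc 0 1 h01 x).2 (projIcc 0 1 h01 y).2 (monotone_projIcc h01 hxy)
  · intro t htS
    exact (hc t htS).comp (continuous_subtype_val.comp continuous_projIcc)
  · intro θ
    exact ht _ (projIcc 0 1 h01 θ).2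

theorem exists_lipschitz_of_contDiff {f : ℝ → ℝ} (hf : ContDiff ℝ 2 f) :
    ∃ n : ℕ, ∀ x y, 0 ≤ x → x ≤ y → y ≤ 1 → |f y - f x| ≤ n * (y - x) := by
  have hc : Continuous (deriv f) := hf.continuous_deriv (by norm_num)
  obtain ⟨C, hC⟩ := isCompact_Icc.exists_bound_of_continuousOn (s := Icc (0 : ℝ) 1)
    hc.continuousOn
  obtain ⟨n, hn⟩ := exists_nat_ge C
  refine ⟨n, fun x y hx hxy hy => ?_⟩
  have := Convex.norm_image_sub_le_of_norm_deriv_le (f := f) (s := Icc (0 : ℝ) 1) (C := n)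
    (fun z _ => (hf.differentiable (by norm_num)) z) (fun z hz => (hC z hz).trans hn)
    (convex_Icc 0 1) ⟨hx, hxy.trans hy⟩ ⟨hx.trans hxy, hy⟩
  rwa [Real.norm_eq_abs, Real.norm_eq_abs, abs_of_nonneg (sub_nonneg.2 hxy)] at this

/-- Uniform spatial Lipschitz bound over the times in `S`. -/
def GoodOn (X : ℝ → ℝ → ℝ) (n : ℕ) (S : Set ℝ) : Prop :=
  ∀ t ∈ S, ∀ x y, 0 ≤ x → x ≤ y → y ≤ 1 → |X t y - X t x| ≤ n * (y - x)

theorem GoodOn.mono_nat {X : ℝ → ℝ → ℝ} {n m : ℕ} {S : Set ℝ} (h : GoodOn X n S) (hnm : n ≤ m) :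
    GoodOn X m S := fun t ht x y hx hxy hy =>
  (h t ht x y hx hxy hy).trans (mul_le_mul_of_nonneg_right (by exact_mod_cast hnm) (by linarith))

theorem GoodOn.union {X : ℝ → ℝ → ℝ} {n m : ℕ} {S S' : Set ℝ} (h : GoodOn X n S)
    (h' : GoodOn X m S') : GoodOn X (max n m) (S ∪ S') := by
  rintro t (ht | ht)
  · exact h.mono_nat (le_max_left _ _) t ht
  · exact h'.mono_nat (le_max_right _ _) t ht

theorem GoodOn.subset {X : ℝ → ℝ → ℝ} {n : ℕ} {S S' : Set ℝ} (h : GoodOn X n S)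
    (h' : S' ⊆ S) : GoodOn X n S' := fun t ht => h t (h' ht)

namespace IsSol

variable {a b : ℝ} {X : ℝ → ℝ → ℝ}

theorem continuousOn_time (h : IsSol a b X) {θ : ℝ} (hθ : θ ∈ Icc (0 : ℝ) 1) :
    ContinuousOn (fun t => X t θ) (Icc a b) :=
  fun t ht => (h.pde t ht θ hθ).continuousWithinAt

theorem continuousOn_of_sub_le (h : IsSol a b X) {L : ℝ}
    (hL : ∀ t ∈ Icc a b, ∀ x y, 0 ≤ x → x ≤ y → y ≤ 1 → X t x - X t y ≤ L * (y - x)) :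
    ContinuousOn (Function.uncurry X) (Icc a b ×ˢ Icc 0 1) := by
  have := continuousOn_uncurry_of_monotoneOn (S := Icc a b) (Z := fun t θ => X t θ + L * θ) ?_ ?_ ?_
  · have h2 : ContinuousOn (fun p : ℝ × ℝ => L * p.2) (Icc a b ×ˢ Icc 0 1) := by fun_prop
    refine (this.sub h2).congr ?_
    rintro ⟨t, θ⟩ _
    simp [Function.uncurry]
  · intro t ht x hx y hy hxy
    have := hL t ht x y hx.1 hxy hy.2
    simp only
    linarith
  · intro t ht
    exact (h.smooth t ht).continuous.add (by fun_prop)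
  · intro θ hθ
    exact (h.continuousOn_time hθ).add continuousOn_const

theorem continuousOn_of_goodOn (h : IsSol a b X) {n : ℕ} (hn : GoodOn X n (Icc a b)) :
    ContinuousOn (Function.uncurry X) (Icc a b ×ˢ Icc 0 1) :=
  h.continuousOn_of_sub_le (L := n) fun t ht x y hx hxy hy => by
    have := (abs_le.1 (hn t ht x y hx hxy hy)).1
    linarith

theorem sub_le_backward (h : IsSol a b X)
    (hc : ContinuousOn (Function.uncurry X) (Icc a b ×ˢ Icc 0 1)) {k : ℝ} (hk : 0 ≤ k)
    (h0 : ∀ x y, 0 ≤ x → x ≤ y → y ≤ 1 → X b x - X b y ≤ k * (y - x)) :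
    ∀ t ∈ Icc a b, ∀ x y, 0 ≤ x → x ≤ y → y ≤ 1 → X t x - X t y ≤ k * (y - x) := by
  have hc' : ContinuousOn (Function.uncurry fun t θ => -X (a + b - t) θ)
      (Icc a b ×ˢ Icc 0 1) := by
    refine (hc.comp (f := fun p : ℝ × ℝ => (a + b - p.1, p.2)) (by fun_prop) ?_).neg
    rintro ⟨t, θ⟩ ⟨ht, hθ⟩
    exact ⟨⟨by linarith [ht.2], by linarith [ht.1]⟩, hθ⟩
  have key := h.reverse.slope_le hc' (σ := 1) hk (by
    intro x y hx hxy hy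
    have := h0 x y hx hxy hy
    simp only [add_sub_cancel_left]
    linarith)
  intro t ht x y hx hxy hy
  have := key (a + b - t) ⟨by linarith [ht.2], by linarith [ht.1]⟩ x y hx hxy hy
  simp only [sub_sub_cancel] at this
  linarith

theorem goodOn_of_endpoints (h : IsSol a b X) {n m : ℕ} (hm : GoodOn X m (Icc a b))
    (hn : GoodOn X n {a, b}) : GoodOn X n (Icc a b) := by
  have hc := h.continuousOn_of_goodOn hm
  have h1 := h.sub_le_backward hc (Nat.cast_nonneg n) (fun x y hx hxy hy => by
    have := (abs_le.1 (hn b (by simp) x y hx hxy hy)).1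
    linarith)
  have h2 := h.slope_le hc (σ := 1) (Nat.cast_nonneg n) (fun x y hx hxy hy => by
    have := (abs_le.1 (hn a (by simp) x y hx hxy hy)).2
    linarith)
  intro t ht x y hx hxy hy
  have := h1 t ht x y hx hxy hy
  have := h2 t ht x y hx hxy hy
  rw [abs_le]
  constructor <;> linarith

theorem exists_goodOn_of_Ioc (h : IsSol a b X) (hab : a < b)
    (hg : ∀ a' ∈ Ioc a b, ∃ n, GoodOn X n (Icc a' b)) : ∃ n, GoodOn X n (Icc a b) := by
  obtain ⟨na, hna⟩ := exists_lipschitz_of_contDiff (h.smooth a ⟨le_rfl, hab.le⟩)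
  obtain ⟨nb, hnb⟩ := exists_lipschitz_of_contDiff (h.smooth b ⟨hab.le, le_rfl⟩)
  set L := max na nb
  have hE : GoodOn X L {a, b} := by
    rintro t (rfl | rfl) x y hx hxy hy
    · exact (hna x y hx hxy hy).trans (mul_le_mul_of_nonneg_right
        (by exact_mod_cast le_max_left na nb) (by linarith))
    · exact (hnb x y hx hxy hy).trans (mul_le_mul_of_nonneg_right
        (by exact_mod_cast le_max_right na nb) (by linarith))
  have hD : ∀ t ∈ Icc a b, ∀ x y, 0 ≤ x → x ≤ y → y ≤ 1 → X t x - X t y ≤ L * (y - x) := by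
    intro t ht x y hx hxy hy
    rcases ht.1.lt_or_eq with hat | rfl
    · obtain ⟨n, hn⟩ := hg t ⟨hat, ht.2⟩
      have hs := h.mono hat.le le_rfl
      refine hs.sub_le_backward (hs.continuousOn_of_goodOn hn) (Nat.cast_nonneg L) ?_ t
        ⟨le_rfl, ht.2⟩ x y hx hxy hy
      intro x y hx hxy hy
      have := (abs_le.1 (hE b (by simp) x y hx hxy hy)).1
      linarith
    · have := (abs_le.1 (hE a (by simp) x y hx hxy hy)).1
      linarith
  have hc := h.continuousOn_of_sub_le hD
  have hU := h.slope_le hc (σ := 1) (Nat.cast_nonneg L) (fun x y hx hxy hy => by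
    have := (abs_le.1 (hE a (by simp) x y hx hxy hy)).2
    linarith)
  refine ⟨L, fun t ht x y hx hxy hy => ?_⟩
  have := hD t ht x y hx hxy hy
  have := hU t ht x y hx hxy hy
  rw [abs_le]
  constructor <;> linarith

theorem goodOn_reverse {n : ℕ} {p q : ℝ} (c : ℝ) (h : GoodOn X n (Icc p q)) :
    GoodOn (fun t θ => -X (c - t) θ) n (Icc (c - q) (c - p)) := by
  intro t ht x y hx hxy hy
  have := h (c - t) ⟨by linarith [ht.2], by linarith [ht.1]⟩ x y hx hxy hy
  rwa [neg_sub_neg, abs_sub_comm]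

theorem goodOn_of_reverse {n : ℕ} {p q : ℝ} (c : ℝ)
    (h : GoodOn (fun t θ => -X (c - t) θ) n (Icc (c - q) (c - p))) :
    GoodOn X n (Icc p q) := by
  have := goodOn_reverse c h
  simpa using this

theorem exists_goodOn_of_Ico (h : IsSol a b X) (hab : a < b)
    (hg : ∀ b' ∈ Ico a b, ∃ n, GoodOn X n (Icc a b')) : ∃ n, GoodOn X n (Icc a b) := by
  obtain ⟨n, hn⟩ := h.reverse.exists_goodOn_of_Ioc hab (by
    intro a' ha'
    obtain ⟨n, hn⟩ := hg (a + b - a') ⟨by linarith [ha'.2], by linarith [ha'.1]⟩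
    have := goodOn_reverse (a + b) hn
    exact ⟨n, by simpa using this⟩)
  exact ⟨n, goodOn_of_reverse (a + b) (by simpa using hn)⟩

theorem goodOn_of_gap (h : IsSol a b X) (hab : a < b)
    (hg : ∀ p q, a < p → q < b → ∃ n, GoodOn X n (Icc p q)) {n : ℕ} (hn : GoodOn X n {a, b}) :
    GoodOn X n (Icc a b) := by
  obtain ⟨c, hac, hcb⟩ := exists_between hab
  obtain ⟨n1, h1⟩ := (h.mono le_rfl hcb.le).exists_goodOn_of_Ioc hac
    (fun a' ha' => hg a' c ha'.1 hcb)
  obtain ⟨n2, h2⟩ := (h.mono hac.le le_rfl).exists_goodOn_of_Ico hcb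
    (fun b' hb' => hg c b' hac hb'.2)
  have := h1.union h2
  rw [Icc_union_Icc_eq_Icc hac.le hcb.le] at this
  exact h.goodOn_of_endpoints this hn

theorem exists_goodOn_right (h : IsSol a b X) (hab : a < b) {F : Set ℝ} (hF : IsClosed F)
    (haF : a ∈ F) {n : ℕ} (hn : GoodOn X n (F ∩ Icc a b))
    (hg : ∀ p q, a ≤ p → q ≤ b → (∀ t ∈ Icc p q, t ∉ F) → ∃ n, GoodOn X n (Icc p q)) :
    ∃ c ∈ Ioc a b, ∃ m, GoodOn X m (Icc a c) := by
  by_cases hex : ∃ e ∈ F, e ∈ Ioc a b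
  · obtain ⟨e, heF, he⟩ := hex
    refine ⟨e, he, n, fun t ht => ?_⟩
    by_cases htF : t ∈ F
    · exact hn t ⟨htF, ht.1, ht.2.trans he.2⟩
    obtain ⟨p, ⟨hpF, hp⟩, hpg⟩ := ((isCompact_Icc (a := a) (b := t)).inter_left hF).exists_isGreatest
      ⟨a, haF, le_rfl, ht.1⟩
    obtain ⟨q, ⟨hqF, hq⟩, hql⟩ := ((isCompact_Icc (a := t) (b := e)).inter_left hF).exists_isLeast
      ⟨e, heF, ht.2, le_rfl⟩
    have hpt : p < t := hp.2.lt_of_ne (fun h => htF (h ▸ hpF))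
    have htq : t < q := hq.1.lt_of_ne (fun h => htF (h ▸ hqF))
    refine (h.mono hp.1 (hq.2.trans he.2)).goodOn_of_gap (hpt.trans htq) ?_ ?_ t
      ⟨hpt.le, htq.le⟩
    · intro p' q' hp' hq'
      refine hg p' q' (hp.1.trans hp'.le) (hq'.le.trans (hq.2.trans he.2)) ?_
      intro s hs hsF
      rcases le_total s t with hst | hst
      · have := hpg ⟨hsF, hp.1.trans (hp'.le.trans hs.1), hst⟩
        linarith [hs.1]
      · have := hql ⟨hsF, hst, hs.2.trans (hq'.le.trans hq.2)⟩
        linarith [hs.2]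
    · refine hn.subset ?_
      rintro s (rfl | rfl)
      · exact ⟨hpF, hp.1, hp.2.trans (ht.2.trans he.2)⟩
      · exact ⟨hqF, ht.1.trans hq.1, hq.2.trans he.2⟩
  · push Not at hex
    refine ⟨b, ⟨hab, le_rfl⟩, h.exists_goodOn_of_Ioc hab fun a' ha' => ?_⟩
    exact hg a' b ha'.1.le le_rfl fun t ht htF => hex t htF ⟨ha'.1.trans_le ht.1, ht.2⟩

theorem exists_goodOn_left (h : IsSol a b X) (hab : a < b) {F : Set ℝ} (hF : IsClosed F)
    (hbF : b ∈ F) {n : ℕ} (hn : GoodOn X n (F ∩ Icc a b))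
    (hg : ∀ p q, a ≤ p → q ≤ b → (∀ t ∈ Icc p q, t ∉ F) → ∃ n, GoodOn X n (Icc p q)) :
    ∃ c ∈ Ico a b, ∃ m, GoodOn X m (Icc c b) := by
  obtain ⟨c, hc, m, hm⟩ := h.reverse.exists_goodOn_right hab (F := (fun t => a + b - t) ⁻¹' F)
    (hF.preimage (by fun_prop)) (by simpa using hbF) (n := n) (by
      rintro t ⟨htF, ht⟩ x y hx hxy hy
      have := hn (a + b - t) ⟨htF, by linarith [ht.2], by linarith [ht.1]⟩ x y hx hxy hy
      rwa [neg_sub_neg, abs_sub_comm]) (by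
      intro p q hp hq hpq
      obtain ⟨n, hn⟩ := hg (a + b - q) (a + b - p) (by linarith) (by linarith) (by
        intro t ht htF
        exact hpq (a + b - t) ⟨by linarith [ht.2], by linarith [ht.1]⟩ (by simpa using htF))
      have := goodOn_reverse (a + b) hn
      exact ⟨n, by simpa using this⟩)
  refine ⟨a + b - c, ⟨by linarith [hc.2], by linarith [hc.1]⟩, m, ?_⟩
  exact goodOn_of_reverse (a + b) (by simpa using hm)

theorem exists_goodOn (h : IsSol a b X) : ∃ n, GoodOn X n (Icc a b) := by
  set E : Set ℝ := {t | t ∈ Icc a b ∧ ∀ U ∈ 𝓝 t, ∀ n, ¬ GoodOn X n (U ∩ Icc a b)} with hE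
  have hEsub : E ⊆ Icc a b := fun t ht => ht.1
  have hlocal : ∀ S ⊆ Icc a b, IsCompact S → (∀ t ∈ S, t ∉ E) → ∃ n, GoodOn X n S := by
    intro S hS hSc hSE
    refine hSc.induction_on (p := fun S => ∃ n, GoodOn X n S) ⟨0, fun t ht => ht.elim⟩ ?_ ?_ ?_
    · rintro s t hst ⟨n, hn⟩
      exact ⟨n, hn.subset hst⟩
    · rintro s t ⟨n, hn⟩ ⟨m, hm⟩
      exact ⟨_, hn.union hm⟩
    · intro t ht
      have := hSE t ht
      simp only [hE, mem_ofPred_eq, not_and, not_forall, not_not] at this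
      obtain ⟨U, hU, n, hn⟩ := this (hS ht)
      exact ⟨U ∩ S, inter_comm S U ▸ inter_mem_nhdsWithin S hU, n, hn.subset (inter_subset_inter_right _ hS)⟩
  have hEclosed : IsClosed E := by
    rw [← isOpen_compl_iff, isOpen_iff_mem_nhds]
    intro t ht
    by_cases htI : t ∈ Icc a b
    · simp only [hE, mem_compl_iff, mem_ofPred_eq, not_and, not_forall, not_not] at ht
      obtain ⟨U, hU, n, hn⟩ := ht htI
      filter_upwards [eventually_mem_nhds_iff.2 hU] with s hs hsE
      exact hsE.2 U hs n hn
    · filter_upwards [isClosed_Icc.isOpen_compl.mem_nhds htI] with s hs hsE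
      exact hs hsE.1
  suffices hemp : ¬ E.Nonempty by
    exact hlocal _ subset_rfl isCompact_Icc fun t _ htE => hemp ⟨t, htE⟩
  intro hne
  have hlip : ∀ n : ℕ, IsClosed {t : E | ∀ x y, 0 ≤ x → x ≤ y → y ≤ 1 →
      |X t y - X t x| ≤ n * (y - x)} := by
    intro n
    have : ∀ θ ∈ Icc (0 : ℝ) 1, Continuous fun t : E => X t θ := fun θ hθ =>
      ((h.continuousOn_time hθ).mono hEsub).domRestrict
    simp only [ofPred_forall]
    refine isClosed_iInter fun x => isClosed_iInter fun y => isClosed_iInter fun hx =>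
      isClosed_iInter fun hxy => isClosed_iInter fun hy => ?_
    exact isClosed_le ((this y ⟨hx.trans hxy, hy⟩).sub (this x ⟨hx, hxy.trans hy⟩)).abs
      continuous_const
  have : Nonempty E := hne.to_subtype
  have : CompleteSpace E := hEclosed.completeSpace_coe
  obtain ⟨n, ⟨e, heE⟩, hint⟩ := nonempty_interior_of_iUnion_of_closed hlip (by
    rw [eq_univ_iff_forall]
    intro t
    obtain ⟨n, hn⟩ := exists_lipschitz_of_contDiff (h.smooth t (hEsub t.2))
    exact mem_iUnion.2 ⟨n, hn⟩)
  rw [mem_interior_iff_mem_nhds, Metric.mem_nhds_iff] at hint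
  obtain ⟨ε, hε, hball⟩ := hint
  have hgood : ∀ t ∈ E, |t - e| < ε → ∀ x y, 0 ≤ x → x ≤ y → y ≤ 1 →
      |X t y - X t x| ≤ n * (y - x) := fun t ht hte =>
    hball (show (⟨t, ht⟩ : E) ∈ Metric.ball ⟨e, heE⟩ ε from hte)
  have heI := hEsub heE
  have hgap : ∀ p q, a ≤ p → q ≤ b → (∀ t ∈ Icc p q, t ∉ E) → ∃ n, GoodOn X n (Icc p q) :=
    fun p q hp hq => hlocal _ (Icc_subset_Icc hp hq) isCompact_Icc
  have hR : ∃ c > e, ∃ m, GoodOn X m (Icc e c ∩ Icc a b) := by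
    rcases heI.2.lt_or_eq with hlt | heq
    · set b' := min b (e + ε / 2)
      have h1 : e < b' := lt_min hlt (by linarith)
      have h2 : b' ≤ b := min_le_left _ _
      have h3 : b' ≤ e + ε / 2 := min_le_right _ _
      obtain ⟨c, hc, m, hm⟩ := (h.mono heI.1 h2).exists_goodOn_right h1 hEclosed heE (n := n)
        (fun t ht => hgood t ht.1 (by
          have := ht.2.1; have := ht.2.2
          rw [abs_lt]; constructor <;> linarith))
        (fun p q hp hq => hgap p q (heI.1.trans hp) (hq.trans h2))
      exact ⟨c, hc.1, m, hm.subset inter_subset_left⟩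
    · refine ⟨e + 1, by linarith, n, fun t ht => ?_⟩
      have : t = e := le_antisymm (by linarith [ht.2.2]) ht.1.1
      rw [this]
      exact hgood e heE (by simpa using hε)
  have hL : ∃ c < e, ∃ m, GoodOn X m (Icc c e ∩ Icc a b) := by
    rcases heI.1.lt_or_eq with hlt | heq
    · set a' := max a (e - ε / 2)
      have h1 : a' < e := max_lt hlt (by linarith)
      have h2 : a ≤ a' := le_max_left _ _
      have h3 : e - ε / 2 ≤ a' := le_max_right _ _
      obtain ⟨c, hc, m, hm⟩ := (h.mono h2 heI.2).exists_goodOn_left h1 hEclosed heE (n := n)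
        (fun t ht => hgood t ht.1 (by
          have := ht.2.1; have := ht.2.2
          rw [abs_lt]; constructor <;> linarith))
        (fun p q hp hq => hgap p q (h2.trans hp) (hq.trans heI.2))
      exact ⟨c, hc.2, m, hm.subset inter_subset_left⟩
    · refine ⟨e - 1, by linarith, n, fun t ht => ?_⟩
      have : t = e := le_antisymm ht.1.2 (by linarith [ht.2.1])
      rw [this]
      exact hgood e heE (by simpa using hε)
  obtain ⟨c, hc, m, hm⟩ := hR
  obtain ⟨c', hc', m', hm'⟩ := hL
  refine heE.2 (Icc c' c) (Icc_mem_nhds hc' hc) (max m' m) ((hm'.union hm).subset ?_)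
  rintro t ⟨ht, htI⟩
  rcases le_total t e with hte | hte
  · exact Or.inl ⟨⟨ht.1, hte⟩, htI⟩
  · exact Or.inr ⟨⟨hte, ht.2⟩, htI⟩

theorem continuousOn (h : IsSol a b X) :
    ContinuousOn (Function.uncurry X) (Icc a b ×ˢ Icc 0 1) :=
  let ⟨_, hn⟩ := h.exists_goodOn
  h.continuousOn_of_goodOn hn

end IsSol

/-- A global solution with Dirichlet data `0, 1` and initial slope in `[c, C]`, initial second
derivative bounded by `K`. -/
structure GlobalSol (c C K : ℝ) (X : ℝ → ℝ → ℝ) : Prop where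
  smooth : ∀ t, 0 ≤ t → ContDiff ℝ 2 (X t)
  pde : ∀ t, 0 ≤ t → ∀ θ ∈ Icc (0 : ℝ) 1, HasDerivAt (fun s => X s θ)
    ((1 / 2) * deriv (X t) θ * deriv (deriv (X t)) θ) t
  bdry : ∀ t, 0 ≤ t → X t 0 = 0 ∧ X t 1 = 1
  c_pos : 0 < c
  C_pos : 0 < C
  K_pos : 0 < K
  slope_zero : ∀ θ ∈ Icc (0 : ℝ) 1, c ≤ deriv (X 0) θ ∧ deriv (X 0) θ ≤ C
  curv_zero : ∀ θ ∈ Icc (0 : ℝ) 1, |deriv (deriv (X 0)) θ| ≤ K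

namespace GlobalSol

variable {c C K : ℝ} {X : ℝ → ℝ → ℝ}

theorem isSol (h : GlobalSol c C K X) {a : ℝ} (ha : 0 ≤ a) (b : ℝ) : IsSol a b X where
  smooth t ht := h.smooth t (ha.trans ht.1)
  pde t ht θ hθ := (h.pde t (ha.trans ht.1) θ hθ).hasDerivWithinAt
  left t ht := by rw [(h.bdry t (ha.trans ht.1)).1, (h.bdry a ha).1]
  right t ht := by rw [(h.bdry t (ha.trans ht.1)).2, (h.bdry a ha).2]

theorem slope_zero_bounds (h : GlobalSol c C K X) {x y : ℝ} (hx : 0 ≤ x) (hxy : x ≤ y)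
    (hy : y ≤ 1) : c * (y - x) ≤ X 0 y - X 0 x ∧ X 0 y - X 0 x ≤ C * (y - x) := by
  have hd := (h.smooth 0 le_rfl).differentiable (by norm_num)
  have hm : ∀ z ∈ interior (Icc (0 : ℝ) 1), z ∈ Icc (0 : ℝ) 1 := fun z hz => interior_subset hz
  exact ⟨Convex.mul_sub_le_image_sub_of_le_deriv (convex_Icc 0 1) hd.continuous.continuousOn
      hd.differentiableOn (fun z hz => (h.slope_zero z (hm z hz)).1) x ⟨hx, hxy.trans hy⟩ y
      ⟨hx.trans hxy, hy⟩ hxy,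
    Convex.image_sub_le_mul_sub_of_deriv_le (convex_Icc 0 1) hd.continuous.continuousOn
      hd.differentiableOn (fun z hz => (h.slope_zero z (hm z hz)).2) x ⟨hx, hxy.trans hy⟩ y
      ⟨hx.trans hxy, hy⟩ hxy⟩

theorem slope_bounds (h : GlobalSol c C K X) {t x y : ℝ} (ht : 0 ≤ t) (hx : 0 ≤ x) (hxy : x ≤ y)
    (hy : y ≤ 1) : c * (y - x) ≤ X t y - X t x ∧ X t y - X t x ≤ C * (y - x) := by
  have hs := h.isSol le_rfl t
  constructor
  · have := hs.slope_le hs.continuousOn (σ := -1) h.c_pos.le (fun x y hx hxy hy => by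
      have := (h.slope_zero_bounds hx hxy hy).1
      linarith) t ⟨ht, le_rfl⟩ x y hx hxy hy
    linarith
  · have := hs.slope_le hs.continuousOn (σ := 1) h.C_pos.le (fun x y hx hxy hy => by
      have := (h.slope_zero_bounds hx hxy hy).2
      linarith) t ⟨ht, le_rfl⟩ x y hx hxy hy
    linarith

theorem deriv_bounds (h : GlobalSol c C K X) {t θ : ℝ} (ht : 0 ≤ t) (hθ : θ ∈ Ioc (0 : ℝ) 1) :
    c ≤ deriv (X t) θ ∧ deriv (X t) θ ≤ C := by
  have hd := ((h.smooth t ht).differentiable (by norm_num) θ).hasDerivAt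
  have hl : ∀ k : ℝ, HasDerivAt (fun x => k * x) k θ := fun k => by
    simpa using (hasDerivAt_id θ).const_mul k
  constructor
  · have := hasDerivWithinAt_nonneg_of_le_right (a := 0) hθ.1 (hd.sub (hl c)).hasDerivWithinAt
      (fun s hs => by
        have := (h.slope_bounds ht hs.1 hs.2 hθ.2).1
        simp only [Pi.sub_apply]
        linarith)
    linarith
  · have := hasDerivWithinAt_nonneg_of_le_right (a := 0) hθ.1 ((hl C).sub hd).hasDerivWithinAt
      (fun s hs => by
        have := (h.slope_bounds ht hs.1 hs.2 hθ.2).2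
        simp only [Pi.sub_apply]
        linarith)
    linarith

theorem continuousOn (h : GlobalSol c C K X) :
    ContinuousOn (Function.uncurry X) (Ici 0 ×ˢ Icc 0 1) := by
  rintro ⟨t, θ⟩ ⟨ht, hθ⟩
  have ht : 0 ≤ t := ht
  have := (h.isSol le_rfl (t + 1)).continuousOn (t, θ) ⟨⟨ht, by linarith⟩, hθ⟩
  refine this.mono_of_mem_nhdsWithin ?_
  rw [nhdsWithin_prod_eq]
  refine prod_mem_prod ?_ self_mem_nhdsWithin
  filter_upwards [self_mem_nhdsWithin, mem_nhdsWithin_of_mem_nhds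
    (Iio_mem_nhds (lt_add_one t))] with s h1 h2 using ⟨h1, le_of_lt h2⟩

theorem sub_zero_le (h : GlobalSol c C K X) {σ : ℝ} (hσ : σ = 1 ∨ σ = -1) {t θ : ℝ} (ht : 0 ≤ t)
    (hθ : θ ∈ Icc (0 : ℝ) 1) : σ * (X t θ - X 0 θ) ≤ C * K / 2 * t := by
  have key := le_of_deriv_nonpos_at_max (κ := Icc (0 : ℝ) 1) (a := 0) (b := t) (B := 0) (B' := 1)
    (f := fun s θ => σ * (X s θ - X 0 θ) - C * K / 2 * s) zero_lt_one ?_ ?_ ?_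
    t ⟨ht, le_rfl⟩ ⟨θ, hθ⟩
  · simpa using key
  · have c1 : ContinuousOn (fun q : ℝ × Icc (0 : ℝ) 1 => X q.1 q.2) (Icc 0 t ×ˢ univ) := by
      refine h.continuousOn.comp (f := fun q : ℝ × Icc (0 : ℝ) 1 => (q.1, (q.2 : ℝ)))
        (by fun_prop) ?_
      rintro ⟨s, x⟩ ⟨hs, -⟩
      exact ⟨hs.1, x.2⟩
    have c2 : Continuous (X 0) := (h.smooth 0 le_rfl).continuous
    exact (continuousOn_const.mul (c1.sub (by fun_prop))).sub (by fun_prop)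
  · intro θ; simp
  · rintro s hs ⟨x, hx0, hx1⟩ hpos - hmax
    simp only [Subtype.forall] at hpos hmax
    have hs0 : 0 ≤ s := hs.1.le
    have hCK : 0 ≤ C * K / 2 * s := by
      have := h.C_pos; have := h.K_pos; positivity
    have hx0 : 0 < x := hx0.lt_of_ne (by
      rintro rfl
      rw [(h.bdry s hs0).1, (h.bdry 0 le_rfl).1] at hpos
      linarith)
    have hx1 : x < 1 := hx1.lt_of_ne (by
      rintro rfl
      rw [(h.bdry s hs0).2, (h.bdry 0 le_rfl).2] at hpos
      linarith)
    have hx : x ∈ Icc (0 : ℝ) 1 := ⟨hx0.le, hx1.le⟩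
    obtain ⟨e1, e2⟩ := deriv_eq_of_isLocalMax_mul_sub (x := x) (h.smooth s hs0)
      (h.smooth 0 le_rfl) (σ := σ) (by rcases hσ with rfl | rfl <;> norm_num) (by
        filter_upwards [Ioo_mem_nhds hx0 hx1] with z hz
        have := hmax z ⟨hz.1.le, hz.2.le⟩
        linarith)
    obtain ⟨b1, b2⟩ := h.slope_zero x hx
    have b3 := abs_le.1 (h.curv_zero x hx)
    have b4 := h.c_pos
    have b5 := h.K_pos
    refine ⟨σ * ((1 / 2) * deriv (X s) x * deriv (deriv (X s)) x - 0) - C * K / 2 * 1, ?_, ?_⟩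
    · rw [e1]
      set p := deriv (X 0) x
      have hq : σ * deriv (deriv (X s)) x ≤ K := by
        rcases hσ with rfl | rfl <;> linarith
      have : p * (σ * deriv (deriv (X s)) x) ≤ p * K :=
        mul_le_mul_of_nonneg_left hq (by linarith)
      have : p * K ≤ C * K := mul_le_mul_of_nonneg_right b2 b5.le
      linarith
    · exact ((((h.pde s hs0 x hx).hasDerivWithinAt).sub (hasDerivWithinAt_const _ _ _)).const_mul
        σ).sub (((hasDerivAt_id s).const_mul _).hasDerivWithinAt)

theorem sub_shift_le (h : GlobalSol c C K X) {σ : ℝ} (hσ : σ = 1 ∨ σ = -1) {t θ r : ℝ}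
    (ht : 0 ≤ t) (hr : 0 ≤ r) (hθ : θ ∈ Icc (0 : ℝ) 1) :
    σ * (X (t + r) θ - X t θ) ≤ C * K / 2 * r := by
  have hCK : 0 ≤ C * K / 2 * r := by
    have := h.C_pos; have := h.K_pos; positivity
  have key := le_of_deriv_nonpos_at_max (κ := Icc (0 : ℝ) 1) (a := 0) (b := t)
    (B := C * K / 2 * r) (B' := C * K / 2 * r + 1)
    (f := fun s θ => σ * (X (s + r) θ - X s θ)) (lt_add_one _) ?_ ?_ ?_
    t ⟨ht, le_rfl⟩ ⟨θ, hθ⟩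
  · simpa using key
  · have c1 : ContinuousOn (fun q : ℝ × Icc (0 : ℝ) 1 => X q.1 q.2) (Icc 0 t ×ˢ univ) := by
      refine h.continuousOn.comp (f := fun q : ℝ × Icc (0 : ℝ) 1 => (q.1, (q.2 : ℝ)))
        (by fun_prop) ?_
      rintro ⟨s, x⟩ ⟨hs, -⟩
      exact ⟨hs.1, x.2⟩
    have c2 : ContinuousOn (fun q : ℝ × Icc (0 : ℝ) 1 => X (q.1 + r) q.2) (Icc 0 t ×ˢ univ) := by
      refine h.continuousOn.comp (f := fun q : ℝ × Icc (0 : ℝ) 1 => (q.1 + r, (q.2 : ℝ)))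
        (by fun_prop) ?_
      rintro ⟨s, x⟩ ⟨hs, -⟩
      exact ⟨add_nonneg hs.1 hr, x.2⟩
    exact continuousOn_const.mul (c2.sub c1)
  · intro θ
    simpa using h.sub_zero_le hσ hr θ.2
  · rintro s hs ⟨x, hx0, hx1⟩ hpos - hmax
    simp only [Subtype.forall] at hpos hmax
    have hs0 : 0 ≤ s := hs.1.le
    have hsr : 0 ≤ s + r := by linarith
    have hx0 : 0 < x := hx0.lt_of_ne (by
      rintro rfl
      rw [(h.bdry s hs0).1, (h.bdry _ hsr).1] at hpos
      linarith)
    have hx1 : x < 1 := hx1.lt_of_ne (by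
      rintro rfl
      rw [(h.bdry s hs0).2, (h.bdry _ hsr).2] at hpos
      linarith)
    have hx : x ∈ Icc (0 : ℝ) 1 := ⟨hx0.le, hx1.le⟩
    obtain ⟨e1, e2⟩ := deriv_eq_of_isLocalMax_mul_sub (x := x) (h.smooth _ hsr)
      (h.smooth s hs0) (σ := σ) (by rcases hσ with rfl | rfl <;> norm_num) (by
        filter_upwards [Ioo_mem_nhds hx0 hx1] with z hz
        have := hmax z ⟨hz.1.le, hz.2.le⟩
        linarith)
    have b1 := (h.deriv_bounds hs0 ⟨hx0, hx1.le⟩).1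
    have b4 := h.c_pos
    refine ⟨σ * ((1 / 2) * deriv (X (s + r)) x * deriv (deriv (X (s + r))) x -
      (1 / 2) * deriv (X s) x * deriv (deriv (X s)) x), ?_, ?_⟩
    · rw [e1]
      have := mul_nonpos_of_nonneg_of_nonpos (b4.le.trans b1) e2
      linarith
    · have hsh : HasDerivAt (fun s => X (s + r) x)
          ((1 / 2) * deriv (X (s + r)) x * deriv (deriv (X (s + r))) x) s :=
        (h.pde _ hsr x hx).comp_add_const s r
      exact ((hsh.sub (h.pde s hs0 x hx)).const_mul σ).hasDerivWithinAt

theorem abs_flux_le (h : GlobalSol c C K X) {t θ : ℝ} (ht : 0 ≤ t) (hθ : θ ∈ Icc (0 : ℝ) 1) :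
    |(1 / 2) * deriv (X t) θ * deriv (deriv (X t)) θ| ≤ C * K / 2 := by
  have hC := h.C_pos
  have hK := h.K_pos
  have hlip : ∀ s r, 0 ≤ s → 0 ≤ r → |X (s + r) θ - X s θ| ≤ C * K / 2 * r := fun s r hs hr => by
    have h1 := h.sub_shift_le (Or.inl rfl) hs hr hθ
    have h2 := h.sub_shift_le (Or.inr rfl) hs hr hθ
    rw [abs_le]; constructor <;> linarith
  rcases ht.lt_or_eq with htp | rfl
  · refine (h.pde t ht θ hθ).le_of_lip' (by positivity) ?_
    filter_upwards [Ioi_mem_nhds htp] with s hs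
    rw [Real.norm_eq_abs, Real.norm_eq_abs]
    rcases le_total t s with hts | hts
    · have := hlip t (s - t) ht (sub_nonneg.2 hts)
      rw [abs_of_nonneg (sub_nonneg.2 hts)]
      simpa using this
    · have := hlip s (t - s) (le_of_lt hs) (sub_nonneg.2 hts)
      rw [abs_sub_comm, abs_sub_comm s, abs_of_nonneg (sub_nonneg.2 hts)]
      simpa using this
  · obtain ⟨b1, b2⟩ := h.slope_zero θ hθ
    have := h.c_pos
    rw [abs_mul, abs_mul, abs_of_pos (by linarith : 0 < deriv (X 0) θ)]
    have := mul_le_mul b2 (h.curv_zero θ hθ) (abs_nonneg _) hC.le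
    norm_num
    linarith

theorem abs_curv_le (h : GlobalSol c C K X) {t θ : ℝ} (ht : 0 ≤ t) (hθ : θ ∈ Ioc (0 : ℝ) 1) :
    |deriv (deriv (X t)) θ| ≤ C * K / c := by
  have h1 := h.abs_flux_le ht ⟨hθ.1.le, hθ.2⟩
  have h2 := (h.deriv_bounds ht hθ).1
  have hc := h.c_pos
  rw [abs_mul, abs_mul, abs_of_pos (by linarith : 0 < deriv (X t) θ), abs_of_pos (by norm_num)]
    at h1
  rw [le_div_iff₀ hc]
  nlinarith [abs_nonneg (deriv (deriv (X t)) θ)]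

end GlobalSol

theorem le_of_deriv_nonpos_at_max_finite {κ : Type*} [Finite κ] {a b B B' : ℝ}
    {f f' : ℝ → κ → ℝ} (hB : B < B')
    (hf : ∀ t ∈ Icc a b, ∀ k, HasDerivWithinAt (fun s => f s k) (f' t k) (Icc a b) t)
    (h0 : ∀ k, f a k ≤ B)
    (h : ∀ t ∈ Icc a b, ∀ k, B < f t k → f t k < B' → (∀ j, f t j ≤ f t k) → f' t k ≤ 0) :
    ∀ t ∈ Icc a b, ∀ k, f t k ≤ B := by
  let _ : TopologicalSpace κ := ⊥
  have : DiscreteTopology κ := ⟨rfl⟩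
  refine le_of_deriv_nonpos_at_max hB ?_ h0 ?_
  · rintro ⟨t, k⟩ ⟨ht, -⟩
    have h1 : ContinuousWithinAt (fun s => f s k) (Icc a b) t := (hf t ht k).continuousWithinAt
    rw [ContinuousWithinAt, nhdsWithin_prod_eq, nhdsWithin_univ, nhds_discrete, prod_pure,
      tendsto_map'_iff]
    exact h1
  · intro t ht k hk hk' hmax
    exact ⟨_, h t ⟨ht.1.le, ht.2⟩ k hk hk' hmax,
      (hf t ⟨ht.1.le, ht.2⟩ k).mono (Icc_subset_Icc_right ht.2)⟩

namespace Scheme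

variable {n : ℕ} (M : ℝ) (η : ZMod n → ℝ)

/-- Half the discrete slope on the edge from `j` to `j + 1`. -/
noncomputable def slope (j : ZMod n) : ℝ := (1 + M * (η (j + 1) - η j)) / 2

/-- The velocity of the semi-discrete flow. -/
noncomputable def vel (j : ZMod n) : ℝ := M * (slope M η j ^ 2 - slope M η (j - 1) ^ 2)

/-- The forward difference quotient of the velocity. -/
noncomputable def velDiff (j : ZMod n) : ℝ := M * (vel M η (j + 1) - vel M η j)

/-- The time derivative of the squared slope. -/
noncomputable def press (j : ZMod n) : ℝ := slope M η j * velDiff M η j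

/-- The acceleration of the semi-discrete flow. -/
noncomputable def acc (j : ZMod n) : ℝ := M * (press M η j - press M η (j - 1))

end Scheme

open Scheme

/-- A solution of the semi-discrete periodic flow with slopes in `[c, C]`. -/
structure IsScheme {n : ℕ} (M c C T : ℝ) (η : ℝ → ZMod n → ℝ) : Prop where
  ode : ∀ t ∈ Icc 0 T, ∀ j, HasDerivWithinAt (fun s => η s j) (vel M (η t) j) (Icc 0 T) t
  lower : ∀ t ∈ Icc 0 T, ∀ j, c ≤ slope M (η t) j
  upper : ∀ t ∈ Icc 0 T, ∀ j, slope M (η t) j ≤ C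
  c_pos : 0 < c
  M_pos : 0 < M

namespace IsScheme

variable {n : ℕ} {M c C T : ℝ} {η : ℝ → ZMod n → ℝ}

theorem deriv_slope (h : IsScheme M c C T η) {t : ℝ} (ht : t ∈ Icc 0 T) (j : ZMod n) :
    HasDerivWithinAt (fun s => slope M (η s) j) (velDiff M (η t) j / 2) (Icc 0 T) t :=
  ((((h.ode t ht (j + 1)).sub (h.ode t ht j)).const_mul M).const_add 1).div_const 2

theorem deriv_slope_sq (h : IsScheme M c C T η) {t : ℝ} (ht : t ∈ Icc 0 T) (j : ZMod n) :
    HasDerivWithinAt (fun s => slope M (η s) j ^ 2) (press M (η t) j) (Icc 0 T) t := by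
  refine ((h.deriv_slope ht j).pow 2).congr_deriv ?_
  simp only [press]
  push_cast
  ring

theorem deriv_vel (h : IsScheme M c C T η) {t : ℝ} (ht : t ∈ Icc 0 T) (j : ZMod n) :
    HasDerivWithinAt (fun s => vel M (η s) j) (acc M (η t) j) (Icc 0 T) t :=
  ((h.deriv_slope_sq ht j).sub (h.deriv_slope_sq ht (j - 1))).const_mul M

theorem deriv_velDiff (h : IsScheme M c C T η) {t : ℝ} (ht : t ∈ Icc 0 T) (j : ZMod n) :
    HasDerivWithinAt (fun s => velDiff M (η s) j) (M * (acc M (η t) (j + 1) - acc M (η t) j))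
      (Icc 0 T) t :=
  ((h.deriv_vel ht (j + 1)).sub (h.deriv_vel ht j)).const_mul M

theorem deriv_press (h : IsScheme M c C T η) {t : ℝ} (ht : t ∈ Icc 0 T) (j : ZMod n) :
    HasDerivWithinAt (fun s => press M (η s) j) (velDiff M (η t) j ^ 2 / 2 +
      slope M (η t) j * (M * (acc M (η t) (j + 1) - acc M (η t) j))) (Icc 0 T) t := by
  refine ((h.deriv_slope ht j).mul (h.deriv_velDiff ht j)).congr_deriv ?_
  ring

theorem deriv_acc (h : IsScheme M c C T η) {t : ℝ} (ht : t ∈ Icc 0 T) (j : ZMod n) :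
    HasDerivWithinAt (fun s => acc M (η s) j) (M * ((velDiff M (η t) j ^ 2 / 2 +
      slope M (η t) j * (M * (acc M (η t) (j + 1) - acc M (η t) j))) -
      (velDiff M (η t) (j - 1) ^ 2 / 2 +
      slope M (η t) (j - 1) * (M * (acc M (η t) j - acc M (η t) (j - 1)))))) (Icc 0 T) t := by
  have h1 := ((h.deriv_press ht j).sub (h.deriv_press ht (j - 1))).const_mul M
  rwa [sub_add_cancel] at h1

variable [NeZero n]

theorem abs_vel_le (h : IsScheme M c C T η) {V : ℝ} (h0 : ∀ j, |vel M (η 0) j| ≤ V) :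
    ∀ t ∈ Icc 0 T, ∀ j, |vel M (η t) j| ≤ V := by
  have key : ∀ σ : ℝ, σ = 1 ∨ σ = -1 → ∀ t ∈ Icc 0 T, ∀ j, σ * vel M (η t) j ≤ V := by
    intro σ hσ
    refine le_of_deriv_nonpos_at_max_finite (lt_add_one V)
      (fun t ht j => (h.deriv_vel ht j).const_mul σ) ?_ ?_
    · intro j
      have := abs_le.1 (h0 j)
      rcases hσ with rfl | rfl <;> linarith
    · intro t ht j _ _ hmax
      have h1 := hmax (j + 1)
      have h2 := hmax (j - 1)
      have r1 := h.c_pos.le.trans (h.lower t ht j)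
      have r2 := h.c_pos.le.trans (h.lower t ht (j - 1))
      have hM := h.M_pos
      simp only [acc, press, velDiff, sub_add_cancel]
      have k1 : slope M (η t) j * (M * (σ * vel M (η t) (j + 1) - σ * vel M (η t) j)) ≤ 0 :=
        mul_nonpos_of_nonneg_of_nonpos r1 (mul_nonpos_of_nonneg_of_nonpos hM.le (by linarith))
      have k2 : 0 ≤ slope M (η t) (j - 1) * (M * (σ * vel M (η t) j - σ * vel M (η t) (j - 1))) :=
        mul_nonneg r2 (mul_nonneg hM.le (by linarith))
      have : M * (slope M (η t) j * (M * (σ * vel M (η t) (j + 1) - σ * vel M (η t) j)) -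
        slope M (η t) (j - 1) * (M * (σ * vel M (η t) j - σ * vel M (η t) (j - 1)))) ≤ 0 :=
        mul_nonpos_of_nonneg_of_nonpos hM.le (by linarith)
      linarith
  intro t ht j
  have h1 := key 1 (Or.inl rfl) t ht j
  have h2 := key (-1) (Or.inr rfl) t ht j
  rw [abs_le]; constructor <;> linarith

theorem neg_le_press (h : IsScheme M c C T η) {B : ℝ} (h0 : ∀ j, -B ≤ press M (η 0) j) :
    ∀ t ∈ Icc 0 T, ∀ j, -B ≤ press M (η t) j := by
  have key : ∀ t ∈ Icc 0 T, ∀ j, -press M (η t) j ≤ B := by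
    refine le_of_deriv_nonpos_at_max_finite (lt_add_one B)
      (fun t ht j => (h.deriv_press ht j).neg) ?_ ?_
    · intro j
      linarith [h0 j]
    · intro t ht j _ _ hmax
      have h1 := hmax (j + 1)
      have h2 := hmax (j - 1)
      have r1 := h.c_pos.le.trans (h.lower t ht j)
      have hM := h.M_pos
      have k1 : 0 ≤ acc M (η t) (j + 1) := by
        rw [acc, add_sub_cancel_right]; exact mul_nonneg hM.le (by linarith)
      have k2 : acc M (η t) j ≤ 0 := by
        exact mul_nonpos_of_nonneg_of_nonpos hM.le (by linarith)
      have : 0 ≤ slope M (η t) j * (M * (acc M (η t) (j + 1) - acc M (η t) j)) :=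
        mul_nonneg r1 (mul_nonneg hM.le (by linarith))
      nlinarith [sq_nonneg (velDiff M (η t) j)]
  intro t ht j
  linarith [key t ht j]

omit [NeZero n] in
theorem abs_slope_diff_le (h : IsScheme M c C T η) {V : ℝ} {t : ℝ} (ht : t ∈ Icc 0 T)
    (hV : ∀ j, |vel M (η t) j| ≤ V) (j : ZMod n) :
    |M * (slope M (η t) j - slope M (η t) (j - 1))| ≤ V / (2 * c) := by
  have r1 := h.lower t ht j
  have r2 := h.lower t ht (j - 1)
  have hc := h.c_pos
  have h1 := hV j
  have e : vel M (η t) j = M * (slope M (η t) j - slope M (η t) (j - 1)) *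
      (slope M (η t) j + slope M (η t) (j - 1)) := by
    rw [vel]; ring
  rw [e, abs_mul, abs_of_pos (by linarith : 0 < slope M (η t) j + slope M (η t) (j - 1))] at h1
  rw [le_div_iff₀ (by linarith)]
  nlinarith [abs_nonneg (M * (slope M (η t) j - slope M (η t) (j - 1)))]

theorem press_le (h : IsScheme M c C T η) {V B : ℝ} (hV0 : ∀ j, |vel M (η 0) j| ≤ V)
    (hB : 0 ≤ B) (h0 : ∀ j, press M (η 0) j ≤ B) :
    ∀ t ∈ Icc 0 T, ∀ j, press M (η t) j ≤ B + C * V ^ 2 / c ^ 2 + 2 * V ^ 2 / c := by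
  have hV := h.abs_vel_le hV0
  have hc := h.c_pos
  have hM := h.M_pos
  have hVsq : ∀ t ∈ Icc 0 T, ∀ j, vel M (η t) j ^ 2 ≤ V ^ 2 := fun t ht j =>
    sq_le_sq.2 ((hV t ht j).trans (le_abs_self V))
  have key : ∀ t ∈ Icc 0 T, ∀ j, press M (η t) j +
      1 / c * (vel M (η t) j ^ 2 + vel M (η t) (j + 1) ^ 2) ≤
        B + C * V ^ 2 / c ^ 2 + 2 * V ^ 2 / c := by
    by_cases hT : 0 ≤ T
    swap
    · intro t ht; exact absurd (ht.1.trans ht.2) hT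
    have hCc : c ≤ C := (h.lower 0 ⟨le_rfl, hT⟩ 0).trans (h.upper 0 ⟨le_rfl, hT⟩ 0)
    have hC : 0 < C := hc.trans_le hCc
    have hE : ∀ t ∈ Icc 0 T, ∀ j,
        1 / c * (vel M (η t) j ^ 2 + vel M (η t) (j + 1) ^ 2) ≤ 2 * V ^ 2 / c := by
      intro t ht j
      have := hVsq t ht j
      have := hVsq t ht (j + 1)
      rw [one_div, inv_mul_le_iff₀ hc, mul_div_cancel₀ _ hc.ne']
      linarith
    refine le_of_deriv_nonpos_at_max_finite (lt_add_one _) (fun t ht j => (h.deriv_press ht j).add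
      ((((h.deriv_vel ht j).pow 2).add ((h.deriv_vel ht (j + 1)).pow 2)).const_mul (1 / c))) ?_ ?_
    · intro j
      have h1 := hE 0 ⟨le_rfl, hT⟩ j
      have h2 := h0 j
      have : 0 ≤ C * V ^ 2 / c ^ 2 := by positivity
      linarith
    · intro t ht j hj _ hmax
      have m1 := hmax (j + 1)
      have m2 := hmax (j - 1)
      simp only [sub_add_cancel] at hj m1 m2
      have ej : j + 1 - 1 = j := add_sub_cancel_right j 1
      have ea : acc M (η t) (j + 1) = M * (press M (η t) (j + 1) - press M (η t) j) := by
        rw [acc, ej]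
      have eb : acc M (η t) j = M * (press M (η t) j - press M (η t) (j - 1)) := rfl
      have ez1 : velDiff M (η t) (j + 1) =
        M * (vel M (η t) (j + 1 + 1) - vel M (η t) (j + 1)) := rfl
      have ez : velDiff M (η t) j = M * (vel M (η t) (j + 1) - vel M (η t) j) := rfl
      have ez0 : velDiff M (η t) (j - 1) = M * (vel M (η t) j - vel M (η t) (j - 1)) := by
        rw [velDiff, sub_add_cancel]
      have ep1 : press M (η t) (j + 1) = slope M (η t) (j + 1) * velDiff M (η t) (j + 1) := rfl
      have ep : press M (η t) j = slope M (η t) j * velDiff M (η t) j := rfl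
      have ep0 : press M (η t) (j - 1) = slope M (η t) (j - 1) * velDiff M (η t) (j - 1) := rfl
      have eρ1 := h.abs_slope_diff_le ht (hV t ht) (j + 1)
      rw [ej] at eρ1
      have eρ := h.abs_slope_diff_le ht (hV t ht) j
      have r1 := h.lower t ht j
      have rC := h.upper t ht j
      have hEj := hE t ht j
      have hv1 := hVsq t ht (j + 1)
      have hv0 := hVsq t ht j
      generalize vel M (η t) (j + 1 + 1) = v2 at *
      generalize vel M (η t) (j + 1) = v1 at *
      generalize vel M (η t) j = v0 at *
      generalize vel M (η t) (j - 1) = vm at *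
      generalize slope M (η t) (j + 1) = s1 at *
      generalize slope M (η t) j = s0 at *
      generalize slope M (η t) (j - 1) = sm at *
      generalize velDiff M (η t) (j + 1) = z1 at *
      generalize velDiff M (η t) j = z0 at *
      generalize velDiff M (η t) (j - 1) = zm at *
      rw [ea, eb]
      generalize press M (η t) (j + 1) = p1 at *
      generalize press M (η t) j = p0 at *
      generalize press M (η t) (j - 1) = pm at *
      set ρ1 := M * (s1 - s0) with hρ1
      set ρ0 := M * (s0 - sm) with hρ0
      have hz : V ^ 2 / c ^ 2 ≤ z0 := by
        have hp : C * V ^ 2 / c ^ 2 ≤ p0 := by linarith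
        by_contra! hlt
        rcases lt_or_ge z0 0 with hn | hn
        · have : p0 ≤ 0 := by rw [ep]; nlinarith
          have h3 : 0 ≤ C * V ^ 2 / c ^ 2 := by positivity
          have : s0 * z0 < 0 := by nlinarith
          linarith
        · have : s0 * z0 ≤ C * z0 := mul_le_mul_of_nonneg_right rC hn
          have : C * z0 < C * (V ^ 2 / c ^ 2) := mul_lt_mul_of_pos_left hlt (by linarith)
          rw [mul_div_assoc] at hp
          linarith
      have hdis : (M * M) * ((p1 - p0) - (p0 - pm)) ≤
          - (1 / c * (2 * M * (z1 * v1 - zm * v0) + z1 ^ 2 + zm ^ 2)) := by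
        have e : 2 * M * (z1 * v1 - zm * v0) + z1 ^ 2 + zm ^ 2 =
            M * M * ((v1 ^ 2 + v2 ^ 2) - 2 * (v0 ^ 2 + v1 ^ 2) + (vm ^ 2 + v0 ^ 2)) := by
          rw [ez1, ez0]; ring
        rw [e]
        have : (M * M) * ((p1 - p0) - (p0 - pm) +
          1 / c * ((v1 ^ 2 + v2 ^ 2) - 2 * (v0 ^ 2 + v1 ^ 2) + (vm ^ 2 + v0 ^ 2))) ≤ 0 :=
          mul_nonpos_of_nonneg_of_nonpos (by positivity) (by linarith)
        linarith
      have hyoung : ∀ v ρ z : ℝ, v ^ 2 ≤ V ^ 2 → |ρ| ≤ V / (2 * c) →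
          2 * v * ρ * z ≤ s0 * z ^ 2 + V ^ 4 / (4 * c ^ 3) := by
        intro v ρ z hv hρ
        have h1 : ρ ^ 2 ≤ (V / (2 * c)) ^ 2 := sq_le_sq' (abs_le.1 hρ).1 (abs_le.1 hρ).2
        have h2 : (v * ρ) ^ 2 ≤ V ^ 2 * (V / (2 * c)) ^ 2 := by
          rw [mul_pow]; exact mul_le_mul hv h1 (sq_nonneg _) (sq_nonneg _)
        have h3 : V ^ 4 / (4 * c ^ 3) = V ^ 2 * (V / (2 * c)) ^ 2 / c := by
          field_simp; norm_num
        have h4 : 2 * v * ρ * z ≤ c * z ^ 2 + (v * ρ) ^ 2 / c := by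
          have : c * z ^ 2 + (v * ρ) ^ 2 / c - 2 * v * ρ * z = (c * z - v * ρ) ^ 2 / c := by
            field_simp; ring
          have : 0 ≤ (c * z - v * ρ) ^ 2 / c := by positivity
          linarith
        have h5 : (v * ρ) ^ 2 / c ≤ V ^ 2 * (V / (2 * c)) ^ 2 / c := by gcongr
        have h6 : c * z ^ 2 ≤ s0 * z ^ 2 := by gcongr
        linarith
      have y1 := hyoung v1 ρ1 z1 hv1 eρ1
      have y0 := hyoung v0 ρ0 zm hv0 eρ
      have hmain : s0 * (M * (M * (p1 - p0) - M * (p0 - pm))) ≤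
          s0 * (- (1 / c * (2 * M * (z1 * v1 - zm * v0) + z1 ^ 2 + zm ^ 2))) :=
        mul_le_mul_of_nonneg_left (by linarith) (by linarith)
      have hid : 2 * v0 * (M * (p0 - pm)) + 2 * v1 * (M * (p1 - p0)) -
          s0 * (2 * M * (z1 * v1 - zm * v0) + z1 ^ 2 + zm ^ 2) =
          - (2 * s0 * z0 ^ 2) - s0 * (z1 ^ 2 + zm ^ 2) + 2 * v1 * ρ1 * z1 + 2 * v0 * ρ0 * zm := by
        rw [ep1, ep, ep0, hρ1, hρ0]
        have : 2 * s0 * z0 ^ 2 = 2 * s0 * z0 * (M * (v1 - v0)) := by rw [← ez]; ring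
        rw [this]; ring
      have hsum : 2 * v0 * (M * (p0 - pm)) + 2 * v1 * (M * (p1 - p0)) -
          s0 * (2 * M * (z1 * v1 - zm * v0) + z1 ^ 2 + zm ^ 2) ≤
          - (2 * c * z0 ^ 2) + V ^ 4 / (2 * c ^ 3) := by
        rw [hid]
        have : c * z0 ^ 2 ≤ s0 * z0 ^ 2 := by gcongr
        have : V ^ 4 / (2 * c ^ 3) = V ^ 4 / (4 * c ^ 3) + V ^ 4 / (4 * c ^ 3) := by
          field_simp; ring
        linarith
      have hsum' := mul_le_mul_of_nonneg_left hsum (by positivity : 0 ≤ 1 / c)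
      have e1 : 1 / c * (- (2 * c * z0 ^ 2) + V ^ 4 / (2 * c ^ 3)) =
          - 2 * z0 ^ 2 + (V ^ 2 / c ^ 2) ^ 2 / 2 := by
        field_simp
      have e2 : (V ^ 2 / c ^ 2) ^ 2 ≤ z0 ^ 2 := by
        have : 0 ≤ V ^ 2 / c ^ 2 := by positivity
        gcongr
      rw [e1] at hsum'
      have goal : z0 ^ 2 / 2 + s0 * (M * (M * (p1 - p0) - M * (p0 - pm))) +
          1 / c * (2 * v0 * (M * (p0 - pm)) + 2 * v1 * (M * (p1 - p0))) ≤ 0 := by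
        have := sq_nonneg z0
        linarith
      refine le_of_eq_of_le ?_ goal
      norm_num
  intro t ht j
  have h1 := key t ht j
  have : 0 ≤ 1 / c * (vel M (η t) j ^ 2 + vel M (η t) (j + 1) ^ 2) := by positivity
  linarith

end IsScheme

namespace IsScheme

variable {n : ℕ} {M c C T : ℝ} {η : ℝ → ZMod n → ℝ}

theorem abs_velDiff_le (h : IsScheme M c C T η) {P : ℝ} {t : ℝ} (ht : t ∈ Icc 0 T)
    (hP : ∀ j, |press M (η t) j| ≤ P) (j : ZMod n) : |velDiff M (η t) j| ≤ P / c := by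
  have r1 := h.lower t ht j
  have hc := h.c_pos
  have h1 := hP j
  rw [press, abs_mul, abs_of_pos (by linarith : 0 < slope M (η t) j)] at h1
  rw [le_div_iff₀ hc]
  nlinarith [abs_nonneg (velDiff M (η t) j)]

theorem abs_velDiff_diff_le (h : IsScheme M c C T η) {Z R : ℝ} {t : ℝ} (ht : t ∈ Icc 0 T)
    (hZ : ∀ j, |velDiff M (η t) j| ≤ Z)
    (hR : ∀ j, |M * (slope M (η t) j - slope M (η t) (j - 1))| ≤ R) (j : ZMod n) :
    |M * (velDiff M (η t) j - velDiff M (η t) (j - 1))| ≤ (|acc M (η t) j| + R * Z) / c := by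
  have r1 := h.lower t ht j
  have hc := h.c_pos
  have e : slope M (η t) j * (M * (velDiff M (η t) j - velDiff M (η t) (j - 1))) =
      acc M (η t) j -
        M * (slope M (η t) j - slope M (η t) (j - 1)) * velDiff M (η t) (j - 1) := by
    simp only [acc, press]; ring
  have h1 : |slope M (η t) j * (M * (velDiff M (η t) j - velDiff M (η t) (j - 1)))| ≤
      |acc M (η t) j| + R * Z := by
    rw [e]
    refine (abs_sub _ _).trans (add_le_add_right ?_ _)
    rw [abs_mul]
    exact mul_le_mul (hR j) (hZ (j - 1)) (abs_nonneg _) ((abs_nonneg _).trans (hR j))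
  rw [abs_mul, abs_of_pos (by linarith : 0 < slope M (η t) j)] at h1
  rw [le_div_iff₀ hc]
  nlinarith [abs_nonneg (M * (velDiff M (η t) j - velDiff M (η t) (j - 1)))]

theorem acc_balance (M l s0 sm z0 zm p1 p0 pm pmm : ℝ) :
    2 * (M * (p0 - pm)) * (M * ((z0 ^ 2 / 2 + s0 * (M * (M * (p1 - p0) - M * (p0 - pm)))) -
      (zm ^ 2 / 2 + sm * (M * (M * (p0 - pm) - M * (pm - pmm)))))) +
      l * (2 * p0 * (z0 ^ 2 / 2 + s0 * (M * (M * (p1 - p0) - M * (p0 - pm)))) +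
        2 * pm * (zm ^ 2 / 2 + sm * (M * (M * (p0 - pm) - M * (pm - pmm))))) =
    M ^ 2 * (s0 * (((M * (p1 - p0)) ^ 2 + l * (p1 ^ 2 + p0 ^ 2)) -
        ((M * (p0 - pm)) ^ 2 + l * (p0 ^ 2 + pm ^ 2))) -
      sm * (((M * (p0 - pm)) ^ 2 + l * (p0 ^ 2 + pm ^ 2)) -
        ((M * (pm - pmm)) ^ 2 + l * (pm ^ 2 + pmm ^ 2)))) +
    (M * (p0 - pm)) * ((z0 + zm) * (M * (z0 - zm)))
    - s0 * (M * (M * (p1 - p0) - M * (p0 - pm))) ^ 2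
    - sm * (M * (M * (p0 - pm) - M * (pm - pmm))) ^ 2
    + l * (p0 * z0 ^ 2 + pm * zm ^ 2 - 2 * (M * (s0 - sm)) * (p0 + pm) * (M * (p0 - pm))
      - s0 * ((M * (p1 - p0)) ^ 2 + (M * (p0 - pm)) ^ 2)
      - sm * ((M * (p0 - pm)) ^ 2 + (M * (pm - pmm)) ^ 2)) := by
  ring

theorem acc_max_le {M c l P R W Z G w1 w0 wm s0 sm z0 zm p1 p0 pm pmm : ℝ} (hc : 0 < c)
    (hP0 : 0 ≤ P) (hR0 : 0 ≤ R) (hZ0 : 0 ≤ Z) (hl0 : 0 ≤ l) (hl : l = (Z / c + 1) / c)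
    (hG : G = 2 * Z / c * (R * Z) + 4 * l * R * P + 2 * l * P * Z ^ 2 + 1)
    (ea : w1 = M * (p1 - p0)) (eb : w0 = M * (p0 - pm)) (ec : wm = M * (pm - pmm))
    (s0c : c ≤ s0) (smc : c ≤ sm) (hρ : |M * (s0 - sm)| ≤ R)
    (z0b : |z0| ≤ Z) (zmb : |zm| ≤ Z) (p0b : |p0| ≤ P) (pmb : |pm| ≤ P)
    (hd : |M * (z0 - zm)| ≤ (|w0| + R * Z) / c) (hEj : l * (p0 ^ 2 + pm ^ 2) ≤ 2 * l * P ^ 2)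
    (hj : G ^ 2 + W ^ 2 + 2 * l * P ^ 2 < w0 ^ 2 + l * (p0 ^ 2 + pm ^ 2))
    (m1 : w1 ^ 2 + l * (p1 ^ 2 + p0 ^ 2) ≤ w0 ^ 2 + l * (p0 ^ 2 + pm ^ 2))
    (m2 : wm ^ 2 + l * (pm ^ 2 + pmm ^ 2) ≤ w0 ^ 2 + l * (p0 ^ 2 + pm ^ 2)) :
    2 * w0 * (M * ((z0 ^ 2 / 2 + s0 * (M * (w1 - w0))) -
      (zm ^ 2 / 2 + sm * (M * (w0 - wm))))) + l * (2 * p0 * (z0 ^ 2 / 2 + s0 * (M * (w1 - w0))) +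
      2 * pm * (zm ^ 2 / 2 + sm * (M * (w0 - wm)))) ≤ 0 := by
  have hbal := acc_balance M l s0 sm z0 zm p1 p0 pm pmm
  rw [← ea, ← eb, ← ec] at hbal
  have hs0 : 0 ≤ s0 := hc.le.trans s0c
  have hsm : 0 ≤ sm := hc.le.trans smc
  have hL : M ^ 2 * (s0 * ((w1 ^ 2 + l * (p1 ^ 2 + p0 ^ 2)) -
      (w0 ^ 2 + l * (p0 ^ 2 + pm ^ 2))) - sm * ((w0 ^ 2 + l * (p0 ^ 2 + pm ^ 2)) -
      (wm ^ 2 + l * (pm ^ 2 + pmm ^ 2)))) ≤ 0 := by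
    refine mul_nonpos_of_nonneg_of_nonpos (by positivity) ?_
    have h1 := mul_nonpos_of_nonneg_of_nonpos hs0 (sub_nonpos.2 m1)
    have h2 := mul_nonneg hsm (sub_nonneg.2 m2)
    linarith
  have hwabs : |w0| ^ 2 = w0 ^ 2 := sq_abs w0
  have hw0 := abs_nonneg w0
  have t1 : w0 * ((z0 + zm) * (M * (z0 - zm))) ≤ |w0| * (2 * Z * ((|w0| + R * Z) / c)) := by
    refine (le_abs_self _).trans ?_
    rw [abs_mul, abs_mul]
    have : |z0 + zm| ≤ 2 * Z := (abs_add_le _ _).trans (by linarith)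
    gcongr
  have t2 : p0 * z0 ^ 2 ≤ P * Z ^ 2 := by
    have : z0 ^ 2 ≤ Z ^ 2 := sq_le_sq.2 (z0b.trans (le_abs_self Z))
    exact mul_le_mul ((le_abs_self _).trans p0b) this (sq_nonneg _) hP0
  have t3 : pm * zm ^ 2 ≤ P * Z ^ 2 := by
    have : zm ^ 2 ≤ Z ^ 2 := sq_le_sq.2 (zmb.trans (le_abs_self Z))
    exact mul_le_mul ((le_abs_self _).trans pmb) this (sq_nonneg _) hP0
  have t4 : - (2 * (M * (s0 - sm)) * (p0 + pm) * w0) ≤ 4 * R * P * |w0| := by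
    refine (neg_le_abs _).trans ?_
    rw [abs_mul, abs_mul, abs_mul, abs_two]
    have h1 : |p0 + pm| ≤ 2 * P := (abs_add_le _ _).trans (by linarith)
    have h2 : 2 * |M * (s0 - sm)| * |p0 + pm| * |w0| ≤ 2 * R * (2 * P) * |w0| := by gcongr
    linarith
  have t5 : c * w0 ^ 2 ≤ s0 * (w1 ^ 2 + w0 ^ 2) :=
    mul_le_mul s0c (by linarith only [sq_nonneg w1]) (sq_nonneg _) hs0
  have t6 : c * w0 ^ 2 ≤ sm * (w0 ^ 2 + wm ^ 2) :=
    mul_le_mul smc (by linarith only [sq_nonneg wm]) (sq_nonneg _) hsm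
  have t7 := mul_le_mul_of_nonneg_left (add_le_add (add_le_add (add_le_add (add_le_add t2 t3) t4)
    (neg_le_neg t5)) (neg_le_neg t6)) hl0
  have t8 : l * (2 * c * w0 ^ 2) = (2 * Z / c + 2) * w0 ^ 2 := by
    rw [hl]; field_simp
  have t9 : |w0| * (2 * Z * ((|w0| + R * Z) / c)) =
      2 * Z / c * w0 ^ 2 + 2 * Z / c * (R * Z) * |w0| := by
    rw [← hwabs]; ring
  have t10 : 0 ≤ s0 * (M * (w1 - w0)) ^ 2 := by positivity
  have t11 : 0 ≤ sm * (M * (w0 - wm)) ^ 2 := by positivity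
  have hGw : G ≤ |w0| := by
    have : G ^ 2 ≤ w0 ^ 2 := by
      have := sq_nonneg W
      linarith only [this, hj, hEj]
    rw [← hwabs] at this
    exact le_of_sq_le_sq this hw0
  have g1 : 0 ≤ 2 * Z / c * (R * Z) + 4 * l * R * P := by positivity
  have g2 : 0 ≤ 2 * l * P * Z ^ 2 := by positivity
  have t12 : (2 * Z / c * (R * Z) + 4 * l * R * P) * |w0| + 2 * l * P * Z ^ 2 ≤ w0 ^ 2 := by
    rw [← hwabs, pow_two |w0|]
    have k1 : (G - 1) * |w0| ≤ |w0| * |w0| :=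
      mul_le_mul_of_nonneg_right (by linarith only [hGw]) hw0
    have hG1 : 1 ≤ |w0| := le_trans (by linarith only [hG, g1, g2]) hGw
    have k2 : 2 * l * P * Z ^ 2 * 1 ≤ 2 * l * P * Z ^ 2 * |w0| :=
      mul_le_mul_of_nonneg_left hG1 g2
    rw [hG] at k1
    linarith only [k1, k2]
  rw [hbal]
  have t13 := mul_le_mul_of_nonneg_left t12 zero_le_two
  have := sq_nonneg w0
  linarith only [hL, t1, t7, t8, t9, t10, t11, t13, this]

theorem abs_acc_le [NeZero n] (h : IsScheme M c C T η) {P R W : ℝ} (hP0 : 0 ≤ P) (hR0 : 0 ≤ R)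
    (hP : ∀ t ∈ Icc 0 T, ∀ j, |press M (η t) j| ≤ P)
    (hR : ∀ t ∈ Icc 0 T, ∀ j, |M * (slope M (η t) j - slope M (η t) (j - 1))| ≤ R)
    (hW : ∀ j, |acc M (η 0) j| ≤ W) {Z l G : ℝ} (hZ : Z = P / c) (hl : l = (Z / c + 1) / c)
    (hG : G = 2 * Z / c * (R * Z) + 4 * l * R * P + 2 * l * P * Z ^ 2 + 1) :
    ∀ t ∈ Icc 0 T, ∀ j, acc M (η t) j ^ 2 ≤ G ^ 2 + W ^ 2 + 2 * l * P ^ 2 := by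
  have hc := h.c_pos
  have hM := h.M_pos
  have hZ0 : 0 ≤ Z := by rw [hZ]; positivity
  have hl0 : 0 ≤ l := by rw [hl]; positivity
  have hPsq : ∀ t ∈ Icc 0 T, ∀ j, press M (η t) j ^ 2 ≤ P ^ 2 := fun t ht j =>
    sq_le_sq.2 ((hP t ht j).trans (le_abs_self P))
  have key : ∀ t ∈ Icc 0 T, ∀ j, acc M (η t) j ^ 2 +
      l * (press M (η t) j ^ 2 + press M (η t) (j - 1) ^ 2) ≤ G ^ 2 + W ^ 2 + 2 * l * P ^ 2 := by
    by_cases hT : 0 ≤ T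
    swap
    · intro t ht; exact absurd (ht.1.trans ht.2) hT
    have hE : ∀ t ∈ Icc 0 T, ∀ j,
        l * (press M (η t) j ^ 2 + press M (η t) (j - 1) ^ 2) ≤ 2 * l * P ^ 2 := by
      intro t ht j
      have := hPsq t ht j
      have := hPsq t ht (j - 1)
      nlinarith
    refine le_of_deriv_nonpos_at_max_finite (lt_add_one _) (fun t ht j =>
      ((h.deriv_acc ht j).pow 2).add ((((h.deriv_press ht j).pow 2).add
        ((h.deriv_press ht (j - 1)).pow 2)).const_mul l)) ?_ ?_
    · intro j
      have h1 := hE 0 ⟨le_rfl, hT⟩ j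
      have h2 : acc M (η 0) j ^ 2 ≤ W ^ 2 := sq_le_sq.2 ((hW j).trans (le_abs_self W))
      have := sq_nonneg G
      linarith
    · intro t ht j hj _ hmax
      have m1 := hmax (j + 1)
      have m2 := hmax (j - 1)
      have ej : j + 1 - 1 = j := add_sub_cancel_right j 1
      have ej' : j - 1 + 1 = j := sub_add_cancel j 1
      simp only [ej, ej'] at hj m1 m2 ⊢
      have ea : acc M (η t) (j + 1) = M * (press M (η t) (j + 1) - press M (η t) j) := by
        rw [acc, ej]
      have eb : acc M (η t) j = M * (press M (η t) j - press M (η t) (j - 1)) := rfl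
      have ec : acc M (η t) (j - 1) =
        M * (press M (η t) (j - 1) - press M (η t) (j - 1 - 1)) := rfl
      have zb := h.abs_velDiff_le ht (hP t ht)
      rw [← hZ] at zb
      have hd := h.abs_velDiff_diff_le ht zb (hR t ht) j
      have hEj := hE t ht j
      refine le_of_eq_of_le ?_ (acc_max_le (W := W) hc hP0 hR0 hZ0 hl0 hl hG ea eb ec (h.lower t ht j)
        (h.lower t ht (j - 1)) (hR t ht j) (zb j) (zb (j - 1)) (hP t ht j) (hP t ht (j - 1)) hd hEj
        hj m1 m2)
      norm_num
  intro t ht j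
  have h1 := key t ht j
  have : 0 ≤ l * (press M (η t) j ^ 2 + press M (η t) (j - 1) ^ 2) := by positivity
  linarith

theorem diff_three (h : IsScheme M c C T η) {t Z R : ℝ} (ht : t ∈ Icc 0 T)
    (hZ : ∀ j, |velDiff M (η t) j| ≤ Z)
    (hR : ∀ j, |M * (slope M (η t) j - slope M (η t) (j - 1))| ≤ R) (j : ZMod n) :
    |M * (M * (slope M (η t) (j + 1) - slope M (η t) j) -
      M * (slope M (η t) j - slope M (η t) (j - 1)))| ≤ (Z + 2 * R ^ 2) / (2 * c) := by
  have hc := h.c_pos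
  have r1 := h.lower t ht (j + 1)
  have r0 := h.lower t ht j
  have hz := hZ j
  have h1 := hR (j + 1)
  have h0 := hR j
  simp only [velDiff, vel, add_sub_cancel_right] at hz h1
  generalize slope M (η t) (j + 1) = s1 at *
  generalize slope M (η t) j = s0 at *
  generalize slope M (η t) (j - 1) = sm at *
  have e : M * (M * (s1 - s0) - M * (s0 - sm)) * (s1 + s0) =
      M * (M * (s1 ^ 2 - s0 ^ 2) - M * (s0 ^ 2 - sm ^ 2)) -
        M * (s0 - sm) * (M * (s1 - s0) + M * (s0 - sm)) := by ring
  have hb : |M * (M * (s1 - s0) - M * (s0 - sm)) * (s1 + s0)| ≤ Z + 2 * R ^ 2 := by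
    rw [e]
    refine (abs_sub _ _).trans (add_le_add hz ?_)
    rw [abs_mul]
    have : |M * (s1 - s0) + M * (s0 - sm)| ≤ 2 * R := (abs_add_le _ _).trans (by linarith)
    nlinarith [abs_nonneg (M * (s0 - sm)), abs_nonneg (M * (s1 - s0) + M * (s0 - sm))]
  rw [abs_mul, abs_of_pos (by linarith : 0 < s1 + s0)] at hb
  rw [le_div_iff₀ (by linarith)]
  nlinarith [abs_nonneg (M * (M * (s1 - s0) - M * (s0 - sm)))]

theorem diff_four (h : IsScheme M c C T η) {t R Q Y : ℝ} (ht : t ∈ Icc 0 T)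
    (hR : ∀ j, |M * (slope M (η t) j - slope M (η t) (j - 1))| ≤ R)
    (hQ : ∀ j, |M * (M * (slope M (η t) (j + 1) - slope M (η t) j) -
      M * (slope M (η t) j - slope M (η t) (j - 1)))| ≤ Q)
    (hY : ∀ j, |M * (velDiff M (η t) j - velDiff M (η t) (j - 1))| ≤ Y) (j : ZMod n) :
    |M * (M * (M * (slope M (η t) (j + 1) - slope M (η t) j) -
      M * (slope M (η t) j - slope M (η t) (j - 1))) -
      M * (M * (slope M (η t) j - slope M (η t) (j - 1)) -
      M * (slope M (η t) (j - 1) - slope M (η t) (j - 1 - 1))))| ≤ (Y + 6 * R * Q) / (2 * c) := by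
  have hc := h.c_pos
  have r1 := h.lower t ht (j + 1)
  have r0 := h.lower t ht j
  have hy := hY j
  have h1 := hR (j + 1)
  have h0 := hR j
  have hm := hR (j - 1)
  have q0 := hQ j
  have qm := hQ (j - 1)
  simp only [velDiff, vel, add_sub_cancel_right, sub_add_cancel] at hy h1 qm
  generalize slope M (η t) (j + 1) = s1 at *
  generalize slope M (η t) j = s0 at *
  generalize slope M (η t) (j - 1) = sm at *
  generalize slope M (η t) (j - 1 - 1) = sn at *
  have e : M * (M * (M * (s1 - s0) - M * (s0 - sm)) - M * (M * (s0 - sm) - M * (sm - sn))) *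
      (s1 + s0) =
      M * (M * (M * (s1 ^ 2 - s0 ^ 2) - M * (s0 ^ 2 - sm ^ 2)) -
        M * (M * (s0 ^ 2 - sm ^ 2) - M * (sm ^ 2 - sn ^ 2))) -
      (M * (M * (s0 - sm) - M * (sm - sn)) * (M * (s1 - s0) + M * (s0 - sm)) +
        (M * (s0 - sm) * (M * (M * (s1 - s0) - M * (s0 - sm)) +
          M * (M * (s0 - sm) - M * (sm - sn))) +
        M * (M * (s0 - sm) - M * (sm - sn)) * (M * (s0 - sm) + M * (sm - sn)))) := by ring
  have hR0 := (abs_nonneg _).trans h0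
  have hQ0 := (abs_nonneg _).trans q0
  have hb : |M * (M * (M * (s1 - s0) - M * (s0 - sm)) - M * (M * (s0 - sm) - M * (sm - sn))) *
      (s1 + s0)| ≤ Y + 6 * R * Q := by
    rw [e]
    have k1 : |M * (s1 - s0) + M * (s0 - sm)| ≤ 2 * R := (abs_add_le _ _).trans (by linarith)
    have k2 : |M * (s0 - sm) + M * (sm - sn)| ≤ 2 * R := (abs_add_le _ _).trans (by linarith)
    have k3 : |M * (M * (s1 - s0) - M * (s0 - sm)) + M * (M * (s0 - sm) - M * (sm - sn))| ≤ 2 * Q :=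
      (abs_add_le _ _).trans (by linarith)
    refine (abs_sub _ _).trans ?_
    have a1 : |M * (M * (s0 - sm) - M * (sm - sn)) * (M * (s1 - s0) + M * (s0 - sm))| ≤
        Q * (2 * R) := by
      rw [abs_mul]; exact mul_le_mul qm k1 (abs_nonneg _) hQ0
    have a2 : |M * (s0 - sm) * (M * (M * (s1 - s0) - M * (s0 - sm)) +
          M * (M * (s0 - sm) - M * (sm - sn)))| ≤ R * (2 * Q) := by
      rw [abs_mul]; exact mul_le_mul h0 k3 (abs_nonneg _) hR0
    have a3 : |M * (M * (s0 - sm) - M * (sm - sn)) * (M * (s0 - sm) + M * (sm - sn))| ≤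
        Q * (2 * R) := by
      rw [abs_mul]; exact mul_le_mul qm k2 (abs_nonneg _) hQ0
    have a4 := (abs_add_le _ _).trans (add_le_add a1 ((abs_add_le _ _).trans (add_le_add a2 a3)))
    linarith
  rw [abs_mul, abs_of_pos (by linarith : 0 < s1 + s0)] at hb
  rw [le_div_iff₀ (by linarith)]
  have := abs_nonneg
    (M * (M * (M * (s1 - s0) - M * (s0 - sm)) - M * (M * (s0 - sm) - M * (sm - sn))))
  nlinarith

/-- Bounds on the initial velocity, pressure and acceleration yield bounds on the third and
fourth differences of the periodic part which are uniform in time and in the mesh. -/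
theorem exists_bound (c C V P W : ℝ) (hV : 0 ≤ V) (hP : 0 ≤ P) :
    ∃ A, ∀ (n : ℕ) [NeZero n] (M T : ℝ) (η : ℝ → ZMod n → ℝ), IsScheme M c C T η →
      (∀ j, |vel M (η 0) j| ≤ V) → (∀ j, |press M (η 0) j| ≤ P) → (∀ j, |acc M (η 0) j| ≤ W) →
      ∀ t ∈ Icc 0 T, ∀ j,
        |M ^ 3 * (η t (j + 1 + 1 + 1) - 3 * η t (j + 1 + 1) + 3 * η t (j + 1) - η t j)| ≤ A ∧
        |M ^ 4 * (η t (j + 1 + 1 + 1 + 1) - 4 * η t (j + 1 + 1 + 1) + 6 * η t (j + 1 + 1) -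
          4 * η t (j + 1) + η t j)| ≤ A := by
  set P' := P + C * V ^ 2 / c ^ 2 + 2 * V ^ 2 / c with hP'
  set R := V / (2 * c) with hR
  set Z := P' / c with hZ
  set l := (Z / c + 1) / c with hl
  set G := 2 * Z / c * (R * Z) + 4 * l * R * P' + 2 * l * P' * Z ^ 2 + 1 with hG
  set W' := √(G ^ 2 + W ^ 2 + 2 * l * P' ^ 2) with hW'
  set Q := (Z + 2 * R ^ 2) / (2 * c) with hQ
  set Y := (W' + R * Z) / c with hY
  refine ⟨max (2 * Q) (2 * ((Y + 6 * R * Q) / (2 * c))), ?_⟩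
  intro n _ M T η h v0 p0 w0 t ht j
  have hc := h.c_pos
  have h0T : (0 : ℝ) ∈ Icc 0 T := ⟨le_rfl, ht.1.trans ht.2⟩
  have hC : 0 < C := hc.trans_le ((h.lower 0 h0T 0).trans (h.upper 0 h0T 0))
  have hP'0 : P ≤ P' := by
    have : 0 ≤ C * V ^ 2 / c ^ 2 + 2 * V ^ 2 / c := by positivity
    linarith
  have hv := h.abs_vel_le v0
  have hp : ∀ t ∈ Icc 0 T, ∀ j, |press M (η t) j| ≤ P' := by
    intro t ht j
    have h1 := h.neg_le_press (fun j => (abs_le.1 (p0 j)).1) t ht j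
    have h2 := h.press_le v0 hP (fun j => (abs_le.1 (p0 j)).2) t ht j
    exact abs_le.2 ⟨by linarith, h2⟩
  have hr : ∀ t ∈ Icc 0 T, ∀ j, |M * (slope M (η t) j - slope M (η t) (j - 1))| ≤ R :=
    fun t ht j => h.abs_slope_diff_le ht (hv t ht) j
  have hw : ∀ j, |acc M (η t) j| ≤ W' := by
    intro j
    refine Real.abs_le_sqrt ?_
    exact h.abs_acc_le (hP.trans hP'0) (by positivity) hp hr w0 hZ hl hG t ht j
  have hz := h.abs_velDiff_le ht (hp t ht)
  have hy : ∀ j, |M * (velDiff M (η t) j - velDiff M (η t) (j - 1))| ≤ Y := fun j =>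
    (h.abs_velDiff_diff_le ht hz (hr t ht) j).trans (by
      have := hw j
      rw [hY]; gcongr)
  have h3 := h.diff_three ht hz (hr t ht)
  have h4 := h.diff_four ht (hr t ht) h3 hy
  constructor
  · refine le_trans ?_ (le_max_left _ _)
    have := h3 (j + 1)
    simp only [Scheme.slope, add_sub_cancel_right] at this
    have e := (abs_mul (2 : ℝ) _).trans_le (mul_le_mul_of_nonneg_left this (abs_nonneg (2 : ℝ)))
    rw [abs_two] at e
    refine le_of_eq_of_le (congrArg _ ?_) e
    ring
  · refine le_trans ?_ (le_max_right _ _)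
    have := h4 (j + 1 + 1)
    simp only [Scheme.slope, add_sub_cancel_right] at this
    have e := (abs_mul (2 : ℝ) _).trans_le (mul_le_mul_of_nonneg_left this (abs_nonneg (2 : ℝ)))
    rw [abs_two] at e
    refine le_of_eq_of_le (congrArg _ ?_) e
    ring

end IsScheme

/-- The square of the truncation of `s` to `[c, C]`. -/
noncomputable def clampSq (c C s : ℝ) : ℝ := max c (min C s) ^ 2

theorem clampSq_of_mem {c C s : ℝ} (h : c ≤ s) (h' : s ≤ C) : clampSq c C s = s ^ 2 := by
  rw [clampSq, min_eq_right h', max_eq_right h]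

theorem clampSq_mono {c C : ℝ} (hc : 0 < c) {s s' : ℝ} (h : s ≤ s') :
    clampSq c C s ≤ clampSq c C s' := by
  unfold clampSq
  have : 0 ≤ max c (min C s) := hc.le.trans (le_max_left _ _)
  gcongr

theorem clampSq_bounds {c C : ℝ} (hc : 0 < c) (hcC : c ≤ C) (s : ℝ) :
    0 ≤ clampSq c C s ∧ clampSq c C s ≤ C ^ 2 := by
  refine ⟨sq_nonneg _, ?_⟩
  have : 0 ≤ max c (min C s) := hc.le.trans (le_max_left _ _)
  have h2 : max c (min C s) ≤ C := max_le hcC (min_le_left _ _)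
  unfold clampSq
  gcongr

theorem abs_clampSq_sub_le {c C : ℝ} (hc : 0 < c) (hcC : c ≤ C) (s s' : ℝ) :
    |clampSq c C s - clampSq c C s'| ≤ 2 * C * |s - s'| := by
  have h1 : 0 ≤ max c (min C s) := hc.le.trans (le_max_left _ _)
  have h1' : 0 ≤ max c (min C s') := hc.le.trans (le_max_left _ _)
  have h2 : max c (min C s) ≤ C := max_le hcC (min_le_left _ _)
  have h2' : max c (min C s') ≤ C := max_le hcC (min_le_left _ _)
  have h3 : |max c (min C s) - max c (min C s')| ≤ |s - s'| := by
    refine (abs_max_sub_max_le_max _ _ _ _).trans ?_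
    rw [sub_self, abs_zero, max_eq_right (abs_nonneg _)]
    refine (abs_min_sub_min_le_max _ _ _ _).trans ?_
    rw [sub_self, abs_zero, max_eq_right (abs_nonneg _)]
  rw [clampSq, clampSq, sq_sub_sq, abs_mul]
  refine mul_le_mul ?_ h3 (abs_nonneg _) (by linarith)
  rw [abs_of_nonneg (by linarith)]
  linarith

namespace Scheme

variable {n : ℕ} {M c C T : ℝ}

/-- The velocity field with truncated slopes. -/
noncomputable def clampVel (M c C : ℝ) (η : ZMod n → ℝ) (j : ZMod n) : ℝ :=
  M * (clampSq c C (slope M η j) - clampSq c C (slope M η (j - 1)))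

theorem exists_clamp_flow [NeZero n] (hM : 0 < M) (hc : 0 < c) (hcC : c ≤ C) (hT : 0 ≤ T)
    (η₀ : ZMod n → ℝ) : ∃ η : ℝ → ZMod n → ℝ, η 0 = η₀ ∧ ∀ t ∈ Icc 0 T, ∀ j,
      HasDerivWithinAt (fun s => η s j) (clampVel M c C (η t) j) (Icc 0 T) t := by
  have hC : 0 < C := hc.trans_le hcC
  have hlip : LipschitzWith (Real.toNNReal (4 * C * M ^ 2)) (clampVel (n := n) M c C) := by
    refine LipschitzWith.of_dist_le_mul fun η η' => ?_
    rw [Real.coe_toNNReal _ (by positivity), dist_pi_le_iff (by positivity)]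
    intro j
    have hs : ∀ j, |slope M η j - slope M η' j| ≤ M * dist η η' := by
      intro j
      have h1 := dist_le_pi_dist η η' j
      have h2 := dist_le_pi_dist η η' (j + 1)
      rw [Real.dist_eq] at h1 h2
      have e : slope M η j - slope M η' j = M * (((η (j + 1) - η' (j + 1)) - (η j - η' j)) / 2) := by
        simp only [Scheme.slope]; ring
      rw [e, abs_mul, abs_of_pos hM]
      refine mul_le_mul_of_nonneg_left ?_ hM.le
      rw [abs_div, abs_two]
      have := abs_sub (η (j + 1) - η' (j + 1)) (η j - η' j)
      linarith
    have e : clampVel M c C η j - clampVel M c C η' j =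
      M * ((clampSq c C (slope M η j) - clampSq c C (slope M η' j)) -
        (clampSq c C (slope M η (j - 1)) - clampSq c C (slope M η' (j - 1)))) := by
      simp only [clampVel]; ring
    rw [Real.dist_eq, e, abs_mul, abs_of_pos hM]
    have h1 := abs_clampSq_sub_le hc hcC (slope M η j) (slope M η' j)
    have h2 := abs_clampSq_sub_le hc hcC (slope M η (j - 1)) (slope M η' (j - 1))
    have k1 := mul_le_mul_of_nonneg_left (hs j) (by linarith : 0 ≤ 2 * C)
    have k2 := mul_le_mul_of_nonneg_left (hs (j - 1)) (by linarith : 0 ≤ 2 * C)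
    have h3 := (abs_sub (clampSq c C (slope M η j) - clampSq c C (slope M η' j))
        (clampSq c C (slope M η (j - 1)) - clampSq c C (slope M η' (j - 1)))).trans
      (add_le_add (h1.trans k1) (h2.trans k2))
    have h4 := mul_le_mul_of_nonneg_left h3 hM.le
    refine h4.trans_eq (by ring)
  have hbd : ∀ η : ZMod n → ℝ, ‖clampVel M c C η‖ ≤ M * C ^ 2 := by
    intro η
    rw [pi_norm_le_iff_of_nonneg (by positivity)]
    intro j
    rw [Real.norm_eq_abs, clampVel, abs_mul, abs_of_pos hM]
    refine mul_le_mul_of_nonneg_left ?_ hM.le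
    have h1 := clampSq_bounds hc hcC (slope M η j)
    have h2 := clampSq_bounds hc hcC (slope M η (j - 1))
    rw [abs_le]
    constructor <;> linarith
  have hpl : IsPicardLindelof (fun _ : ℝ => clampVel (n := n) M c C)
      (⟨0, le_rfl, hT⟩ : Icc (0 : ℝ) T) η₀ (Real.toNNReal (M * C ^ 2 * T)) 0
      (Real.toNNReal (M * C ^ 2)) (Real.toNNReal (4 * C * M ^ 2)) := by
    refine ⟨fun _ _ => hlip.lipschitzOnWith, fun _ _ => continuousOn_const, fun _ _ η _ => ?_, ?_⟩
    · rw [Real.coe_toNNReal _ (by positivity)]; exact hbd η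
    · rw [Real.coe_toNNReal _ (by positivity), Real.coe_toNNReal _ (by positivity)]
      simp [hT]
  obtain ⟨η, h0, h1⟩ := hpl.exists_eq_forall_mem_Icc_hasDerivWithinAt₀
  exact ⟨η, h0, fun t ht => hasDerivWithinAt_pi.1 (h1 t ht)⟩

theorem exists_isScheme [NeZero n] (hM : 0 < M) (hc : 0 < c) (hcC : c ≤ C) (hT : 0 ≤ T)
    {η₀ : ZMod n → ℝ} (h0 : ∀ j, c ≤ slope M η₀ j ∧ slope M η₀ j ≤ C) :
    ∃ η : ℝ → ZMod n → ℝ, η 0 = η₀ ∧ IsScheme M c C T η := by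
  obtain ⟨η, e0, hη⟩ := exists_clamp_flow hM hc hcC hT η₀
  refine ⟨η, e0, ?_⟩
  have hd : ∀ t ∈ Icc 0 T, ∀ j, HasDerivWithinAt (fun s => slope M (η s) j)
      (M * (clampVel M c C (η t) (j + 1) - clampVel M c C (η t) j) / 2) (Icc 0 T) t :=
    fun t ht j => ((((hη t ht (j + 1)).sub (hη t ht j)).const_mul M).const_add 1).div_const 2
  have up : ∀ t ∈ Icc 0 T, ∀ j, slope M (η t) j ≤ C := by
    refine le_of_deriv_nonpos_at_max_finite (lt_add_one C) hd (fun j => e0 ▸ (h0 j).2) ?_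
    intro t ht j _ _ hmax
    have h1 := clampSq_mono (C := C) hc (hmax (j + 1))
    have h2 := clampSq_mono (C := C) hc (hmax (j - 1))
    simp only [clampVel, add_sub_cancel_right]
    have : M * (M * (clampSq c C (slope M (η t) (j + 1)) - clampSq c C (slope M (η t) j)) -
        M * (clampSq c C (slope M (η t) j) - clampSq c C (slope M (η t) (j - 1)))) ≤ 0 := by
      refine mul_nonpos_of_nonneg_of_nonpos hM.le ?_
      rw [← mul_sub]
      exact mul_nonpos_of_nonneg_of_nonpos hM.le (by linarith)
    linarith
  have lo : ∀ t ∈ Icc 0 T, ∀ j, -slope M (η t) j ≤ -c := by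
    refine le_of_deriv_nonpos_at_max_finite (lt_add_one (-c)) (fun t ht j => (hd t ht j).neg)
      (fun j => e0 ▸ neg_le_neg (h0 j).1) ?_
    intro t ht j _ _ hmax
    have h1 := clampSq_mono (C := C) hc (neg_le_neg_iff.1 (hmax (j + 1)))
    have h2 := clampSq_mono (C := C) hc (neg_le_neg_iff.1 (hmax (j - 1)))
    simp only [clampVel, add_sub_cancel_right]
    have : 0 ≤ M * (M * (clampSq c C (slope M (η t) (j + 1)) - clampSq c C (slope M (η t) j)) -
        M * (clampSq c C (slope M (η t) j) - clampSq c C (slope M (η t) (j - 1)))) := by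
      refine mul_nonneg hM.le ?_
      rw [← mul_sub]
      exact mul_nonneg hM.le (by linarith)
    linarith
  refine ⟨fun t ht j => ?_, fun t ht j => neg_le_neg_iff.1 (lo t ht j), up, hc, hM⟩
  have := hη t ht j
  rwa [clampVel, clampSq_of_mem (neg_le_neg_iff.1 (lo t ht j)) (up t ht j),
    clampSq_of_mem (neg_le_neg_iff.1 (lo t ht (j - 1))) (up t ht (j - 1))] at this

end Scheme

/-- An initially odd solution of the scheme stays odd. -/
theorem IsScheme.odd {n : ℕ} [NeZero n] {M c C T : ℝ} {η : ℝ → ZMod n → ℝ}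
    (h : IsScheme M c C T η) (h0 : ∀ j, η 0 (-j) = -η 0 j) :
    ∀ t ∈ Icc 0 T, ∀ j, η t (-j) = -η t j := by
  have hM := h.M_pos
  have key : ∀ σ : ℝ, σ = 1 ∨ σ = -1 → ∀ t ∈ Icc 0 T, ∀ j, σ * (η t j + η t (-j)) ≤ 0 := by
    intro σ hσ
    refine le_of_deriv_nonpos_at_max_finite one_pos
      (fun t ht j => ((h.ode t ht j).add (h.ode t ht (-j))).const_mul σ) ?_ ?_
    · intro j; rw [h0]; simp
    · intro t ht j _ _ hmax
      have m1 := hmax (j + 1)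
      have m2 := hmax (j - 1)
      have p1 := h.lower t ht j
      have p2 := h.lower t ht (j - 1)
      have p3 := h.lower t ht (-j)
      have p4 := h.lower t ht (-j - 1)
      have hc := h.c_pos
      have e1 : -(j + 1) = -j - 1 := by ring
      have e2 : -(j - 1) = -j + 1 := by ring
      rw [e1] at m1
      rw [e2] at m2
      have k1 : σ * (slope M (η t) j - slope M (η t) (-j - 1)) ≤ 0 := by
        have : σ * (slope M (η t) j - slope M (η t) (-j - 1)) =
          M * (σ * (η t (j + 1) + η t (-j - 1)) - σ * (η t j + η t (-j))) / 2 := by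
          simp only [Scheme.slope, sub_add_cancel]; ring
        rw [this]
        have := mul_nonpos_of_nonneg_of_nonpos hM.le (sub_nonpos.2 m1)
        linarith
      have k2 : σ * (slope M (η t) (-j) - slope M (η t) (j - 1)) ≤ 0 := by
        have : σ * (slope M (η t) (-j) - slope M (η t) (j - 1)) =
          M * (σ * (η t (j - 1) + η t (-j + 1)) - σ * (η t j + η t (-j))) / 2 := by
          simp only [Scheme.slope, sub_add_cancel]; ring
        rw [this]
        have := mul_nonpos_of_nonneg_of_nonpos hM.le (sub_nonpos.2 m2)
        linarith
      have e : σ * (vel M (η t) j + vel M (η t) (-j)) =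
        M * ((σ * (slope M (η t) j - slope M (η t) (-j - 1))) *
          (slope M (η t) j + slope M (η t) (-j - 1)) +
          (σ * (slope M (η t) (-j) - slope M (η t) (j - 1))) *
          (slope M (η t) (-j) + slope M (η t) (j - 1))) := by
        simp only [vel]; ring
      rw [e]
      refine mul_nonpos_of_nonneg_of_nonpos hM.le ?_
      have q1 := mul_nonpos_of_nonpos_of_nonneg k1
        (by linarith : 0 ≤ slope M (η t) j + slope M (η t) (-j - 1))
      have q2 := mul_nonpos_of_nonpos_of_nonneg k2
        (by linarith : 0 ≤ slope M (η t) (-j) + slope M (η t) (j - 1))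
      linarith
  intro t ht j
  have h1 := key 1 (Or.inl rfl) t ht j
  have h2 := key (-1) (Or.inr rfl) t ht j
  linarith

theorem abs_le_pow_succ_of_deriv {g g' : ℝ → ℝ} {K x₀ : ℝ} {k : ℕ} (hK : 0 ≤ K)
    (hx₀ : x₀ ∈ Icc (0 : ℝ) 1) (h0 : g x₀ = 0) (hg : ∀ x, HasDerivAt g (g' x) x)
    (hb : ∀ x ∈ Icc (0 : ℝ) 1, |g' x| ≤ K * |x - x₀| ^ k) :
    ∀ x ∈ Icc (0 : ℝ) 1, |g x| ≤ K * |x - x₀| ^ (k + 1) := by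
  intro x hx
  have h1 : ∀ y ∈ uIcc x₀ x, ‖g' y‖ ≤ K * |x - x₀| ^ k := by
    intro y hy
    refine (hb y (uIcc_subset_Icc hx₀ hx hy)).trans ?_
    have := abs_sub_left_of_mem_uIcc hy
    gcongr
  have h2 := (convex_uIcc x₀ x).norm_image_sub_le_of_norm_hasDerivWithin_le
    (fun y _ => (hg y).hasDerivWithinAt) h1 left_mem_uIcc right_mem_uIcc
  rw [h0, sub_zero, Real.norm_eq_abs, Real.norm_eq_abs] at h2
  exact h2.trans_eq (by ring)

theorem abs_sub_taylor_le {f : ℝ → ℝ} (hf : ContDiff ℝ 4 f) {K : ℝ}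
    (hK : ∀ θ ∈ Icc (0 : ℝ) 1, |iteratedDeriv 4 f θ| ≤ K) {x₀ x : ℝ} (hx₀ : x₀ ∈ Icc (0 : ℝ) 1)
    (hx : x ∈ Icc (0 : ℝ) 1) :
    |f x - (f x₀ + deriv f x₀ * (x - x₀) + iteratedDeriv 2 f x₀ / 2 * (x - x₀) ^ 2 +
      iteratedDeriv 3 f x₀ / 6 * (x - x₀) ^ 3)| ≤ K * |x - x₀| ^ 4 := by
  have hK0 : 0 ≤ K := (abs_nonneg _).trans (hK x₀ hx₀)
  have hd : ∀ m : ℕ, m < 4 → ∀ x, HasDerivAt (iteratedDeriv m f) (iteratedDeriv (m + 1) f x) x := by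
    intro m hm x
    rw [iteratedDeriv_succ]
    exact ((hf.differentiable_iteratedDeriv m (by exact_mod_cast hm)) x).hasDerivAt
  have hu : ∀ x : ℝ, HasDerivAt (fun x => x - x₀) 1 x := fun x => (hasDerivAt_id x).sub_const x₀
  have d3 := hd 3 (by norm_num)
  have d2 := hd 2 (by norm_num)
  have d1 := hd 1 (by norm_num)
  have d0 := hd 0 (by norm_num)
  rw [iteratedDeriv_zero] at d0
  have b3 := abs_le_pow_succ_of_deriv (k := 0)
    (g := fun x => iteratedDeriv 3 f x - iteratedDeriv 3 f x₀) hK0 hx₀ (sub_self _)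
    (fun x => (d3 x).sub_const (iteratedDeriv 3 f x₀)) (by simpa using hK)
  have b2 := abs_le_pow_succ_of_deriv
    (g := fun x => iteratedDeriv 2 f x - (iteratedDeriv 2 f x₀ + iteratedDeriv 3 f x₀ * (x - x₀)))
    hK0 hx₀ (by simp) (fun x => ((d2 x).sub
      (((hu x).const_mul (iteratedDeriv 3 f x₀)).const_add (iteratedDeriv 2 f x₀))).congr_deriv
      (by rw [mul_one])) b3
  have b1 := abs_le_pow_succ_of_deriv
    (g := fun x => iteratedDeriv 1 f x - (iteratedDeriv 1 f x₀ + iteratedDeriv 2 f x₀ * (x - x₀) +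
      iteratedDeriv 3 f x₀ / 2 * (x - x₀) ^ 2))
    hK0 hx₀ (by simp) (fun x => ((d1 x).sub
      ((((hu x).const_mul (iteratedDeriv 2 f x₀)).const_add (iteratedDeriv 1 f x₀)).add
      (((hu x).pow 2).const_mul (iteratedDeriv 3 f x₀ / 2)))).congr_deriv
      (by push_cast; ring)) b2
  have b0 := abs_le_pow_succ_of_deriv
    (g := fun x => f x - (f x₀ + iteratedDeriv 1 f x₀ * (x - x₀) +
      iteratedDeriv 2 f x₀ / 2 * (x - x₀) ^ 2 + iteratedDeriv 3 f x₀ / 6 * (x - x₀) ^ 3))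
    hK0 hx₀ (by simp) (fun x => ((d0 x).sub
      (((((hu x).const_mul (iteratedDeriv 1 f x₀)).const_add (f x₀)).add
      (((hu x).pow 2).const_mul (iteratedDeriv 2 f x₀ / 2))).add
      (((hu x).pow 3).const_mul (iteratedDeriv 3 f x₀ / 6)))).congr_deriv
      (by push_cast; ring)) b1
  have := b0 x hx
  rwa [iteratedDeriv_one] at this

/-- Extension of a function on `[0, 1]` to `[-1, 2]` by point reflection at the two endpoints of
its graph, for boundary values `0` and `1`. -/
noncomputable def reflExt (f : ℝ → ℝ) (θ : ℝ) : ℝ :=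
  if θ < 0 then -f (-θ) else if 1 < θ then 2 - f (2 - θ) else f θ

theorem reflExt_of_mem (f : ℝ → ℝ) {θ : ℝ} (hθ : θ ∈ Icc (0 : ℝ) 1) : reflExt f θ = f θ := by
  rw [reflExt, if_neg hθ.1.not_gt, if_neg hθ.2.not_gt]

theorem reflExt_of_nonpos {f : ℝ → ℝ} (h0 : f 0 = 0) {θ : ℝ} (hθ : θ ≤ 0) :
    reflExt f θ = -f (-θ) := by
  rcases hθ.lt_or_eq with h | rfl
  · rw [reflExt, if_pos h]
  · rw [reflExt_of_mem f (by simp)]; simp [h0]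

theorem reflExt_of_one_le {f : ℝ → ℝ} (h1 : f 1 = 1) {θ : ℝ} (hθ : 1 ≤ θ) :
    reflExt f θ = 2 - f (2 - θ) := by
  rcases hθ.lt_or_eq with h | rfl
  · rw [reflExt, if_neg (by linarith), if_pos h]
  · rw [reflExt_of_mem f (by simp), h1]; norm_num [h1]

theorem reflExt_neg {f : ℝ → ℝ} (h0 : f 0 = 0) {θ : ℝ} (h : θ ≤ 1) (h' : -1 ≤ θ) :
    reflExt f (-θ) = -reflExt f θ := by
  rcases le_total θ 0 with hθ | hθ
  · rw [reflExt_of_nonpos h0 hθ, reflExt_of_mem f ⟨by linarith, by linarith⟩, neg_neg]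
  · rw [reflExt_of_mem f ⟨hθ, h⟩, reflExt_of_nonpos h0 (by linarith), neg_neg]

theorem exists_cubic_approx {f : ℝ → ℝ} (hf : ContDiff ℝ 4 f) {K δ θ : ℝ} (f0 : f 0 = 0)
    (f1 : f 1 = 1) (g0 : iteratedDeriv 2 f 0 = 0) (g1 : iteratedDeriv 2 f 1 = 0)
    (hK : ∀ k : ℕ, k ≤ 4 → ∀ θ ∈ Icc (0 : ℝ) 1, |iteratedDeriv k f θ| ≤ K)
    (hδ0 : 0 ≤ δ) (hδ : 4 * δ ≤ 1) (hθ : θ ∈ Icc (0 : ℝ) 1) :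
    ∃ x₀ a b d e, |d| ≤ K ∧ |e| ≤ K ∧ |θ - x₀| ≤ 2 * δ ∧ ∀ x, |x - θ| ≤ 2 * δ →
      |reflExt f x - (a + b * (x - x₀) + d * (x - x₀) ^ 2 + e * (x - x₀) ^ 3)| ≤
        256 * K * δ ^ 4 := by
  have hT := fun {x₀ x : ℝ} => abs_sub_taylor_le hf (hK 4 le_rfl) (x₀ := x₀) (x := x)
  have hK0 : 0 ≤ K := (abs_nonneg _).trans (hK 0 (by norm_num) θ hθ)
  have h2 : ∀ θ ∈ Icc (0 : ℝ) 1, |iteratedDeriv 2 f θ / 2| ≤ K := fun θ hθ => by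
    have := hK 2 (by norm_num) θ hθ
    rw [abs_div, abs_two]; linarith [abs_nonneg (iteratedDeriv 2 f θ)]
  have h3 : ∀ θ ∈ Icc (0 : ℝ) 1, |iteratedDeriv 3 f θ / 6| ≤ K := fun θ hθ => by
    have := hK 3 (by norm_num) θ hθ
    rw [abs_div, abs_of_pos (by norm_num : (0 : ℝ) < 6)]
    linarith [abs_nonneg (iteratedDeriv 3 f θ)]
  have hp : ∀ {u}, |u| ≤ 4 * δ → K * |u| ^ 4 ≤ 256 * K * δ ^ 4 := by
    intro u hu
    have : |u| ^ 4 ≤ (4 * δ) ^ 4 := pow_le_pow_left₀ (abs_nonneg _) hu 4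
    calc _ ≤ K * (4 * δ) ^ 4 := mul_le_mul_of_nonneg_left this hK0
      _ = _ := by ring
  by_cases c1 : θ < 2 * δ
  · have z : (0 : ℝ) ∈ Icc (0 : ℝ) 1 := by simp
    refine ⟨0, f 0, deriv f 0, _, _, h2 0 z, h3 0 z, ?_, ?_⟩
    · rw [sub_zero, abs_of_nonneg hθ.1]; exact c1.le
    · intro x hx
      rw [abs_le] at hx
      have hθ0 := hθ.1
      have hu : |x| ≤ 4 * δ := abs_le.2 ⟨by linarith, by linarith⟩
      refine le_trans ?_ (hp hu)
      rcases le_total x 0 with h | h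
      · have := hT (x₀ := 0) (x := -x) z ⟨by linarith, by linarith⟩
        rw [reflExt_of_nonpos f0 h]
        rw [sub_zero, abs_neg, ← abs_neg (f (-x) - _)] at this
        refine (congrArg _ ?_).trans_le this
        rw [g0, f0]; ring
      · have := hT (x₀ := 0) (x := x) z ⟨by linarith, by linarith⟩
        rw [reflExt_of_mem f ⟨by linarith, by linarith⟩]
        simpa using this
  by_cases c2 : 1 - 2 * δ < θ
  · have z : (1 : ℝ) ∈ Icc (0 : ℝ) 1 := by simp
    refine ⟨1, f 1, deriv f 1, _, _, h2 1 z, h3 1 z, ?_, ?_⟩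
    · rw [abs_sub_comm, abs_of_nonneg (by linarith [hθ.2])]; linarith
    · intro x hx
      rw [abs_le] at hx
      have hθ1 := hθ.2
      have hu : |x - 1| ≤ 4 * δ := abs_le.2 ⟨by linarith, by linarith⟩
      refine le_trans ?_ (hp hu)
      rcases le_total 1 x with h | h
      · have := hT (x₀ := 1) (x := 2 - x) z ⟨by linarith, by linarith⟩
        rw [reflExt_of_one_le f1 h]
        rw [← abs_neg (f (2 - x) - _), show |2 - x - 1| = |x - 1| by
          rw [← abs_neg]; congr 1; ring] at this
        refine (congrArg _ ?_).trans_le this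
        rw [g1, f1]; ring
      · have := hT (x₀ := 1) (x := x) z ⟨by linarith, by linarith⟩
        rwa [reflExt_of_mem f ⟨by linarith, by linarith⟩]
  · have hδ2 : 0 ≤ 2 * δ := by linarith
    refine ⟨θ, f θ, deriv f θ, _, _, h2 θ hθ, h3 θ hθ, by simpa using hδ2, ?_⟩
    intro x hx
    refine le_trans ?_ (hp (hx.trans (by linarith)))
    rw [abs_le] at hx
    have hx' : x ∈ Icc (0 : ℝ) 1 := ⟨by linarith, by linarith⟩
    rw [reflExt_of_mem f hx']
    exact hT hθ hx'

theorem reflExt_differences {f : ℝ → ℝ} (hf : ContDiff ℝ 4 f) {K δ θ : ℝ} (f0 : f 0 = 0)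
    (f1 : f 1 = 1) (g0 : iteratedDeriv 2 f 0 = 0) (g1 : iteratedDeriv 2 f 1 = 0)
    (hK : ∀ k : ℕ, k ≤ 4 → ∀ θ ∈ Icc (0 : ℝ) 1, |iteratedDeriv k f θ| ≤ K)
    (hδ0 : 0 ≤ δ) (hδ : 4 * δ ≤ 1) (hθ : θ ∈ Icc (0 : ℝ) 1) :
    |reflExt f (θ + δ) - 2 * reflExt f θ + reflExt f (θ - δ)| ≤ 4096 * K * δ ^ 2 ∧
    |reflExt f (θ + 2 * δ) - 3 * reflExt f (θ + δ) + 3 * reflExt f θ - reflExt f (θ - δ)| ≤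
      4096 * K * δ ^ 3 ∧
    |reflExt f (θ + δ) - 3 * reflExt f θ + 3 * reflExt f (θ - δ) - reflExt f (θ - 2 * δ)| ≤
      4096 * K * δ ^ 3 ∧
    |reflExt f (θ + 2 * δ) - 4 * reflExt f (θ + δ) + 6 * reflExt f θ - 4 * reflExt f (θ - δ) +
      reflExt f (θ - 2 * δ)| ≤ 4096 * K * δ ^ 4 := by
  obtain ⟨x₀, a, b, d, e, hd, he, hx₀, h⟩ := exists_cubic_approx hf f0 f1 g0 g1 hK hδ0 hδ hθ
  have hK0 : 0 ≤ K := (abs_nonneg _).trans hd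
  have e0 := h θ (by simpa using hδ0)
  have e1 := h (θ + δ) (by rw [add_sub_cancel_left, abs_of_nonneg hδ0]; linarith)
  have e2 := h (θ + 2 * δ) (by rw [add_sub_cancel_left, abs_of_nonneg (by linarith)])
  have e3 := h (θ - δ) (by rw [sub_sub_cancel_left, abs_neg, abs_of_nonneg hδ0]; linarith)
  have e4 := h (θ - 2 * δ) (by rw [sub_sub_cancel_left, abs_neg, abs_of_nonneg (by linarith)])
  have p3 : K * δ ^ 3 ≤ K * δ ^ 2 := by
    refine mul_le_mul_of_nonneg_left (pow_le_pow_of_le_one hδ0 (by linarith) (by norm_num)) hK0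
  have p4 : K * δ ^ 4 ≤ K * δ ^ 3 := by
    refine mul_le_mul_of_nonneg_left (pow_le_pow_of_le_one hδ0 (by linarith) (by norm_num)) hK0
  have q2 : |d * δ ^ 2| ≤ K * δ ^ 2 := by
    rw [abs_mul, abs_of_nonneg (by positivity : 0 ≤ δ ^ 2)]; gcongr
  have q3 : |e * δ ^ 3| ≤ K * δ ^ 3 := by
    rw [abs_mul, abs_of_nonneg (by positivity : 0 ≤ δ ^ 3)]; gcongr
  have q4 : |e * (θ - x₀) * δ ^ 2| ≤ 2 * (K * δ ^ 3) := by
    rw [abs_mul, abs_mul, abs_of_nonneg (by positivity : 0 ≤ δ ^ 2)]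
    calc _ ≤ K * (2 * δ) * δ ^ 2 := by gcongr
      _ = _ := by ring
  have n3 : 0 ≤ K * δ ^ 3 := by positivity
  have n4 : 0 ≤ K * δ ^ 4 := by positivity
  have n2 : 0 ≤ K * δ ^ 2 := by positivity
  clear h
  simp only [abs_le] at *
  refine ⟨⟨?_, ?_⟩, ⟨?_, ?_⟩, ⟨?_, ?_⟩, ⟨?_, ?_⟩⟩ <;>
    linarith only [e0, e1, e2, e3, e4, p3, p4, q2, q3, q4, n2, n3, n4]

namespace Scheme

variable {n : ℕ} {M S B : ℝ} {η : ZMod n → ℝ}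

theorem bounds_of_differences (hs0 : ∀ j, 0 ≤ slope M η j)
    (hs : ∀ j, slope M η j ≤ S)
    (h2 : ∀ j, |M ^ 2 * (η (j + 1) - 2 * η j + η (j - 1))| ≤ B)
    (h3 : ∀ j, |M ^ 3 * (η (j + 2) - 3 * η (j + 1) + 3 * η j - η (j - 1))| ≤ B)
    (h4 : ∀ j, |M ^ 4 * (η (j + 2) - 4 * η (j + 1) + 6 * η j - 4 * η (j - 1) + η (j - 2))| ≤ B)
    (j : ZMod n) :
    |vel M η j| ≤ 2 * B * S ∧ |press M η j| ≤ S * (2 * B * S + 2 * B ^ 2) ∧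
      |acc M η j| ≤ B * (2 * B * S + 2 * B ^ 2) + S * (2 * B * S + 6 * B ^ 2) := by
  have hB : 0 ≤ B := (abs_nonneg _).trans (h2 j)
  have hS : 0 ≤ S := (hs0 j).trans (hs j)
  set r : ZMod n → ℝ := fun j => M * (slope M η j - slope M η (j - 1)) with hr
  set q : ZMod n → ℝ := fun j => M * (r (j + 1) - r j) with hq
  have br : ∀ j, |r j| ≤ B := by
    intro j
    have e : r j = M ^ 2 * (η (j + 1) - 2 * η j + η (j - 1)) / 2 := by
      simp only [hr, Scheme.slope, sub_add_cancel]; ring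
    rw [e, abs_div, abs_two]
    linarith [h2 j]
  have bq : ∀ j, |q j| ≤ B := by
    intro j
    have e : q j = M ^ 3 * (η (j + 2) - 3 * η (j + 1) + 3 * η j - η (j - 1)) / 2 := by
      simp only [hq, hr, Scheme.slope, sub_add_cancel, add_sub_cancel_right, add_assoc,
        one_add_one_eq_two]
      ring
    rw [e, abs_div, abs_two]
    linarith [h3 j]
  have bqq : ∀ j, |M * (q j - q (j - 1))| ≤ B := by
    intro j
    have e : M * (q j - q (j - 1)) =
        M ^ 4 * (η (j + 2) - 4 * η (j + 1) + 6 * η j - 4 * η (j - 1) + η (j - 2)) / 2 := by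
      simp only [hq, hr, Scheme.slope, sub_add_cancel, add_sub_cancel_right, add_assoc,
        one_add_one_eq_two, sub_sub]
      ring_nf
    rw [e, abs_div, abs_two]
    linarith [h4 j]
  have ss : ∀ i j, |slope M η i + slope M η j| ≤ 2 * S := fun i j => by
    rw [abs_of_nonneg (add_nonneg (hs0 i) (hs0 j))]; linarith [hs i, hs j]
  have rr : ∀ i j, |r i + r j| ≤ 2 * B := fun i j =>
    (abs_add_le _ _).trans (by linarith [br i, br j])
  have mm : ∀ {a b x y : ℝ}, |a| ≤ x → |b| ≤ y → |a * b| ≤ x * y := fun h h' => by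
    rw [abs_mul]; exact mul_le_mul h h' (abs_nonneg _) ((abs_nonneg _).trans h)
  have ev : ∀ j, vel M η j = r j * (slope M η j + slope M η (j - 1)) := fun j => by
    simp only [vel, hr]; ring
  have ez : ∀ j, velDiff M η j = q j * (slope M η (j + 1) + slope M η j) +
      r j * (r (j + 1) + r j) := fun j => by
    simp only [velDiff, vel, hq, hr, add_sub_cancel_right]; ring
  have bz : ∀ j, |velDiff M η j| ≤ 2 * B * S + 2 * B ^ 2 := fun j => by
    rw [ez]
    refine (abs_add_le _ _).trans ((add_le_add (mm (bq j) (ss _ _)) (mm (br j) (rr _ _))).trans_eq ?_)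
    ring
  refine ⟨?_, ?_, ?_⟩
  · rw [ev]
    exact (mm (br j) (ss _ _)).trans_eq (by ring)
  · exact mm (by rw [abs_of_nonneg (hs0 j)]; exact hs j) (bz j)
  · have e : acc M η j = r j * velDiff M η j + slope M η (j - 1) *
        (M * (q j - q (j - 1)) * (slope M η (j + 1) + slope M η j) +
          q (j - 1) * (r (j + 1) + r j) + (q (j - 1) * (r (j + 1) + r j) +
          r (j - 1) * (q j + q (j - 1)))) := by
      have e1 : q (j - 1) = M * (r j - r (j - 1)) := by simp only [hq, sub_add_cancel]
      have e2 : r (j + 1) = M * (slope M η (j + 1) - slope M η j) := by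
        simp only [hr, add_sub_cancel_right]
      have e3 : velDiff M η (j - 1) = q (j - 1) * (slope M η j + slope M η (j - 1)) +
        r (j - 1) * (r j + r (j - 1)) := by rw [ez, sub_add_cancel]
      have e4 : q j = M * (r (j + 1) - r j) := rfl
      have e5 : r j = M * (slope M η j - slope M η (j - 1)) := rfl
      rw [acc, press, press, e3, ez]
      generalize r (j - 1) = rm at *
      generalize q (j - 1) = qm at *
      generalize q j = q0 at *
      generalize r (j + 1) = r1 at *
      generalize r j = r0 at *
      have d1 : M * slope M η (j + 1) = r1 + M * slope M η j := by rw [e2]; ring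
      have d2 : M * slope M η j = r0 + M * slope M η (j - 1) := by rw [e5]; ring
      have d3 : M * r0 = qm + M * rm := by rw [e1]; ring
      have d4 : M * r1 = q0 + M * r0 := by rw [e4]; ring
      linear_combination (q0 * (slope M η (j + 1) + slope M η j) + r0 * (r1 + r0)) * d2 +
        slope M η (j - 1) * qm * (d1 + d2) + slope M η (j - 1) * ((r1 + r0) * d3 + rm * (d4 + d3))
    rw [e]
    have k : |M * (q j - q (j - 1)) * (slope M η (j + 1) + slope M η j) +
          q (j - 1) * (r (j + 1) + r j) + (q (j - 1) * (r (j + 1) + r j) +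
          r (j - 1) * (q j + q (j - 1)))| ≤ 2 * B * S + 6 * B ^ 2 := by
      refine (abs_add_le _ _).trans ?_
      have k1 := mm (bqq j) (ss (j + 1) j)
      have k2 := mm (bq (j - 1)) (rr (j + 1) j)
      have k3 := mm (br (j - 1)) ((abs_add_le _ _).trans (add_le_add (bq j) (bq (j - 1))))
      linarith [abs_add_le (M * (q j - q (j - 1)) * (slope M η (j + 1) + slope M η j))
        (q (j - 1) * (r (j + 1) + r j)), abs_add_le (q (j - 1) * (r (j + 1) + r j))
        (r (j - 1) * (q j + q (j - 1)))]
    refine (abs_add_le _ _).trans (add_le_add (mm (br j) (bz j)) (mm ?_ k))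
    rw [abs_of_nonneg (hs0 _)]; exact hs _

end Scheme

/-- The periodic part of the sampled initial datum. -/
noncomputable def initData (f : ℝ → ℝ) (m : ℕ) (j : ZMod (2 * m)) : ℝ :=
  reflExt f (j.val / m) - j.val / m

section initData

variable {f : ℝ → ℝ} {m : ℕ}

theorem initData_natCast (f0 : f 0 = 0) (hm : 0 < m) {k : ℕ} (hk : k ≤ 2 * m) :
    initData f m (k : ZMod (2 * m)) = reflExt f (k / m) - k / m := by
  have hm' : (m : ℝ) ≠ 0 := by positivity
  rcases hk.lt_or_eq with h | rfl
  · rw [initData, ZMod.val_natCast_of_lt h]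
  · rw [ZMod.natCast_self, initData, ZMod.val_zero]
    have : ((2 * m : ℕ) : ℝ) / m = 2 := by push_cast; field_simp
    rw [this, Nat.cast_zero, zero_div, reflExt_of_mem f (by simp), f0]
    norm_num [reflExt, f0]

theorem initData_intCast (f0 : f 0 = 0) (f1 : f 1 = 1) (hm : 0 < m) {k : ℤ} (hk : -m ≤ k)
    (hk' : k ≤ 2 * m) : initData f m (k : ZMod (2 * m)) = reflExt f (k / m) - k / m := by
  have hm' : (0 : ℝ) < m := by positivity
  rcases le_or_gt 0 k with h | h
  · lift k to ℕ using h
    have := initData_natCast f0 hm (k := k) (by omega)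
    rwa [Int.cast_natCast, Int.cast_natCast]
  · obtain ⟨l, hl⟩ := Int.eq_ofNat_of_zero_le (by omega : 0 ≤ k + 2 * m)
    have e : (k : ZMod (2 * m)) = (l : ZMod (2 * m)) := by
      have h1 : ((k + 2 * m : ℤ) : ZMod (2 * m)) = ((l : ℤ) : ZMod (2 * m)) := by rw [hl]
      have h2 : (2 * m : ZMod (2 * m)) = 0 := by exact_mod_cast ZMod.natCast_self (2 * m)
      push_cast at h1
      rwa [h2, add_zero] at h1
    rw [e, initData_natCast f0 hm (by omega)]
    have e2 : (l : ℝ) / m = k / m + 2 := by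
      have : (l : ℝ) = k + 2 * m := by exact_mod_cast hl.symm
      rw [this]; field_simp
    have k1 : (k : ℝ) / m < 0 := div_neg_of_neg_of_pos (by exact_mod_cast h) hm'
    have k2 : -1 ≤ (k : ℝ) / m := by
      rw [le_div_iff₀ hm']; have : (-m : ℝ) ≤ k := by exact_mod_cast hk
      linarith
    rw [e2, reflExt_of_nonpos f0 k1.le]
    rw [reflExt_of_one_le f1 (by linarith)]
    ring_nf

theorem exists_rep (hm : 0 < m) (j : ZMod (2 * m)) :
    ∃ k : ℤ, 0 ≤ k ∧ k ≤ m ∧ (j = k ∨ j = -k) := by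
  have : NeZero (2 * m) := ⟨by omega⟩
  have h := j.val_lt
  have e := ZMod.natCast_zmod_val j
  rcases le_or_gt j.val m with h' | h'
  · exact ⟨j.val, by omega, by omega, Or.inl (by exact_mod_cast e.symm)⟩
  · refine ⟨2 * m - j.val, by omega, by omega, Or.inr ?_⟩
    have h2 : (2 * m : ZMod (2 * m)) = 0 := by exact_mod_cast ZMod.natCast_self (2 * m)
    push_cast
    rw [h2, e]; ring

theorem initData_neg (f0 : f 0 = 0) (f1 : f 1 = 1) (hm : 0 < m) (j : ZMod (2 * m)) :
    initData f m (-j) = -initData f m j := by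
  have key : ∀ k : ℤ, 0 ≤ k → k ≤ m →
      initData f m (-(k : ZMod (2 * m))) = -initData f m (k : ZMod (2 * m)) := by
    intro k h1 h2
    have hm' : (0 : ℝ) < m := by positivity
    have k1 : (k : ℝ) / m ≤ 1 := by
      rw [div_le_one hm']; exact_mod_cast h2
    have k2 : 0 ≤ (k : ℝ) / m := div_nonneg (by exact_mod_cast h1) hm'.le
    have := initData_intCast f0 f1 hm (k := -k) (by omega) (by omega)
    push_cast at this
    rw [this, initData_intCast f0 f1 hm (by omega) (by omega), neg_div,
      reflExt_neg f0 k1 (by linarith)]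
    ring
  obtain ⟨k, h1, h2, rfl | rfl⟩ := exists_rep hm j
  · exact key k h1 h2
  · rw [key k h1 h2, neg_neg, neg_neg]

theorem initData_slope (f0 : f 0 = 0) (f1 : f 1 = 1) (hm : 0 < m) {c C : ℝ}
    (hs : ∀ x y, 0 ≤ x → x ≤ y → y ≤ 1 → c * (y - x) ≤ f y - f x ∧ f y - f x ≤ C * (y - x))
    (j : ZMod (2 * m)) : c / 2 ≤ slope m (initData f m) j ∧ slope m (initData f m) j ≤ C / 2 := by
  have hm' : (0 : ℝ) < m := by positivity
  have key : ∀ k : ℤ, 0 ≤ k → k + 1 ≤ m → c ≤ 1 + m * (initData f m ((k + 1 : ℤ) : ZMod (2 * m)) -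
      initData f m (k : ZMod (2 * m))) ∧ 1 + m * (initData f m ((k + 1 : ℤ) : ZMod (2 * m)) -
      initData f m (k : ZMod (2 * m))) ≤ C := by
    intro k h1 h2
    have k1 : ((k + 1 : ℤ) : ℝ) / m ≤ 1 := by
      rw [div_le_one hm']; exact_mod_cast h2
    have k2 : 0 ≤ (k : ℝ) / m := div_nonneg (by exact_mod_cast h1) hm'.le
    have k3 : ((k + 1 : ℤ) : ℝ) / m - k / m = 1 / m := by push_cast; field_simp; ring
    have k4 : (0 : ℝ) < 1 / m := by positivity
    have := hs (k / m) ((k + 1 : ℤ) / m) k2 (by linarith) k1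
    rw [k3] at this
    rw [initData_intCast f0 f1 hm (by omega) (by omega), initData_intCast f0 f1 hm (by omega) (by omega),
      reflExt_of_mem f ⟨by linarith, k1⟩, reflExt_of_mem f ⟨by linarith, by linarith⟩]
    have e : 1 + m * (f ((k + 1 : ℤ) / m) - (k + 1 : ℤ) / m - (f (k / m) - k / m)) =
      m * (f ((k + 1 : ℤ) / m) - f (k / m)) := by
      push_cast; field_simp; ring
    rw [e]
    have e2 : ∀ a : ℝ, a = m * (a * (1 / m)) := fun a => by field_simp
    constructor
    · rw [e2 c]; exact mul_le_mul_of_nonneg_left this.1 hm'.le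
    · rw [e2 C]; exact mul_le_mul_of_nonneg_left this.2 hm'.le
  have key2 : ∃ k : ℤ, 0 ≤ k ∧ k + 1 ≤ m ∧ (j = k ∨ j = -((k + 1 : ℤ) : ZMod (2 * m))) := by
    obtain ⟨k, h1, h2, h3⟩ := exists_rep hm j
    have h20 : (2 * m : ZMod (2 * m)) = 0 := by exact_mod_cast ZMod.natCast_self (2 * m)
    rcases h3 with rfl | rfl
    · rcases h2.lt_or_eq with h | rfl
      · exact ⟨k, h1, by omega, Or.inl rfl⟩
      · refine ⟨m - 1, by omega, by omega, Or.inr ?_⟩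
        push_cast
        linear_combination h20
    · rcases h1.lt_or_eq with h | rfl
      · exact ⟨k - 1, by omega, by omega, Or.inr (by simp)⟩
      · exact ⟨0, by omega, by omega, Or.inl (by simp)⟩
  obtain ⟨k, h1, h2, h3⟩ := key2
  have := key k h1 h2
  have e : slope m (initData f m) j = (1 + m * (initData f m ((k + 1 : ℤ) : ZMod (2 * m)) -
      initData f m (k : ZMod (2 * m)))) / 2 := by
    rw [Scheme.slope]
    rcases h3 with rfl | rfl
    · push_cast; rfl
    · rw [initData_neg f0 f1 hm, show -((k + 1 : ℤ) : ZMod (2 * m)) + 1 = -(k : ZMod (2 * m)) by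
        push_cast; ring, initData_neg f0 f1 hm]
      ring
  rw [e]
  constructor <;> linarith

theorem initData_differences (hf : ContDiff ℝ 4 f) {K : ℝ} (f0 : f 0 = 0)
    (f1 : f 1 = 1) (g0 : iteratedDeriv 2 f 0 = 0) (g1 : iteratedDeriv 2 f 1 = 0)
    (hK : ∀ k : ℕ, k ≤ 4 → ∀ θ ∈ Icc (0 : ℝ) 1, |iteratedDeriv k f θ| ≤ K) (hm : 4 ≤ m)
    (j : ZMod (2 * m)) {η : ZMod (2 * m) → ℝ} (hη : η = initData f m) :
    |(m : ℝ) ^ 2 * (η (j + 1) - 2 * η j + η (j - 1))| ≤ 4096 * K ∧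
    |(m : ℝ) ^ 3 * (η (j + 2) - 3 * η (j + 1) + 3 * η j - η (j - 1))| ≤ 4096 * K ∧
    |(m : ℝ) ^ 4 * (η (j + 2) - 4 * η (j + 1) + 6 * η j - 4 * η (j - 1) + η (j - 2))| ≤ 4096 * K := by
  have hm0 : 0 < m := by omega
  have hm' : (0 : ℝ) < m := by positivity
  have h4m : (4 : ℝ) ≤ m := by exact_mod_cast hm
  have hδ : 4 * (1 / (m : ℝ)) ≤ 1 := by rw [mul_one_div, div_le_one hm']; exact h4m
  have conv : ∀ (p : ℕ) (x : ℝ), |x| ≤ 4096 * K * (1 / m) ^ p → |(m : ℝ) ^ p * x| ≤ 4096 * K := by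
    intro p x hx
    rw [abs_mul, abs_of_pos (by positivity : (0 : ℝ) < m ^ p)]
    refine (mul_le_mul_of_nonneg_left hx (by positivity)).trans_eq ?_
    rw [one_div, inv_pow]; field_simp
  obtain ⟨k, h1, h2, h3⟩ := exists_rep hm0 j
  have k1 : (k : ℝ) / m ≤ 1 := by
    rw [div_le_one hm']; exact_mod_cast h2
  have k2 : 0 ≤ (k : ℝ) / m := div_nonneg (by exact_mod_cast h1) hm'.le
  obtain ⟨d2, d3, d3', d4⟩ := reflExt_differences hf f0 f1 g0 g1 hK (by positivity) hδ
    (⟨k2, k1⟩ : (k : ℝ) / m ∈ Icc (0 : ℝ) 1)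
  have ev : ∀ i : ℤ, -2 ≤ i → i ≤ 2 → η ((k : ZMod (2 * m)) + (i : ZMod (2 * m))) =
      reflExt f (k / m + i * (1 / m)) - (k / m + i * (1 / m)) := by
    intro i hi hi'
    have := initData_intCast f0 f1 hm0 (k := k + i) (by omega) (by omega)
    push_cast at this
    rw [hη, this]
    ring_nf
  have ev0 := ev 0 (by norm_num) (by norm_num)
  have ev1 := ev 1 (by norm_num) (by norm_num)
  have ev2 := ev 2 (by norm_num) (by norm_num)
  have ev3 := ev (-1) (by norm_num) (by norm_num)
  have ev4 := ev (-2) (by norm_num) (by norm_num)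
  push_cast at ev0 ev1 ev2 ev3 ev4
  rw [add_zero, zero_mul, add_zero] at ev0
  rw [one_mul] at ev1
  rw [neg_one_mul, ← sub_eq_add_neg, ← sub_eq_add_neg] at ev3
  rw [neg_mul, ← sub_eq_add_neg, ← sub_eq_add_neg] at ev4
  have hodd : ∀ j, η (-j) = -η j := by rw [hη]; exact initData_neg f0 f1 hm0
  rcases h3 with rfl | rfl
  · rw [ev0, ev1, ev2, ev3, ev4]
    refine ⟨conv 2 _ ?_, conv 3 _ ?_, conv 4 _ ?_⟩
    · exact (congrArg _ (by ring)).trans_le d2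
    · exact (congrArg _ (by ring)).trans_le d3
    · exact (congrArg _ (by ring)).trans_le d4
  · rw [show -(k : ZMod (2 * m)) + 1 = -(k - 1) by ring, show -(k : ZMod (2 * m)) + 2 = -(k - 2) by ring,
      show -(k : ZMod (2 * m)) - 1 = -(k + 1) by ring, show -(k : ZMod (2 * m)) - 2 = -(k + 2) by ring,
      hodd, hodd, hodd, hodd, hodd, ev0, ev1, ev2, ev3, ev4]
    refine ⟨conv 2 _ ?_, conv 3 _ ?_, conv 4 _ ?_⟩
    · rw [← abs_neg]; exact (congrArg _ (by ring)).trans_le d2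
    · exact (congrArg _ (by ring)).trans_le d3'
    · rw [← abs_neg]; exact (congrArg _ (by ring)).trans_le d4

end initData

theorem exists_scheme_family (c C K : ℝ) (hc : 0 < c) (hcC : c ≤ C) (hK0 : 0 ≤ K) :
    ∃ A, ∀ f : ℝ → ℝ, ContDiff ℝ 4 f → f 0 = 0 → f 1 = 1 → iteratedDeriv 2 f 0 = 0 →
      iteratedDeriv 2 f 1 = 0 →
      (∀ k : ℕ, k ≤ 4 → ∀ θ ∈ Icc (0 : ℝ) 1, |iteratedDeriv k f θ| ≤ K) →
      (∀ x y, 0 ≤ x → x ≤ y → y ≤ 1 → c * (y - x) ≤ f y - f x ∧ f y - f x ≤ C * (y - x)) →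
      ∀ m : ℕ, 4 ≤ m → ∀ T : ℝ, 0 ≤ T → ∃ η : ℝ → ZMod (2 * m) → ℝ,
        IsScheme m (c / 2) (C / 2) T η ∧ η 0 = initData f m ∧
        (∀ t ∈ Icc 0 T, ∀ j, η t (-j) = -η t j) ∧ ∀ t ∈ Icc 0 T, ∀ j,
          |(m : ℝ) ^ 3 * (η t (j + 1 + 1 + 1) - 3 * η t (j + 1 + 1) + 3 * η t (j + 1) - η t j)| ≤
            A ∧
          |(m : ℝ) ^ 4 * (η t (j + 1 + 1 + 1 + 1) - 4 * η t (j + 1 + 1 + 1) +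
            6 * η t (j + 1 + 1) - 4 * η t (j + 1) + η t j)| ≤ A := by
  have hC : 0 < C := hc.trans_le hcC
  set B := 4096 * K with hB
  set S := C / 2 with hS
  obtain ⟨A, hA⟩ := IsScheme.exists_bound (c / 2) (C / 2) (2 * B * S)
    (S * (2 * B * S + 2 * B ^ 2)) (B * (2 * B * S + 2 * B ^ 2) + S * (2 * B * S + 6 * B ^ 2))
    (by positivity) (by positivity)
  refine ⟨A, ?_⟩
  intro f hf f0 f1 g0 g1 hK hs m hm T hT
  have hm0 : 0 < m := by omega
  have : NeZero (2 * m) := ⟨by omega⟩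
  have hsl := initData_slope f0 f1 hm0 hs
  obtain ⟨η, e0, h⟩ := exists_isScheme (n := 2 * m) (M := m) (by exact_mod_cast hm0)
    (half_pos hc) (by linarith : c / 2 ≤ C / 2) hT hsl
  have hd := fun j => initData_differences hf f0 f1 g0 g1 hK hm j rfl
  have hb := bounds_of_differences (S := S) (fun j => (half_pos hc).le.trans (hsl j).1)
    (fun j => (hsl j).2) (fun j => (hd j).1) (fun j => (hd j).2.1) (fun j => (hd j).2.2)
  refine ⟨η, h, e0, h.odd (by rw [e0]; exact initData_neg f0 f1 hm0), ?_⟩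
  exact hA (2 * m) m T η h (by rw [e0]; exact fun j => (hb j).1)
    (by rw [e0]; exact fun j => (hb j).2.1) (by rw [e0]; exact fun j => (hb j).2.2)

theorem abs_fwdDiff_natCast_le {n : ℕ} {u : ZMod n → ℝ} {B : ℝ} (h : ∀ j, |fwdDiff 1 u j| ≤ B)
    (k : ℕ) (j : ZMod n) : |fwdDiff (k : ZMod n) u j| ≤ k * B := by
  induction k with
  | zero => simp [fwdDiff]
  | succ k ih =>
    have e : fwdDiff ((k + 1 : ℕ) : ZMod n) u j = fwdDiff 1 u (j + k) + fwdDiff (k : ZMod n) u j := by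
      simp only [fwdDiff]; push_cast; rw [add_assoc]; ring
    rw [e]
    refine (abs_add_le _ _).trans ((add_le_add (h _) ih).trans_eq ?_)
    push_cast; ring

theorem fwdDiff_comm' {n : ℕ} (h k : ZMod n) (u : ZMod n → ℝ) :
    fwdDiff h (fwdDiff k u) = fwdDiff k (fwdDiff h u) := by
  ext j
  simp only [fwdDiff]
  rw [add_right_comm]; ring

theorem abs_fwdDiff_three_le {n : ℕ} {u : ZMod n → ℝ} {B : ℝ}
    (h : ∀ j, |u (j + 1 + 1 + 1) - 3 * u (j + 1 + 1) + 3 * u (j + 1) - u j| ≤ B) (k : ℕ)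
    (j : ZMod n) :
    |u (j + k + k + k) - 3 * u (j + k + k) + 3 * u (j + k) - u j| ≤ (k : ℝ) ^ 3 * B := by
  have h1 : ∀ j, |fwdDiff 1 (fwdDiff 1 (fwdDiff 1 u)) j| ≤ B := fun j =>
    (congrArg _ (by simp only [fwdDiff]; ring)).trans_le (h j)
  have h2 := abs_fwdDiff_natCast_le h1 k
  rw [fwdDiff_comm' (k : ZMod n)] at h2
  have h3 := abs_fwdDiff_natCast_le h2 k
  rw [fwdDiff_comm' (k : ZMod n) 1, fwdDiff_comm' (k : ZMod n) 1] at h3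
  have h4 := abs_fwdDiff_natCast_le h3 k j
  refine (congrArg _ ?_).trans_le (h4.trans_eq (by ring))
  simp only [fwdDiff]; ring

theorem abs_fwdDiff_four_le {n : ℕ} {u : ZMod n → ℝ} {B : ℝ}
    (h : ∀ j, |u (j + 1 + 1 + 1 + 1) - 4 * u (j + 1 + 1 + 1) + 6 * u (j + 1 + 1) -
      4 * u (j + 1) + u j| ≤ B) (k : ℕ) (j : ZMod n) :
    |u (j + k + k + k + k) - 4 * u (j + k + k + k) + 6 * u (j + k + k) - 4 * u (j + k) + u j| ≤
      (k : ℝ) ^ 4 * B := by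
  have h1 : ∀ j, |fwdDiff 1 u (j + 1 + 1 + 1) - 3 * fwdDiff 1 u (j + 1 + 1) +
      3 * fwdDiff 1 u (j + 1) - fwdDiff 1 u j| ≤ B := fun j =>
    (congrArg _ (by simp only [fwdDiff]; ring)).trans_le (h j)
  have h2 : ∀ j, |fwdDiff 1 (fun j => u (j + k + k + k) - 3 * u (j + k + k) + 3 * u (j + k) - u j) j|
      ≤ (k : ℝ) ^ 3 * B := fun j =>
    (congrArg _ (by
      simp only [fwdDiff]
      have r : ∀ j : ZMod n, j + 1 + k = j + k + 1 := fun j => add_right_comm j 1 k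
      simp only [r]
      ring)).trans_le (abs_fwdDiff_three_le h1 k j)
  refine (congrArg _ ?_).trans_le ((abs_fwdDiff_natCast_le h2 k j).trans_eq (by ring))
  simp only [fwdDiff]; ring

theorem exists_deriv_eq_central_diff {φ : ℝ → ℝ} (hφ : ContDiff ℝ 2 φ) {θ h : ℝ} (hh : 0 < h) :
    ∃ ξ ∈ Ioo (θ - h) (θ + h), φ (θ + h) - φ (θ - h) = 2 * h * deriv φ ξ := by
  have hd := hφ.differentiable (by norm_num)
  obtain ⟨ξ, h1, h2⟩ := exists_deriv_eq_slope φ (by linarith : θ - h < θ + h)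
    hd.continuous.continuousOn hd.differentiableOn
  refine ⟨ξ, h1, ?_⟩
  rw [h2]
  have : θ + h - (θ - h) ≠ 0 := by linarith
  field_simp
  ring

theorem exists_deriv_deriv_eq_second_diff {φ : ℝ → ℝ} (hφ : ContDiff ℝ 2 φ) {θ h : ℝ} (hh : 0 < h) :
    ∃ ζ ∈ Ioo (θ - h) (θ + h), φ (θ + h) - 2 * φ θ + φ (θ - h) = h ^ 2 * deriv (deriv φ) ζ := by
  have hd := hφ.differentiable (by norm_num)
  have hd' : ContDiff ℝ 1 (deriv φ) := ((contDiff_succ_iff_deriv (n := 1)).1 hφ).2.2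
  have hdd := hd'.differentiable (by norm_num)
  have e : ∀ u : ℝ, HasDerivAt (fun u => φ (θ + u) - 2 * φ θ + φ (θ - u))
      (deriv φ (θ + u) - deriv φ (θ - u)) u := by
    intro u
    have h1 : HasDerivAt (fun u => φ (θ + u)) (deriv φ (θ + u)) u := by
      exact (hd (θ + u)).hasDerivAt.comp_const_add θ u
    have h2 : HasDerivAt (fun u => φ (θ - u)) (-deriv φ (θ - u)) u := by
      exact (hd (θ - u)).hasDerivAt.comp_const_sub θ u
    exact ((h1.sub_const _).add h2).congr_deriv (by ring)
  have e2 : ∀ u : ℝ, HasDerivAt (fun u : ℝ => u ^ 2) (2 * u) u := fun u => by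
    simpa using hasDerivAt_pow 2 u
  obtain ⟨u, hu, h1⟩ := exists_ratio_hasDerivAt_eq_ratio_slope _ _ hh
    (fun u _ => (e u).continuousAt.continuousWithinAt) (fun u _ => e u)
    (fun u : ℝ => u ^ 2) (fun u => 2 * u)
    (fun u _ => (e2 u).continuousAt.continuousWithinAt) (fun u _ => e2 u)
  obtain ⟨ζ, h2, h3⟩ := exists_deriv_eq_slope (deriv φ) (by linarith [hu.1] : θ - u < θ + u)
    hdd.continuous.continuousOn hdd.differentiableOn
  have hu0 := hu.1
  refine ⟨ζ, ⟨by linarith [h2.1, hu.2], by linarith [h2.2, hu.2]⟩, ?_⟩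
  rw [h3]
  have : θ + u - (θ - u) ≠ 0 := by linarith
  have h4 : (θ + u - (θ - u)) = 2 * u := by ring
  rw [h4]
  simp only [add_zero, sub_zero] at h1
  have : u ≠ 0 := hu0.ne'
  field_simp
  linear_combination -h1

theorem exists_flux_eq {φ : ℝ → ℝ} (hφ : ContDiff ℝ 2 φ) {θ h : ℝ} (hh : 0 < h) :
    ∃ ξ ∈ Ioo (θ - h) (θ + h), ∃ ζ ∈ Ioo (θ - h) (θ + h),
      (1 / (4 * h ^ 3)) * ((φ (θ + h) - φ θ) ^ 2 - (φ θ - φ (θ - h)) ^ 2) =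
        1 / 2 * deriv φ ξ * deriv (deriv φ) ζ := by
  obtain ⟨ξ, h1, e1⟩ := exists_deriv_eq_central_diff hφ hh (θ := θ)
  obtain ⟨ζ, h2, e2⟩ := exists_deriv_deriv_eq_second_diff hφ hh (θ := θ)
  refine ⟨ξ, h1, ζ, h2, ?_⟩
  have : (φ (θ + h) - φ θ) ^ 2 - (φ θ - φ (θ - h)) ^ 2 =
      (φ (θ + h) - φ (θ - h)) * (φ (θ + h) - 2 * φ θ + φ (θ - h)) := by ring
  rw [this, e1, e2]
  field_simp
  ring

theorem exists_flux_consistency {φ : ℝ → ℝ} (hφ : ContDiff ℝ 2 φ) {ε : ℝ} (hε : 0 < ε) :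
    ∃ δ > 0, ∀ h, 0 < h → h < δ → ∀ θ, 0 ≤ θ - h → θ + h ≤ 1 →
      |1 / 2 * deriv φ θ * deriv (deriv φ) θ -
        (1 / (4 * h ^ 3)) * ((φ (θ + h) - φ θ) ^ 2 - (φ θ - φ (θ - h)) ^ 2)| ≤ ε := by
  have hd' : ContDiff ℝ 1 (deriv φ) := ((contDiff_succ_iff_deriv (n := 1)).1 hφ).2.2
  have hdd : Continuous (deriv (deriv φ)) := hd'.continuous_deriv le_rfl
  have hc : ContinuousOn (fun p : ℝ × ℝ => 1 / 2 * deriv φ p.1 * deriv (deriv φ) p.2)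
      (Icc 0 1 ×ˢ Icc 0 1) := by
    have := hd'.continuous
    exact Continuous.continuousOn (by fun_prop)
  have hu := (isCompact_Icc.prod isCompact_Icc).uniformContinuousOn_of_continuous hc
  obtain ⟨δ, hδ, H⟩ := Metric.uniformContinuousOn_iff.1 hu ε hε
  refine ⟨δ, hδ, fun h hh hhδ θ h0 h1 => ?_⟩
  obtain ⟨ξ, m1, ζ, m2, e⟩ := exists_flux_eq hφ hh (θ := θ)
  rw [e]
  have m1' := m1.1
  have m1'' := m1.2
  have m2' := m2.1
  have m2'' := m2.2
  have := H (θ, θ) (by constructor <;> constructor <;> simp only <;> linarith) (ξ, ζ)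
    (by constructor <;> constructor <;> simp only <;> linarith) (by
      rw [Prod.dist_eq, Real.dist_eq, Real.dist_eq]
      refine (max_le ?_ ?_).trans_lt hhδ <;> (rw [abs_le]; constructor <;> simp only <;> linarith))
  rw [Real.dist_eq] at this
  exact this.le

theorem sum_mul_diff_nonpos (e p a : ℕ → ℝ) (m : ℕ) (e0 : e 0 = 0) (em : e m = 0)
    (ha : ∀ k, k < m → 0 ≤ a k) (hp : ∀ k, k < m → p k = a k * (e (k + 1) - e k)) :
    ∑ k ∈ Finset.range m, e (k + 1) * (p (k + 1) - p k) ≤ 0 := by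
  have key : ∀ r : ℕ, ∑ k ∈ Finset.range r, e (k + 1) * (p (k + 1) - p k) =
      e r * p r - e 0 * p 0 - ∑ k ∈ Finset.range r, p k * (e (k + 1) - e k) := by
    intro r
    induction r with
    | zero => simp
    | succ r ih => rw [Finset.sum_range_succ, Finset.sum_range_succ, ih]; ring
  rw [key, e0, em]
  have : 0 ≤ ∑ k ∈ Finset.range m, p k * (e (k + 1) - e k) := by
    refine Finset.sum_nonneg fun k hk => ?_
    have hk := Finset.mem_range.1 hk
    rw [hp k hk, mul_assoc]
    exact mul_nonneg (ha k hk) (mul_self_nonneg _)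
  linarith

theorem pow_four_le_of_increments {e : ℕ → ℝ} {C : ℝ} {m : ℕ} (hm : 0 < m) (hC : 0 ≤ C)
    (e0 : e 0 = 0) (hinc : ∀ k, k < m → |e (k + 1) - e k| ≤ C / m) :
    ∀ k ≤ m, e k ^ 4 ≤ 4 * C ^ 2 * ((1 / m) * ∑ k ∈ Finset.range m, e (k + 1) ^ 2) := by
  have hm' : (0 : ℝ) < m := by exact_mod_cast hm
  have key : ∀ k ≤ m, e k ^ 2 ≤ 2 * C / m * ∑ i ∈ Finset.range k, |e (i + 1)| := by
    intro k
    induction k with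
    | zero => intro _; simp [e0]
    | succ k ih =>
      intro hk
      have h1 := ih (by omega)
      have h2 : e (k + 1) * (e (k + 1) - e k) ≤ |e (k + 1)| * (C / m) :=
        (le_abs_self _).trans (by
          rw [abs_mul]; exact mul_le_mul_of_nonneg_left (hinc k (by omega)) (abs_nonneg _))
      rw [Finset.sum_range_succ, mul_add]
      have h3 := sq_nonneg (e (k + 1) - e k)
      have h4 : 2 * C / m * |e (k + 1)| = 2 * (|e (k + 1)| * (C / m)) := by ring
      linarith
  intro k hk
  have h1 : e k ^ 2 ≤ 2 * C / m * ∑ i ∈ Finset.range m, |e (i + 1)| :=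
    (key k hk).trans (mul_le_mul_of_nonneg_left (Finset.sum_le_sum_of_subset_of_nonneg
      (Finset.range_mono hk) fun _ _ _ => abs_nonneg _) (by positivity))
  have h2 := sq_sum_le_card_mul_sum_sq (s := Finset.range m) (f := fun i => |e (i + 1)|)
  simp only [sq_abs, Finset.card_range] at h2
  have h3 := pow_le_pow_left₀ (sq_nonneg (e k)) h1 2
  calc e k ^ 4 = (e k ^ 2) ^ 2 := by ring
    _ ≤ _ := h3
    _ = (2 * C / m) ^ 2 * (∑ i ∈ Finset.range m, |e (i + 1)|) ^ 2 := by ring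
    _ ≤ (2 * C / m) ^ 2 * (m * ∑ i ∈ Finset.range m, e (i + 1) ^ 2) :=
      mul_le_mul_of_nonneg_left h2 (by positivity)
    _ = _ := by field_simp; ring

/-- The consistency error of the semi-discrete flow at the node `(k + 1) / m`. -/
noncomputable def nodeErr (φ : ℝ → ℝ) (m k : ℕ) : ℝ :=
  1 / 2 * deriv φ ((k + 1 : ℕ) / m) * deriv (deriv φ) ((k + 1 : ℕ) / m) -
    (m : ℝ) ^ 3 / 4 * ((φ ((k + 1 + 1 : ℕ) / m) - φ ((k + 1 : ℕ) / m)) ^ 2 -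
      (φ ((k + 1 : ℕ) / m) - φ (k / m)) ^ 2)

/-- The average of the consistency errors over the interior nodes. -/
noncomputable def meanErr (φ : ℝ → ℝ) (m : ℕ) : ℝ :=
  1 / m * ∑ k ∈ Finset.range (m - 1), |nodeErr φ m k|

theorem abs_le_of_increments {e : ℕ → ℝ} {C : ℝ} {m : ℕ} (hm : 0 < m) (hC : 0 ≤ C)
    (e0 : e 0 = 0) (hinc : ∀ k, k < m → |e (k + 1) - e k| ≤ C / m) : ∀ k ≤ m, |e k| ≤ C := by
  have hm' : (0 : ℝ) < m := by exact_mod_cast hm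
  have key : ∀ k ≤ m, |e k| ≤ k * (C / m) := by
    intro k
    induction k with
    | zero => simp [e0]
    | succ k ih =>
      intro hk
      have h1 := ih (by omega)
      have h2 := hinc k (by omega)
      have h3 := abs_add_le (e (k + 1) - e k) (e k)
      rw [sub_add_cancel] at h3
      push_cast
      linarith
  intro k hk
  refine (key k hk).trans ?_
  have : (k : ℝ) ≤ m := by exact_mod_cast hk
  calc (k : ℝ) * (C / m) ≤ m * (C / m) := mul_le_mul_of_nonneg_right this (by positivity)
    _ = C := by field_simp

namespace GlobalSol

variable {c C K : ℝ} {X : ℝ → ℝ → ℝ}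

theorem pow_four_sub_le (h : GlobalSol c C K X) {T : ℝ} (hT : 0 ≤ T) {m : ℕ} (hm : 0 < m)
    {η : ℝ → ZMod (2 * m) → ℝ} (hη : IsScheme m (c / 2) (C / 2) T η)
    (hη0 : η 0 = initData (X 0) m) (hodd : ∀ t ∈ Icc 0 T, ∀ j, η t (-j) = -η t j)
    (hint : MeasureTheory.IntegrableOn (fun τ => meanErr (X τ) m) (Icc 0 T)) {k : ℕ}
    (hk : k ≤ m) :
    (X T (k / m) - (k / m + η T k)) ^ 4 ≤ 8 * C ^ 3 * ∫ τ in 0..T, meanErr (X τ) m := by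
  have hm' : (0 : ℝ) < m := by exact_mod_cast hm
  have hC := h.C_pos
  have hc := h.c_pos
  set y : ℝ → ℕ → ℝ := fun τ k => k / m + η τ k with hy
  set e : ℝ → ℕ → ℝ := fun τ k => X τ (k / m) - y τ k with he
  have hη_zero : ∀ τ ∈ Icc 0 T, η τ 0 = 0 := fun τ hτ => by
    have := hodd τ hτ 0
    rw [neg_zero] at this
    linarith
  have hη_m : ∀ τ ∈ Icc 0 T, η τ m = 0 := fun τ hτ => by
    have h1 := hodd τ hτ m
    have h2 : (-(m : ZMod (2 * m))) = m := by
      rw [neg_eq_iff_add_eq_zero]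
      have := ZMod.natCast_self (2 * m)
      push_cast at this
      linear_combination this
    rw [h2] at h1
    linarith
  have e_zero : ∀ τ ∈ Icc 0 T, e τ 0 = 0 := fun τ hτ => by
    simp [he, hy, hη_zero τ hτ, (h.bdry τ hτ.1).1]
  have e_m : ∀ τ ∈ Icc 0 T, e τ m = 0 := fun τ hτ => by
    simp [he, hy, hη_m τ hτ, div_self hm'.ne', (h.bdry τ hτ.1).2]
  have hslope : ∀ τ (k : ℕ), y τ (k + 1) - y τ k = 2 / m * slope m (η τ) k := fun τ k => by
    simp only [hy, Scheme.slope]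
    push_cast
    field_simp
    ring
  have hyb : ∀ τ ∈ Icc 0 T, ∀ k, c / m ≤ y τ (k + 1) - y τ k ∧ y τ (k + 1) - y τ k ≤ C / m := by
    intro τ hτ k
    rw [hslope]
    have h1 := hη.lower τ hτ k
    have h2 := hη.upper τ hτ k
    constructor
    · calc c / m = 2 / m * (c / 2) := by ring
        _ ≤ _ := mul_le_mul_of_nonneg_left h1 (by positivity)
    · calc _ ≤ 2 / m * (C / 2) := mul_le_mul_of_nonneg_left h2 (by positivity)
        _ = C / m := by ring
  have hXb : ∀ τ ∈ Icc 0 T, ∀ k < m, c / m ≤ X τ ((k + 1 : ℕ) / m) - X τ (k / m) ∧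
      X τ ((k + 1 : ℕ) / m) - X τ (k / m) ≤ C / m := by
    intro τ hτ k hk
    have hk' : ((k + 1 : ℕ) : ℝ) ≤ m := by exact_mod_cast hk
    have := h.slope_bounds hτ.1 (x := (k : ℝ) / m) (y := (k + 1 : ℕ) / m) (by positivity)
      (by gcongr; simp) ((div_le_one hm').2 hk')
    have e1 : ((k + 1 : ℕ) : ℝ) / m - k / m = 1 / m := by push_cast; ring
    rw [e1] at this
    simpa only [mul_one_div] using this
  have hinc : ∀ τ ∈ Icc 0 T, ∀ k < m, |e τ (k + 1) - e τ k| ≤ C / m := by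
    intro τ hτ k hk
    have h1 := hyb τ hτ k
    have h2 := hXb τ hτ k hk
    have h3 : 0 < c / m := by positivity
    have h4 : e τ (k + 1) - e τ k =
      (X τ ((k + 1 : ℕ) / m) - X τ (k / m)) - (y τ (k + 1) - y τ k) := by
      simp only [he]; ring
    rw [h4, abs_le]
    constructor <;> linarith [h1.1, h1.2, h2.1, h2.2]
  have hnode : ∀ k ≤ m, (k : ℝ) / m ∈ Icc (0 : ℝ) 1 := fun k hk =>
    ⟨by positivity, (div_le_one hm').2 (by exact_mod_cast hk)⟩
  set g : ℝ → ℝ := fun τ => 1 / m * ∑ k ∈ Finset.range m, e τ (k + 1) ^ 2 with hg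
  set g' : ℝ → ℝ := fun τ => 1 / m * ∑ k ∈ Finset.range m, 2 * e τ (k + 1) *
    (1 / 2 * deriv (X τ) ((k + 1 : ℕ) / m) * deriv (deriv (X τ)) ((k + 1 : ℕ) / m) -
      vel m (η τ) ((k + 1 : ℕ) : ZMod (2 * m))) with hg'
  have hgd : ∀ τ ∈ Icc 0 T, HasDerivWithinAt g (g' τ) (Icc 0 T) τ := by
    intro τ hτ
    refine HasDerivWithinAt.const_mul _ (HasDerivWithinAt.fun_sum fun k hk => ?_)
    have h1 := (h.pde τ hτ.1 _ (hnode (k + 1) (Finset.mem_range.1 hk))).hasDerivWithinAt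
      (s := Icc 0 T)
    have h2 := (hη.ode τ hτ ((k + 1 : ℕ) : ZMod (2 * m))).const_add (((k + 1 : ℕ) : ℝ) / m)
    have h3 := (h1.sub h2).pow 2
    refine h3.congr_deriv ?_
    simp [he, hy]
  have hg'le : ∀ τ ∈ Icc 0 T, g' τ ≤ 2 * C * meanErr (X τ) m := by
    intro τ hτ
    set p : ℕ → ℝ := fun k => (m : ℝ) ^ 3 / 4 *
      ((X τ ((k + 1 : ℕ) / m) - X τ (k / m)) ^ 2 - (y τ (k + 1) - y τ k) ^ 2) with hp
    have h1 := sum_mul_diff_nonpos (e τ) p (fun k => (m : ℝ) ^ 3 / 4 *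
      ((X τ ((k + 1 : ℕ) / m) - X τ (k / m)) + (y τ (k + 1) - y τ k))) m (e_zero τ hτ) (e_m τ hτ)
      (fun k hk => by
        have h1 := hyb τ hτ k
        have h2 := hXb τ hτ k hk
        have h3 : 0 < c / m := by positivity
        exact mul_nonneg (by positivity) (by linarith [h1.1, h2.1]))
      (fun k hk => by simp only [hp, he]; ring)
    have h2 : ∀ k : ℕ, 2 * e τ (k + 1) *
        (1 / 2 * deriv (X τ) ((k + 1 : ℕ) / m) * deriv (deriv (X τ)) ((k + 1 : ℕ) / m) -
          vel m (η τ) ((k + 1 : ℕ) : ZMod (2 * m))) =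
        2 * (e τ (k + 1) * nodeErr (X τ) m k) + 2 * (e τ (k + 1) * (p (k + 1) - p k)) := by
      intro k
      have h3 : vel m (η τ) ((k + 1 : ℕ) : ZMod (2 * m)) = (m : ℝ) ^ 3 / 4 *
          ((y τ (k + 1 + 1) - y τ (k + 1)) ^ 2 - (y τ (k + 1) - y τ k) ^ 2) := by
        rw [hslope, hslope, vel]
        push_cast
        rw [add_sub_cancel_right]
        field_simp
        ring
      rw [h3, nodeErr]
      simp only [hp]
      ring
    have h3 : ∑ k ∈ Finset.range m, e τ (k + 1) * nodeErr (X τ) m k ≤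
        C * ∑ k ∈ Finset.range (m - 1), |nodeErr (X τ) m k| := by
      obtain ⟨n, rfl⟩ : ∃ n, m = n + 1 := ⟨m - 1, by omega⟩
      rw [Finset.sum_range_succ, e_m τ hτ, zero_mul, add_zero, Finset.mul_sum,
        Nat.add_sub_cancel]
      refine Finset.sum_le_sum fun k hk => (le_abs_self _).trans ?_
      rw [abs_mul]
      exact mul_le_mul_of_nonneg_right (abs_le_of_increments hm hC.le (e_zero τ hτ)
        (hinc τ hτ) (k + 1) (by have := Finset.mem_range.1 hk; omega)) (abs_nonneg _)
    simp only [hg', h2, meanErr]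
    rw [Finset.sum_add_distrib, ← Finset.mul_sum, ← Finset.mul_sum]
    calc _ ≤ 1 / (m : ℝ) * (2 * (C * ∑ k ∈ Finset.range (m - 1), |nodeErr (X τ) m k|) + 2 * 0) := by
          gcongr
      _ = _ := by ring
  have hg0 : g 0 = 0 := by
    have : ∀ k ∈ Finset.range m, e 0 (k + 1) ^ 2 = 0 := fun k hk => by
      have hk' := Finset.mem_range.1 hk
      simp only [he, hy, hη0]
      rw [initData_natCast (h.bdry 0 le_rfl).1 hm (by omega),
        reflExt_of_mem _ (hnode (k + 1) (by omega))]
      ring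
    simp only [hg, Finset.sum_eq_zero this, mul_zero]
  have hgT : g T ≤ 2 * C * ∫ τ in 0..T, meanErr (X τ) m := by
    have := intervalIntegral.sub_le_integral_of_hasDeriv_right_of_le hT
      (fun τ hτ => (hgd τ hτ).continuousWithinAt)
      (fun τ hτ => ((hgd τ ⟨hτ.1.le, hτ.2.le⟩).hasDerivAt (Icc_mem_nhds hτ.1 hτ.2)).hasDerivWithinAt)
      (φ := fun τ => 2 * C * meanErr (X τ) m) (hint.const_mul _)
      (fun τ hτ => hg'le τ ⟨hτ.1.le, hτ.2.le⟩)
    rw [hg0, sub_zero, intervalIntegral.integral_const_mul] at this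
    exact this
  have hTT : T ∈ Icc 0 T := ⟨hT, le_rfl⟩
  calc _ ≤ 4 * C ^ 2 * g T := pow_four_le_of_increments hm hC.le (e_zero T hTT) (hinc T hTT) k hk
    _ ≤ 4 * C ^ 2 * (2 * C * ∫ τ in 0..T, meanErr (X τ) m) :=
      mul_le_mul_of_nonneg_left hgT (by positivity)
    _ = _ := by ring

end GlobalSol

theorem nodeErr_eq (φ : ℝ → ℝ) {m : ℕ} (hm : 0 < m) (k : ℕ) :
    nodeErr φ m k = 1 / 2 * deriv φ ((k + 1 : ℕ) / m) * deriv (deriv φ) ((k + 1 : ℕ) / m) -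
      (1 / (4 * (1 / (m : ℝ)) ^ 3)) *
        ((φ ((k + 1 : ℕ) / m + 1 / m) - φ ((k + 1 : ℕ) / m)) ^ 2 -
          (φ ((k + 1 : ℕ) / m) - φ ((k + 1 : ℕ) / m - 1 / m)) ^ 2) := by
  have hm' : (0 : ℝ) < m := by exact_mod_cast hm
  have e1 : ((k + 1 : ℕ) : ℝ) / m + 1 / m = (k + 1 + 1 : ℕ) / m := by push_cast; ring
  have e2 : ((k + 1 : ℕ) : ℝ) / m - 1 / m = k / m := by push_cast; ring
  have e3 : 1 / (4 * (1 / (m : ℝ)) ^ 3) = (m : ℝ) ^ 3 / 4 := by field_simp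
  rw [nodeErr, e1, e2, e3]

theorem meanErr_nonneg (φ : ℝ → ℝ) (m : ℕ) : 0 ≤ meanErr φ m :=
  mul_nonneg (by positivity) (Finset.sum_nonneg fun _ _ => abs_nonneg _)

theorem meanErr_le {φ : ℝ → ℝ} {m : ℕ} {B : ℝ} (hB : 0 ≤ B)
    (h : ∀ k < m - 1, |nodeErr φ m k| ≤ B) : meanErr φ m ≤ B := by
  rcases Nat.eq_zero_or_pos m with rfl | hm
  · simpa [meanErr] using hB
  have hm' : (0 : ℝ) < m := by exact_mod_cast hm
  have h1 : ∑ k ∈ Finset.range (m - 1), |nodeErr φ m k| ≤ m * B := by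
    refine (Finset.sum_le_card_nsmul _ _ B fun k hk => h k (Finset.mem_range.1 hk)).trans ?_
    rw [Finset.card_range, nsmul_eq_mul]
    exact mul_le_mul_of_nonneg_right (by exact_mod_cast Nat.sub_le m 1) hB
  calc meanErr φ m ≤ 1 / m * (m * B) := mul_le_mul_of_nonneg_left h1 (by positivity)
    _ = B := by field_simp

theorem tendsto_meanErr {φ : ℝ → ℝ} (hφ : ContDiff ℝ 2 φ) :
    Tendsto (meanErr φ) atTop (𝓝 0) := by
  rw [Metric.tendsto_atTop]
  intro ε hε
  obtain ⟨δ, hδ, H⟩ := exists_flux_consistency hφ (half_pos hε)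
  obtain ⟨n, hn⟩ := exists_nat_gt (1 / δ)
  refine ⟨n + 1, fun m hm => ?_⟩
  have hm0 : 0 < m := by omega
  have hm' : (0 : ℝ) < m := by exact_mod_cast hm0
  rw [Real.dist_eq, sub_zero, abs_of_nonneg (meanErr_nonneg _ _)]
  refine (meanErr_le (half_pos hε).le fun k hk => ?_).trans_lt (half_lt_self hε)
  rw [nodeErr_eq φ hm0]
  refine H _ (by positivity) ?_ _ ?_ ?_
  · have : (n : ℝ) ≤ m := by exact_mod_cast (by omega : n ≤ m)
    rw [div_lt_comm₀ hm' hδ]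
    linarith
  · rw [← sub_div]; push_cast; rw [add_sub_cancel_right]; positivity
  · rw [← add_div, div_le_one hm']; exact_mod_cast (by omega : k + 1 + 1 ≤ m)

namespace GlobalSol

variable {c C K : ℝ} {X : ℝ → ℝ → ℝ}

theorem abs_nodeErr_le (h : GlobalSol c C K X) {t : ℝ} (ht : 0 ≤ t) {m k : ℕ} (hk : k < m - 1) :
    |nodeErr (X t) m k| ≤ C * K / 2 + C * (C * K / c) / 2 := by
  have hm0 : 0 < m := by omega
  have hm' : (0 : ℝ) < m := by exact_mod_cast hm0
  have hc := h.c_pos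
  have hC := h.C_pos
  have hK := h.K_pos
  rw [nodeErr_eq _ hm0]
  have a1 : ((k + 1 : ℕ) : ℝ) / m - 1 / m = k / m := by push_cast; ring
  have a2 : ((k + 1 : ℕ) : ℝ) / m + 1 / m ≤ 1 := by
    rw [← add_div, div_le_one hm']; exact_mod_cast (by omega : k + 1 + 1 ≤ m)
  have a3 : (0 : ℝ) ≤ k / m := by positivity
  have a4 : (0 : ℝ) < 1 / m := by positivity
  obtain ⟨ξ, h1, ζ, h2, e⟩ := exists_flux_eq (h.smooth t ht) (θ := (k + 1 : ℕ) / m) a4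
  rw [e]
  rw [a1] at h1 h2
  have b1 := h.deriv_bounds ht (θ := ξ) ⟨a3.trans_lt h1.1, h1.2.le.trans a2⟩
  have b2 := h.abs_curv_le ht (θ := ζ) ⟨a3.trans_lt h2.1, h2.2.le.trans a2⟩
  have b3 : |1 / 2 * deriv (X t) ξ * deriv (deriv (X t)) ζ| ≤ C * (C * K / c) / 2 := by
    rw [abs_mul, abs_mul, abs_of_pos (by linarith : 0 < deriv (X t) ξ), abs_of_pos (by norm_num)]
    have := mul_le_mul b1.2 b2 (abs_nonneg _) hC.le
    linarith
  exact (abs_sub _ _).trans (add_le_add (h.abs_flux_le ht ⟨by positivity, by linarith⟩) b3)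

theorem aestronglyMeasurable_meanErr (h : GlobalSol c C K X) (T : ℝ) (m : ℕ) :
    MeasureTheory.AEStronglyMeasurable (fun τ => meanErr (X τ) m)
      (MeasureTheory.volume.restrict (Icc 0 T)) := by
  rcases Nat.eq_zero_or_pos m with rfl | hm
  · simpa [meanErr] using MeasureTheory.aestronglyMeasurable_const
  have hm' : (0 : ℝ) < m := by exact_mod_cast hm
  have hX : ∀ k ≤ m, MeasureTheory.AEStronglyMeasurable (fun τ => X τ (k / m))
      (MeasureTheory.volume.restrict (Icc 0 T)) := fun k hk => by
    refine ContinuousOn.aestronglyMeasurable (fun τ hτ => ?_) measurableSet_Icc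
    exact (h.pde τ hτ.1 _ ⟨by positivity,
      (div_le_one hm').2 (by exact_mod_cast hk)⟩).continuousAt.continuousWithinAt
  have hD : ∀ k ≤ m, MeasureTheory.AEStronglyMeasurable
      (fun τ => 1 / 2 * deriv (X τ) (k / m) * deriv (deriv (X τ)) (k / m))
      (MeasureTheory.volume.restrict (Icc 0 T)) := fun k hk => by
    refine (measurable_deriv fun τ => X τ (k / m)).aestronglyMeasurable.congr ?_
    filter_upwards [MeasureTheory.ae_restrict_mem measurableSet_Icc] with τ hτ
    exact (h.pde τ hτ.1 _ ⟨by positivity, (div_le_one hm').2 (by exact_mod_cast hk)⟩).deriv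
  refine MeasureTheory.AEStronglyMeasurable.const_mul ?_ _
  refine Finset.aestronglyMeasurable_fun_sum _ fun k hk => ?_
  have hk := Finset.mem_range.1 hk
  exact ((hD (k + 1) (by omega)).sub (((((hX (k + 1 + 1) (by omega)).sub
    (hX (k + 1) (by omega))).pow 2).sub (((hX (k + 1) (by omega)).sub
    (hX k (by omega))).pow 2)).const_mul _)).norm

theorem integrableOn_meanErr (h : GlobalSol c C K X) (T : ℝ) (m : ℕ) :
    MeasureTheory.IntegrableOn (fun τ => meanErr (X τ) m) (Icc 0 T) := by
  have hc := h.c_pos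
  have hC := h.C_pos
  have hK := h.K_pos
  refine MeasureTheory.Integrable.of_bound (h.aestronglyMeasurable_meanErr T m)
    (C * K / 2 + C * (C * K / c) / 2) ?_
  filter_upwards [MeasureTheory.ae_restrict_mem measurableSet_Icc] with τ hτ
  rw [Real.norm_eq_abs, abs_of_nonneg (meanErr_nonneg _ _)]
  exact meanErr_le (by positivity) fun k hk => h.abs_nodeErr_le hτ.1 hk

theorem tendsto_integral_meanErr (h : GlobalSol c C K X) {T : ℝ} (hT : 0 ≤ T) :
    Tendsto (fun m => ∫ τ in 0..T, meanErr (X τ) m) atTop (𝓝 0) := by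
  have hc := h.c_pos
  have hC := h.C_pos
  have hK := h.K_pos
  have key := intervalIntegral.tendsto_integral_filter_of_dominated_convergence
    (μ := MeasureTheory.volume) (a := 0) (b := T) (l := atTop)
    (F := fun m τ => meanErr (X τ) m) (f := fun _ => 0)
    (fun _ => C * K / 2 + C * (C * K / c) / 2) (.of_forall fun m => ?_) (.of_forall fun m => ?_)
    (by simp) ?_
  · simpa using key
  · exact (h.aestronglyMeasurable_meanErr T m).mono_measure
      (MeasureTheory.Measure.restrict_mono (by rw [uIoc_of_le hT]; exact Ioc_subset_Icc_self) le_rfl)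
  · refine .of_forall fun τ hτ => ?_
    rw [uIoc_of_le hT] at hτ
    rw [Real.norm_eq_abs, abs_of_nonneg (meanErr_nonneg _ _)]
    exact meanErr_le (by positivity) fun k hk => h.abs_nodeErr_le hτ.1.le hk
  · refine .of_forall fun τ hτ => ?_
    rw [uIoc_of_le hT] at hτ
    exact tendsto_meanErr (h.smooth τ hτ.1.le)

end GlobalSol

namespace GlobalSol

variable {c C K : ℝ} {X : ℝ → ℝ → ℝ}

theorem pow_four_reflExt_sub_le (h : GlobalSol c C K X) {T : ℝ} (hT : 0 ≤ T) {m : ℕ}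
    (hm : 0 < m) {η : ℝ → ZMod (2 * m) → ℝ} (hη : IsScheme m (c / 2) (C / 2) T η)
    (hη0 : η 0 = initData (X 0) m) (hodd : ∀ t ∈ Icc 0 T, ∀ j, η t (-j) = -η t j) {i : ℤ}
    (hi : -m ≤ i) (hi' : i ≤ 2 * m) :
    (reflExt (X T) (i / m) - (i / m + η T i)) ^ 4 ≤ 8 * C ^ 3 * ∫ τ in 0..T, meanErr (X τ) m := by
  have hm' : (0 : ℝ) < m := by exact_mod_cast hm
  have key := fun {k : ℕ} (hk : k ≤ m) =>
    h.pow_four_sub_le hT hm hη hη0 hodd (h.integrableOn_meanErr T m) hk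
  have hTT : T ∈ Icc 0 T := ⟨hT, le_rfl⟩
  obtain ⟨b0, b1⟩ := h.bdry T hT
  rcases le_total i 0 with h0 | h0
  · obtain ⟨k, rfl⟩ : ∃ k : ℕ, i = -k := ⟨i.natAbs, by omega⟩
    have h1 := hodd T hTT k
    rw [reflExt_of_nonpos b0 (by push_cast; rw [neg_div]; simp only [neg_nonpos]; positivity)]
    push_cast
    rw [h1]
    refine (key (k := k) (by omega)).trans_eq' ?_
    rw [neg_div, neg_neg]; ring
  rcases le_total i m with h1 | h1
  · lift i to ℕ using h0
    rw [reflExt_of_mem _ ⟨by positivity, (div_le_one hm').2 (by exact_mod_cast h1)⟩]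
    push_cast
    exact key (by omega)
  · obtain ⟨k, rfl⟩ : ∃ k : ℕ, i = 2 * m - k := ⟨(2 * m - i).natAbs, by omega⟩
    have h2 := hodd T hTT k
    have h3 : ((2 * m - k : ℤ) : ZMod (2 * m)) = -k := by
      have := ZMod.natCast_self (2 * m)
      push_cast at this ⊢
      linear_combination this
    have h4 : (2 : ℝ) - ((2 * m - k : ℤ) : ℝ) / m = k / m := by push_cast; field_simp; ring
    have h5 : (1 : ℝ) ≤ ((2 * m - k : ℤ) : ℝ) / m := by
      rw [le_div_iff₀ hm', one_mul]; exact_mod_cast h1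
    rw [reflExt_of_one_le b1 h5, h4, h3, h2]
    refine (key (k := k) (by omega)).trans_eq' ?_
    have h6 : ((2 * m - k : ℤ) : ℝ) / m = 2 - k / m := by linarith
    rw [h6]; ring

end GlobalSol

/-- Uniform bounds for the third and fourth differences of the reflected solution. -/
theorem exists_reflExt_diff_bound (c C K : ℝ) (hc : 0 < c) (hcC : c ≤ C) (hK0 : 0 ≤ K) :
    ∃ A : ℝ, ∀ X : ℝ → ℝ → ℝ, GlobalSol c C K X → ContDiff ℝ 4 (X 0) →
      (∀ k : ℕ, k ≤ 4 → ∀ θ ∈ Icc (0 : ℝ) 1, |iteratedDeriv k (X 0) θ| ≤ K) →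
      ∀ t, 0 ≤ t → ∀ q : ℕ, 0 < q → ∀ (E : ℤ → ℝ), (∀ i : ℤ, E i = reflExt (X t) (i / q)) →
      ∀ (k : ℤ) (l : ℕ), -q ≤ k →
        (k + 3 * l ≤ 2 * q →
          |E (k + l + l + l) - 3 * E (k + l + l) + 3 * E (k + l) - E k| ≤ A * (l / q) ^ 3) ∧
        (k + 4 * l ≤ 2 * q →
          |E (k + l + l + l + l) - 4 * E (k + l + l + l) + 6 * E (k + l + l) - 4 * E (k + l) + E k|
            ≤ A * (l / q) ^ 4) := by
  obtain ⟨A, hA⟩ := exists_scheme_family c C K hc hcC hK0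
  refine ⟨A, fun X h hX hXK t ht q hq E hE k l hk => ?_⟩
  have hC : 0 < C := hc.trans_le hcC
  have hs := h.isSol le_rfl 1
  have h01 : (0 : ℝ) ∈ Icc (0 : ℝ) 1 := by simp
  have h11 : (1 : ℝ) ∈ Icc (0 : ℝ) 1 := by simp
  have hi2 : iteratedDeriv 2 (X 0) = deriv (deriv (X 0)) := by
    rw [iteratedDeriv_succ, iteratedDeriv_one]
  have g0 : iteratedDeriv 2 (X 0) 0 = 0 := by
    have := hs.flux_eq_zero_left zero_lt_one h01
    have h2 := (h.slope_zero 0 h01).1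
    rw [hi2]
    simpa [(hc.trans_le h2).ne'] using this
  have g1 : iteratedDeriv 2 (X 0) 1 = 0 := by
    have := hs.flux_eq_zero_right zero_lt_one h01
    have h2 := (h.slope_zero 1 h11).1
    rw [hi2]
    simpa [(hc.trans_le h2).ne'] using this
  have hfam := hA (X 0) hX (h.bdry 0 le_rfl).1 (h.bdry 0 le_rfl).2 g0 g1 hXK
    (fun x y hx hxy hy => h.slope_bounds le_rfl hx hxy hy)
  have hq' : (0 : ℝ) < q := by exact_mod_cast hq
  have approx : ∀ ε > 0, ∃ u : ℤ → ℝ,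
      (∀ i : ℤ, -q ≤ i → i ≤ 2 * q → |E i - u i| ≤ ε) ∧
      (∀ k : ℤ, |u (k + l + l + l) - 3 * u (k + l + l) + 3 * u (k + l) - u k| ≤ A * (l / q) ^ 3) ∧
      (∀ k : ℤ, |u (k + l + l + l + l) - 4 * u (k + l + l + l) + 6 * u (k + l + l) -
        4 * u (k + l) + u k| ≤ A * (l / q) ^ 4) := by
    intro ε hε
    have h1 := (h.tendsto_integral_meanErr ht).const_mul (8 * C ^ 3)
    rw [mul_zero] at h1
    obtain ⟨n, hn⟩ := eventually_atTop.1 (h1.eventually_lt_const (by positivity : 0 < ε ^ 4))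
    set s := n + 4
    have hqs : s ≤ q * s := Nat.le_mul_of_pos_left s hq
    have hm4 : 4 ≤ q * s := by omega
    have hns : n ≤ q * s := by omega
    have hs' : (0 : ℝ) < s := by positivity
    have hm' : (0 : ℝ) < (q * s : ℕ) := by push_cast; positivity
    obtain ⟨η, hη, hη0, hodd, hd⟩ := hfam (q * s) hm4 t ht
    have hdt := hd t ⟨ht, le_rfl⟩
    have b3 := fun j => (le_div_iff₀' (pow_pos hm' 3)).2
      ((abs_mul _ _).symm.trans_le (((hdt j).1))|>.trans_eq' (by rw [abs_of_pos (pow_pos hm' 3)]))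
    have b4 := fun j => (le_div_iff₀' (pow_pos hm' 4)).2
      ((abs_mul _ _).symm.trans_le (((hdt j).2))|>.trans_eq' (by rw [abs_of_pos (pow_pos hm' 4)]))
    refine ⟨fun i => i / q + η t ((i * s : ℤ) : ZMod (2 * (q * s))), fun i hi hi' => ?_,
      fun k => ?_, fun k => ?_⟩
    · have h2 := h.pow_four_reflExt_sub_le ht (by omega) hη hη0 hodd (i := i * s)
        (by push_cast; nlinarith) (by push_cast; nlinarith)
      have h3 := h2.trans_lt (hn _ hns)
      have e : ((i * s : ℤ) : ℝ) / (q * s : ℕ) = i / q := by push_cast; field_simp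
      rw [e, ← hE] at h3
      rw [← Even.pow_abs (by decide)] at h3
      exact (lt_of_pow_lt_pow_left₀ 4 hε.le h3).le
    · have := abs_fwdDiff_three_le b3 (l * s) ((k * s : ℤ) : ZMod (2 * (q * s)))
      refine (congrArg abs ?_).trans_le (this.trans_eq ?_)
      · push_cast
        simp only [add_mul]
        ring
      · push_cast; field_simp
    · have := abs_fwdDiff_four_le b4 (l * s) ((k * s : ℤ) : ZMod (2 * (q * s)))
      refine (congrArg abs ?_).trans_le (this.trans_eq ?_)
      · push_cast
        simp only [add_mul]
        ring
      · push_cast; field_simp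
  constructor
  · intro hk'
    refine le_of_forall_pos_le_add fun ε hε => ?_
    obtain ⟨u, h1, h2, -⟩ := approx (ε / 16) (by positivity)
    have a0 := abs_le.1 (h1 k (by omega) (by omega))
    have a1 := abs_le.1 (h1 (k + l) (by omega) (by omega))
    have a2 := abs_le.1 (h1 (k + l + l) (by omega) (by omega))
    have a3 := abs_le.1 (h1 (k + l + l + l) (by omega) (by omega))
    have a4 := abs_le.1 (h2 k)
    rw [abs_le]
    constructor <;> linarith [a0.1, a0.2, a1.1, a1.2, a2.1, a2.2, a3.1, a3.2, a4.1, a4.2]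
  · intro hk'
    refine le_of_forall_pos_le_add fun ε hε => ?_
    obtain ⟨u, h1, -, h2⟩ := approx (ε / 16) (by positivity)
    have a0 := abs_le.1 (h1 k (by omega) (by omega))
    have a1 := abs_le.1 (h1 (k + l) (by omega) (by omega))
    have a2 := abs_le.1 (h1 (k + l + l) (by omega) (by omega))
    have a3 := abs_le.1 (h1 (k + l + l + l) (by omega) (by omega))
    have a5 := abs_le.1 (h1 (k + l + l + l + l) (by omega) (by omega))
    have a4 := abs_le.1 (h2 k)
    rw [abs_le]
    constructor <;> linarith [a0.1, a0.2, a1.1, a1.2, a2.1, a2.2, a3.1, a3.2, a4.1, a4.2, a5.1, a5.2]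

theorem abs_sub_le_of_dyadic {s : ℕ → ℝ} {a B : ℝ} (hB : 0 ≤ B)
    (h : ∀ p, |s p - s (p + 1)| ≤ B / 2 * (1 / 4) ^ p) (hs : Tendsto s atTop (𝓝 a)) :
    |s 0 - a| ≤ B := by
  have := dist_le_of_le_geometric_of_tendsto₀ (1 / 4) (B / 2) (by norm_num)
    (fun p => by rw [Real.dist_eq]; exact h p) hs
  rw [Real.dist_eq] at this
  norm_num at this
  linarith

theorem tendsto_of_mem_dyadic {g : ℝ → ℝ} (hg : Continuous g) {s : ℕ → ℝ} {θ h : ℝ}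
    (hs : ∀ p : ℕ, ∃ ξ ∈ Ioo (θ - h / 2 ^ (p + 1)) (θ + h / 2 ^ (p + 1)), s (p + 1) = g ξ) :
    Tendsto s atTop (𝓝 (g θ)) := by
  choose ξ hξ hsξ using hs
  have h0 : Tendsto (fun p : ℕ => h / 2 ^ (p + 1)) atTop (𝓝 0) := by
    have := (tendsto_pow_atTop_nhds_zero_of_lt_one (r := (1 / 2 : ℝ)) (by norm_num)
      (by norm_num)).comp (tendsto_add_atTop_nat 1)
    have := this.const_mul h
    rw [mul_zero] at this
    refine this.congr fun p => ?_
    simp only [Function.comp_apply, one_div, inv_pow]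
    rfl
  have h1 : Tendsto ξ atTop (𝓝 θ) := by
    refine tendsto_of_tendsto_of_tendsto_of_le_of_le (g := fun p : ℕ => θ - h / 2 ^ (p + 1))
      (h := fun p : ℕ => θ + h / 2 ^ (p + 1)) ?_ ?_ (fun p => (hξ p).1.le) (fun p => (hξ p).2.le)
    · simpa using h0.const_sub θ
    · simpa using h0.const_add θ
  rw [← tendsto_add_atTop_iff_nat 1]
  exact ((hg.tendsto θ).comp h1).congr fun p => (hsξ p).symm

/-- Central difference quotients are second-order accurate when the third and fourth differences
have the expected size on all dyadic refinements. -/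
theorem abs_deriv_sub_quotient_le {φ G : ℝ → ℝ} (hφ : ContDiff ℝ 2 φ)
    (hG : ∀ x ∈ Icc (0 : ℝ) 1, G x = φ x) {θ h A : ℝ} (hA : 0 ≤ A) (hh : 0 < h)
    (h0 : 0 ≤ θ - h / 2) (h1 : θ + h / 2 ≤ 1)
    (hd : ∀ (p : ℕ) (r : ℝ), r = h / 2 ^ (p + 1) →
      |G (θ + 2 * r) - 2 * G (θ + r) + 2 * G (θ - r) - G (θ - 2 * r)| ≤ 2 * A * r ^ 3 ∧
      |G (θ + 2 * r) - 4 * G (θ + r) + 6 * G θ - 4 * G (θ - r) + G (θ - 2 * r)| ≤ A * r ^ 4) :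
    |(G (θ + h) - G (θ - h)) / h - 2 * deriv φ θ| ≤ A * h ^ 2 ∧
      |(G (θ + h) - 2 * G θ + G (θ - h)) / h ^ 2 - deriv (deriv φ) θ| ≤ A * h ^ 2 := by
  have hφ' : ContDiff ℝ 1 (deriv φ) := ((contDiff_succ_iff_deriv (n := 1)).1 hφ).2.2
  have hφ'' : Continuous (deriv (deriv φ)) := hφ'.continuous_deriv le_rfl
  have hr : ∀ p : ℕ, 0 < h / 2 ^ (p + 1) ∧ h / 2 ^ p = 2 * (h / 2 ^ (p + 1)) ∧
      h / 2 ^ (p + 1) ≤ h / 2 ∧ (h / 2 ^ (p + 1)) ^ 2 = h ^ 2 / 4 * (1 / 4) ^ p := by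
    intro p
    refine ⟨by positivity, by rw [pow_succ]; field_simp, ?_, ?_⟩
    · have : (2 : ℝ) ≤ 2 ^ (p + 1) := by
        rw [pow_succ]; linarith [one_le_pow₀ (n := p) (by norm_num : (1 : ℝ) ≤ 2)]
      gcongr
    · have : (1 / 4 : ℝ) ^ p = (1 / 2 ^ p) ^ 2 := by
        rw [← one_div_pow, ← pow_mul, mul_comm, pow_mul]
        norm_num
      rw [this]; field_simp; ring
  have hGφ : ∀ p : ℕ, G (θ + h / 2 ^ (p + 1)) = φ (θ + h / 2 ^ (p + 1)) ∧
      G (θ - h / 2 ^ (p + 1)) = φ (θ - h / 2 ^ (p + 1)) ∧ G θ = φ θ := by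
    intro p
    obtain ⟨a1, -, a2, -⟩ := hr p
    exact ⟨hG _ ⟨by linarith, by linarith⟩, hG _ ⟨by linarith, by linarith⟩,
      hG _ ⟨by linarith, by linarith⟩⟩
  constructor
  · have key := abs_sub_le_of_dyadic
      (s := fun p => (G (θ + h / 2 ^ p) - G (θ - h / 2 ^ p)) / (h / 2 ^ p))
      (a := 2 * deriv φ θ) (B := A * h ^ 2) (by positivity) ?_ ?_
    · simpa using key
    · intro p
      obtain ⟨a1, a2, a3, a4⟩ := hr p
      have := (hd p _ rfl).1
      rw [a2]
      set r := h / 2 ^ (p + 1)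
      have e : (G (θ + 2 * r) - G (θ - 2 * r)) / (2 * r) - (G (θ + r) - G (θ - r)) / r =
          (G (θ + 2 * r) - 2 * G (θ + r) + 2 * G (θ - r) - G (θ - 2 * r)) / (2 * r) := by
        field_simp; ring
      rw [e, abs_div, abs_of_pos (by positivity : 0 < 2 * r), div_le_iff₀ (by positivity)]
      have hp : 0 ≤ A * r ^ 2 := by positivity
      calc _ ≤ _ := this
        _ = A * r ^ 2 * (2 * r) := by ring
        _ ≤ 2 * (A * r ^ 2) * (2 * r) := by nlinarith
        _ = _ := by rw [a4]; ring
    · refine tendsto_of_mem_dyadic (g := fun x => 2 * deriv φ x) (h := h)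
        (by have := hφ'.continuous; fun_prop) fun p => ?_
      obtain ⟨a1, -, -, -⟩ := hr p
      obtain ⟨e1, e2, -⟩ := hGφ p
      obtain ⟨ξ, hξ, e⟩ := exists_deriv_eq_central_diff hφ (θ := θ) a1
      refine ⟨ξ, hξ, ?_⟩
      simp only [e1, e2, e]
      field_simp
  · have key := abs_sub_le_of_dyadic
      (s := fun p => (G (θ + h / 2 ^ p) - 2 * G θ + G (θ - h / 2 ^ p)) / (h / 2 ^ p) ^ 2)
      (a := deriv (deriv φ) θ) (B := A * h ^ 2) (by positivity) ?_ ?_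
    · simpa using key
    · intro p
      obtain ⟨a1, a2, a3, a4⟩ := hr p
      have := (hd p _ rfl).2
      rw [a2]
      set r := h / 2 ^ (p + 1)
      have e : (G (θ + 2 * r) - 2 * G θ + G (θ - 2 * r)) / (2 * r) ^ 2 -
          (G (θ + r) - 2 * G θ + G (θ - r)) / r ^ 2 =
          (G (θ + 2 * r) - 4 * G (θ + r) + 6 * G θ - 4 * G (θ - r) + G (θ - 2 * r)) /
            (4 * r ^ 2) := by
        field_simp; ring
      rw [e, abs_div, abs_of_pos (by positivity : 0 < 4 * r ^ 2), div_le_iff₀ (by positivity)]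
      have hp : 0 ≤ A * r ^ 4 := by positivity
      calc _ ≤ _ := this
        _ ≤ 2 * A * r ^ 2 * (4 * r ^ 2) := by nlinarith
        _ = _ := by rw [a4]; ring
    · refine tendsto_of_mem_dyadic (g := fun x => deriv (deriv φ) x) (h := h) hφ'' fun p => ?_
      obtain ⟨a1, -, -, -⟩ := hr p
      obtain ⟨e1, e2, e3⟩ := hGφ p
      obtain ⟨ξ, hξ, e⟩ := exists_deriv_deriv_eq_second_diff hφ (θ := θ) a1
      refine ⟨ξ, hξ, ?_⟩
      simp only [e1, e2, e3, e]
      field_simp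

theorem grid_mem {N i : ℕ} (hi : i ∈ Finset.Icc 1 N) :
    0 ≤ grid N i - 1 / N / 2 ∧ grid N i + 1 / N / 2 ≤ 1 := by
  obtain ⟨h1, h2⟩ := Finset.mem_Icc.1 hi
  have hN : (0 : ℝ) < N := by exact_mod_cast (by omega : 0 < N)
  have h1' : (1 : ℝ) ≤ i := by exact_mod_cast h1
  have h2' : (i : ℝ) ≤ N := by exact_mod_cast h2
  have e1 : grid N i - 1 / N / 2 = (i - 1) / N := by rw [grid]; field_simp; ring
  have e2 : grid N i + 1 / N / 2 = i / N := by rw [grid]; field_simp; ring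
  rw [e1, e2, div_le_one hN]
  exact ⟨div_nonneg (by linarith) hN.le, h2'⟩

theorem pad_grid_eq (f : ℝ → ℝ) {N i : ℕ} (hN : 0 < N) (hi : i ≤ N + 1) :
    pad N (fun j => f (grid N j)) i = reflExt f (grid N i) := by
  have hN' : (0 : ℝ) < N := by exact_mod_cast hN
  rcases Nat.eq_zero_or_pos i with rfl | hi0
  · have e : -grid N 0 = grid N 1 := by simp only [grid]; push_cast; ring
    have : grid N 0 < 0 := by
      have : (0 : ℝ) < grid N 1 := by simp only [grid]; push_cast; norm_num; exact hN
      linarith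
    rw [reflExt, if_pos this, e]
    simp [pad]
  rcases hi.lt_or_eq with h | rfl
  · have h1 := grid_mem (Finset.mem_Icc.2 ⟨hi0, Nat.lt_succ_iff.1 h⟩)
    have h2 : (0 : ℝ) < 1 / N / 2 := by positivity
    rw [reflExt_of_mem f ⟨by linarith, by linarith⟩, pad, if_neg hi0.ne', if_neg h.ne]
  · have e : 2 - grid N (N + 1) = grid N N := by simp only [grid]; push_cast; field_simp; ring
    have h1 := (grid_mem (Finset.mem_Icc.2 ⟨hN, le_refl N⟩)).2
    have h3 : grid N (N + 1) = 1 + 1 / N / 2 := by simp only [grid]; push_cast; field_simp; ring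
    have h2 : (0 : ℝ) < 1 / N / 2 := by positivity
    rw [reflExt, if_neg (by linarith), if_pos (by linarith), e]
    simp [pad]

theorem grid_succ (N i : ℕ) : grid N (i + 1) = grid N i + 1 / N := by
  simp only [grid]; push_cast; ring

theorem grid_pred (N : ℕ) {i : ℕ} (hi : 1 ≤ i) : grid N (i - 1) = grid N i - 1 / N := by
  obtain ⟨k, rfl⟩ : ∃ k, i = k + 1 := ⟨i - 1, by omega⟩
  rw [grid_succ]; simp

theorem exists_consistency (c C K : ℝ) (hc : 0 < c) (hcC : c ≤ C) (hK0 : 0 < K) :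
    ∃ Chat : ℝ, 0 < Chat ∧ ∀ X : ℝ → ℝ → ℝ, GlobalSol c C K X → ContDiff ℝ 4 (X 0) →
      (∀ k : ℕ, k ≤ 4 → ∀ θ ∈ Icc (0 : ℝ) 1, |iteratedDeriv k (X 0) θ| ≤ K) →
      ∀ t, 0 ≤ t → ∀ N : ℕ, 1 ≤ N → ∀ i ∈ Finset.Icc 1 N,
        |1 / 2 * deriv (X t) (grid N i) * deriv (deriv (X t)) (grid N i) -
          ((N : ℝ) ^ 3 / 4) *
            ((pad N (fun j => X t (grid N j)) (i + 1) - pad N (fun j => X t (grid N j)) i) ^ 2 -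
              (pad N (fun j => X t (grid N j)) i -
                pad N (fun j => X t (grid N j)) (i - 1)) ^ 2)| ≤ Chat / (N : ℝ) ^ 2 := by
  obtain ⟨A₀, hA₀⟩ := exists_reflExt_diff_bound c C K hc hcC hK0.le
  have hC : 0 < C := hc.trans_le hcC
  set A := |A₀| with hA
  have hAn : 0 ≤ A := abs_nonneg _
  refine ⟨(A * (C * K / c) + (2 * C + A) * A) / 4 + 1, by positivity, ?_⟩
  intro X h hX hXK t ht N hN i hi
  have hN' : (1 : ℝ) ≤ N := by exact_mod_cast hN
  have hN0 : (0 : ℝ) < N := by linarith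
  obtain ⟨hi1, hi2⟩ := Finset.mem_Icc.1 hi
  obtain ⟨g0, g1⟩ := grid_mem hi
  rw [pad_grid_eq _ hN (by omega), pad_grid_eq _ hN (by omega), pad_grid_eq _ hN (by omega),
    grid_succ, grid_pred N hi1]
  have hpos : (0 : ℝ) < 1 / N := by positivity
  have hle : (1 : ℝ) / N ≤ 1 := by rw [div_le_one hN0]; exact hN'
  have key := abs_deriv_sub_quotient_le (h.smooth t ht)
    (G := reflExt (X t)) (fun x hx => reflExt_of_mem _ hx) hAn hpos g0 g1 ?_
  · set G := reflExt (X t)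
    set θ := grid N i
    have hθ : θ ∈ Ioc (0 : ℝ) 1 := ⟨by linarith, by linarith⟩
    obtain ⟨k1, k2⟩ := key
    have hd := h.deriv_bounds ht hθ
    have hdd := h.abs_curv_le ht hθ
    set a := (G (θ + 1 / N) - G (θ - 1 / N)) / (1 / N) with ha
    set b := (G (θ + 1 / N) - 2 * G θ + G (θ - 1 / N)) / (1 / N) ^ 2 with hb
    set u := deriv (X t) θ
    set v := deriv (deriv (X t)) θ
    have e : (N : ℝ) ^ 3 / 4 * ((G (θ + 1 / N) - G θ) ^ 2 - (G θ - G (θ - 1 / N)) ^ 2) =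
        a * b / 4 := by
      rw [ha, hb]; field_simp; ring
    have e2 : 1 / 2 * u * v - a * b / 4 = (-(a - 2 * u) * v + (-a) * (b - v)) / 4 := by ring
    have hsq : (1 / (N : ℝ)) ^ 2 ≤ 1 := pow_le_one₀ hpos.le hle
    have ha' : |a| ≤ 2 * C + A := by
      have h3 := abs_add_le (a - 2 * u) (2 * u)
      rw [sub_add_cancel, abs_of_pos (by linarith : 0 < 2 * u)] at h3
      have : A * (1 / (N : ℝ)) ^ 2 ≤ A * 1 := mul_le_mul_of_nonneg_left hsq hAn
      linarith
    rw [e, e2, abs_div, abs_of_pos (by norm_num : (0 : ℝ) < 4)]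
    have h4 := abs_add_le (-(a - 2 * u) * v) (-a * (b - v))
    rw [abs_mul, abs_mul, abs_neg, abs_neg] at h4
    have h5 := mul_le_mul k1 hdd (abs_nonneg _) (by positivity)
    have h6 := mul_le_mul ha' k2 (abs_nonneg _) (by positivity)
    have h7 : (0 : ℝ) < 1 / N ^ 2 := by positivity
    have h8 : (1 / (N : ℝ)) ^ 2 = 1 / N ^ 2 := by rw [one_div_pow]
    rw [h8] at h5 h6
    rw [div_eq_mul_one_div (_ + 1)]
    nlinarith
  · intro p r hr
    have h2p : (1 : ℕ) ≤ 2 ^ p := Nat.one_le_two_pow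
    have h2pR : (0 : ℝ) < 2 ^ p := by positivity
    set q := N * 2 ^ (p + 2) with hq
    have hq0 : 0 < q := by positivity
    have hqp : (2 : ℤ) ^ (p + 1) * (2 * N) = q := by rw [hq]; push_cast; ring
    have h2z : (2 : ℤ) ≤ 2 ^ (p + 1) := by
      have : (2 : ℕ) ≤ 2 ^ (p + 1) := by rw [pow_succ]; omega
      exact_mod_cast this
    set P : ℤ := 2 ^ (p + 1) with hP
    have hqR : (q : ℝ) = N * (2 ^ p * 4) := by rw [hq]; push_cast; ring
    set k : ℤ := (2 * i - 1) * P - 4 with hk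
    have hi1' : (1 : ℤ) ≤ i := by exact_mod_cast hi1
    have hi2' : (i : ℤ) ≤ N := by exact_mod_cast hi2
    have hk0 : -(q : ℤ) ≤ k := by nlinarith
    have hk8 : k + 8 ≤ 2 * q := by nlinarith
    have hr2 : ((2 : ℕ) : ℝ) / q = r := by
      rw [hr, hqR, pow_succ]; push_cast; field_simp; norm_num
    have hE : ∀ j : ℤ, ((k + 4 + j : ℤ) : ℝ) / q = grid N i + j / 2 * r := by
      intro j
      rw [← hr2, hk, hP, grid, hqR]
      push_cast
      field_simp
      ring
    have b := fun k => hA₀ X h hX hXK t ht q hq0 (fun j => reflExt (X t) (j / q)) (fun _ => rfl) k 2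
    rw [hr2] at b
    have hr0 : 0 ≤ r := by rw [hr]; positivity
    have b1 := (b k hk0).1 (by push_cast; omega)
    have b2 := (b (k + 2) (by omega)).1 (by push_cast; omega)
    have b3 := (b k hk0).2 (by push_cast; omega)
    have c0 := hE (-4)
    have c1 := hE (-2)
    have c2 := hE 0
    have c3 := hE 2
    have c4 := hE 4
    have d0 : k + 4 + -4 = k := by ring
    have d1 : k + 4 + -2 = k + 2 := by ring
    have d2 : k + 4 + 0 = k + 2 + 2 := by ring
    have d3 : k + 4 + 2 = k + 2 + 2 + 2 := by ring
    have d4 : k + 4 + 4 = k + 2 + 2 + 2 + 2 := by ring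
    rw [d0] at c0
    rw [d1] at c1
    rw [d2] at c2
    rw [d3] at c3
    rw [d4] at c4
    have f0 : grid N i + ((-4 : ℤ) : ℝ) / 2 * r = grid N i - 2 * r := by push_cast; ring
    have f1 : grid N i + ((-2 : ℤ) : ℝ) / 2 * r = grid N i - r := by push_cast; ring
    have f2 : grid N i + ((0 : ℤ) : ℝ) / 2 * r = grid N i := by push_cast; ring
    have f3 : grid N i + ((2 : ℤ) : ℝ) / 2 * r = grid N i + r := by push_cast; ring
    have f4 : grid N i + ((4 : ℤ) : ℝ) / 2 * r = grid N i + 2 * r := by push_cast; ring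
    rw [f0] at c0
    rw [f1] at c1
    rw [f2] at c2
    rw [f3] at c3
    rw [f4] at c4
    simp only [Nat.cast_ofNat, c0, c1, c2, c3, c4] at b1 b2 b3
    have hA3 : A₀ * r ^ 3 ≤ A * r ^ 3 := mul_le_mul_of_nonneg_right (le_abs_self _) (by positivity)
    have hA4 : A₀ * r ^ 4 ≤ A * r ^ 4 := mul_le_mul_of_nonneg_right (le_abs_self _) (by positivity)
    refine ⟨?_, ?_⟩
    · have b1' := abs_le.1 b1
      have b2' := abs_le.1 b2
      rw [abs_le]
      constructor <;> linarith [b1'.1, b1'.2, b2'.1, b2'.2]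
    · exact b3.trans hA4

theorem sum_Icc_one_eq (f : ℕ → ℝ) (N : ℕ) :
    ∑ i ∈ Finset.Icc 1 N, f i = ∑ i ∈ Finset.range N, f (i + 1) := by
  induction N with
  | zero => simp
  | succ n ih => rw [Finset.sum_Icc_succ_top (by omega), Finset.sum_range_succ, ih]

theorem pad_of_mem {N i : ℕ} (v : ℕ → ℝ) (hi : i ∈ Finset.Icc 1 N) : pad N v i = v i := by
  obtain ⟨h1, h2⟩ := Finset.mem_Icc.1 hi
  rw [pad, if_neg (by omega), if_neg (by omega)]

theorem pad_zero (N : ℕ) (v : ℕ → ℝ) : pad N v 0 = -v 1 := by simp [pad]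

theorem pad_succ_self (N : ℕ) (v : ℕ → ℝ) : pad N v (N + 1) = 2 - v N := by simp [pad]

/-- Lower bounds on the spacings are preserved by the discrete flow. -/
theorem gap_lower_bound {N : ℕ} (hN : 1 ≤ N) {b : ℝ} (hb : 0 < b) {x : ℝ → ℕ → ℝ}
    (hx : ∀ t, 0 ≤ t → ∀ i ∈ Finset.Icc 1 N, HasDerivAt (fun s => x s i)
      (((N : ℝ) ^ 3 / 4) * ((pad N (x t) (i + 1) - pad N (x t) i) ^ 2 -
        (pad N (x t) i - pad N (x t) (i - 1)) ^ 2)) t)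
    (h0 : ∀ i ≤ N, b ≤ pad N (x 0) (i + 1) - pad N (x 0) i) :
    ∀ t, 0 ≤ t → ∀ i ≤ N, b ≤ pad N (x t) (i + 1) - pad N (x t) i := by
  set d : ℝ → ℕ → ℝ := fun t i => pad N (x t) (i + 1) - pad N (x t) i with hd
  set d' : ℝ → ℕ → ℝ := fun t i => (N : ℝ) ^ 3 / 4 *
    (if i = 0 then 2 * (d t 1 ^ 2 - d t 0 ^ 2) else if i = N then
      2 * (d t (N - 1) ^ 2 - d t N ^ 2) else
      d t (i + 1) ^ 2 - 2 * d t i ^ 2 + d t (i - 1) ^ 2) with hd'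
  have hderiv : ∀ t, 0 ≤ t → ∀ i ≤ N, HasDerivAt (fun s => d s i) (d' t i) t := by
    intro t ht i hi
    have hN' : N ∈ Finset.Icc 1 N := Finset.mem_Icc.2 ⟨hN, le_rfl⟩
    have h1N : 1 ∈ Finset.Icc 1 N := Finset.mem_Icc.2 ⟨le_rfl, hN⟩
    rcases Nat.eq_zero_or_pos i with rfl | hi0
    · have e : (fun s => d s 0) = fun s => 2 * x s 1 := by
        ext s
        simp only [hd, zero_add, pad_zero, pad_of_mem _ h1N]
        ring
      rw [e]
      refine ((hx t ht 1 h1N).const_mul 2).congr_deriv ?_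
      simp [hd', hd]
      ring
    obtain ⟨j, rfl⟩ : ∃ j, i = j + 1 := ⟨i - 1, by omega⟩
    have h1 := hx t ht (j + 1) (Finset.mem_Icc.2 ⟨hi0, hi⟩)
    rcases hi.lt_or_eq with h | h
    · have h2 := hx t ht (j + 1 + 1) (Finset.mem_Icc.2 ⟨by omega, h⟩)
      have e : (fun s => d s (j + 1)) = fun s => x s (j + 1 + 1) - x s (j + 1) := by
        ext s
        simp only [hd]
        rw [pad_of_mem _ (Finset.mem_Icc.2 ⟨by omega, h⟩),
          pad_of_mem _ (Finset.mem_Icc.2 ⟨by omega, hi⟩)]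
      rw [e]
      refine (h2.sub h1).congr_deriv ?_
      simp only [hd', hd, h.ne, if_false, Nat.add_sub_cancel, Nat.succ_ne_zero]
      ring
    · have e : (fun s => d s (j + 1)) = fun s => 2 - 2 * x s (j + 1) := by
        ext s
        simp only [hd]
        rw [pad_of_mem _ (Finset.mem_Icc.2 ⟨by omega, hi⟩), h, pad_succ_self]
        ring
      rw [e]
      refine ((h1.const_mul 2).const_sub 2).congr_deriv ?_
      simp only [hd', hd, ← h, if_true, if_false, Nat.add_sub_cancel, Nat.succ_ne_zero]
      ring
  intro t ht i hi
  have key := le_of_deriv_nonpos_at_max_finite (κ := Fin (N + 1)) (a := 0) (b := t) (B := -b)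
    (B' := 0) (f := fun s k => -d s k) (f' := fun s k => -d' s k) (by linarith)
    (fun s hs k => (hderiv s hs.1 k (by omega)).neg.hasDerivWithinAt)
    (fun k => neg_le_neg (h0 k (by omega))) ?_ t ⟨ht, le_rfl⟩ ⟨i, by omega⟩
  · exact neg_le_neg_iff.1 key
  · intro s hs k _ hk hmax
    have hpos : 0 < d s k := by linarith
    have hsq : ∀ j ≤ N, d s k ^ 2 ≤ d s j ^ 2 := fun j hj =>
      pow_le_pow_left₀ hpos.le (neg_le_neg_iff.1 (hmax ⟨j, by omega⟩)) 2
    have hkN : (k : ℕ) ≤ N := by omega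
    rw [neg_nonpos]
    refine mul_nonneg (by positivity) ?_
    split_ifs with h1 h2
    · have := hsq 1 hN
      rw [h1] at this
      linarith
    · have := hsq (N - 1) (by omega)
      rw [h2] at this
      linarith
    · have a1 := hsq (k + 1) (by omega)
      have a2 := hsq (k - 1) (by omega)
      linarith

/-- Strong monotonicity of the discrete flow field, for two padded configurations. -/
theorem sum_mul_field_sub_le {N : ℕ} (hN : 1 ≤ N) {c : ℝ} (hc : 0 < c) {p q : ℕ → ℝ}
    (hp : ∀ i ≤ N, c / N ≤ p (i + 1) - p i) (hq : ∀ i ≤ N, c / N ≤ q (i + 1) - q i)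
    (h0 : p 0 - q 0 = -(p 1 - q 1)) (h1 : p (N + 1) - q (N + 1) = -(p N - q N)) :
    ∑ i ∈ Finset.range N, (p (i + 1) - q (i + 1)) *
      ((N : ℝ) ^ 3 / 4 * ((p (i + 1 + 1) - p (i + 1)) ^ 2 - (p (i + 1) - p i) ^ 2) -
        (N : ℝ) ^ 3 / 4 * ((q (i + 1 + 1) - q (i + 1)) ^ 2 - (q (i + 1) - q i) ^ 2)) ≤
      -(c / 4) * ∑ i ∈ Finset.range N, (p (i + 1) - q (i + 1)) ^ 2 := by
  have hN0 : (0 : ℝ) < N := by exact_mod_cast hN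
  set u : ℕ → ℝ := fun i => p i - q i with hu
  set w : ℕ → ℝ := fun i => ((p (i + 1) - p i) + (q (i + 1) - q i)) * (u (i + 1) - u i) with hw
  have hcN : 0 < c / N := by positivity
  have abel : ∀ r : ℕ, ∑ i ∈ Finset.range r, u (i + 1) * (w (i + 1) - w i) =
      u r * w r - u 0 * w 0 - ∑ i ∈ Finset.range r, w i * (u (i + 1) - u i) := by
    intro r
    induction r with
    | zero => simp
    | succ r ih => rw [Finset.sum_range_succ, Finset.sum_range_succ, ih]; ring
  have hwlow : ∀ i ≤ N, 2 * (c / N) * (u (i + 1) - u i) ^ 2 ≤ w i * (u (i + 1) - u i) := by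
    intro i hi
    have a1 := hp i hi
    have a2 := hq i hi
    have := mul_le_mul_of_nonneg_right (by linarith : 2 * (c / N) ≤
      (p (i + 1) - p i) + (q (i + 1) - q i)) (sq_nonneg (u (i + 1) - u i))
    refine this.trans_eq ?_
    simp only [hw]; ring
  have hu0 : u 0 = -u 1 := h0
  have huN : u (N + 1) = -u N := h1
  have hwn : ∀ i ≤ N, 0 ≤ w i * (u (i + 1) - u i) := fun i hi =>
    (by positivity : 0 ≤ 2 * (c / N) * (u (i + 1) - u i) ^ 2).trans (hwlow i hi)
  have hdis : ∑ i ∈ Finset.range N, u (i + 1) * (w (i + 1) - w i) ≤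
      -(c / N) * ∑ i ∈ Finset.range N, (u (i + 1) - u i) ^ 2 := by
    rw [abel]
    have s1 : ∑ i ∈ Finset.range N, 2 * (c / N) * (u (i + 1) - u i) ^ 2 ≤
        ∑ i ∈ Finset.range N, w i * (u (i + 1) - u i) :=
      Finset.sum_le_sum fun i hi => hwlow i (Finset.mem_range.1 hi).le
    rw [← Finset.mul_sum] at s1
    have s2 : w 0 * (u (0 + 1) - u 0) ≤ ∑ i ∈ Finset.range N, w i * (u (i + 1) - u i) :=
      Finset.single_le_sum (f := fun i => w i * (u (i + 1) - u i))
        (fun i hi => hwn i (Finset.mem_range.1 hi).le) (Finset.mem_range.2 hN)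
    have s3 := hwn N le_rfl
    rw [zero_add, hu0] at s2
    rw [huN] at s3
    rw [hu0]
    linarith
  have hpoin : ∀ k, 1 ≤ k → k ≤ N → u k ^ 2 ≤ N * ∑ i ∈ Finset.range N, (u (i + 1) - u i) ^ 2 := by
    have hab : ∀ k, 1 ≤ k → |u k| ≤ ∑ i ∈ Finset.range k, |u (i + 1) - u i| := by
      intro k hk
      induction k, hk using Nat.le_induction with
      | base =>
        rw [Finset.sum_range_one, zero_add, hu0, sub_neg_eq_add, ← two_mul, abs_mul, abs_two]
        linarith [abs_nonneg (u 1)]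
      | succ k hk ih =>
        rw [Finset.sum_range_succ]
        have := abs_add_le (u k) (u (k + 1) - u k)
        rw [add_sub_cancel] at this
        linarith
    intro k hk hkN
    have s1 := pow_le_pow_left₀ (abs_nonneg _) (hab k hk) 2
    have s2 := sq_sum_le_card_mul_sum_sq (s := Finset.range k) (f := fun i => |u (i + 1) - u i|)
    simp only [sq_abs, Finset.card_range] at s1 s2
    have hkN' : (k : ℝ) ≤ N := by exact_mod_cast hkN
    refine s1.trans (s2.trans (mul_le_mul hkN' ?_
      (Finset.sum_nonneg fun _ _ => sq_nonneg _) hN0.le))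
    exact Finset.sum_le_sum_of_subset_of_nonneg (Finset.range_mono hkN) fun _ _ _ => sq_nonneg _
  have hsum : ∑ i ∈ Finset.range N, u (i + 1) ^ 2 ≤
      N * (N * ∑ i ∈ Finset.range N, (u (i + 1) - u i) ^ 2) := by
    refine (Finset.sum_le_card_nsmul _ _ _ fun i hi =>
      hpoin (i + 1) (by omega) (Finset.mem_range.1 hi)).trans_eq ?_
    rw [Finset.card_range, nsmul_eq_mul]
  calc _ = (N : ℝ) ^ 3 / 4 * ∑ i ∈ Finset.range N, u (i + 1) * (w (i + 1) - w i) := by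
        rw [Finset.mul_sum]
        refine Finset.sum_congr rfl fun i _ => ?_
        simp only [hw, hu]; ring
    _ ≤ (N : ℝ) ^ 3 / 4 * (-(c / N) * ∑ i ∈ Finset.range N, (u (i + 1) - u i) ^ 2) :=
        mul_le_mul_of_nonneg_left hdis (by positivity)
    _ = -(c / 4) * (N * (N * ∑ i ∈ Finset.range N, (u (i + 1) - u i) ^ 2)) := by
        field_simp
    _ ≤ _ := mul_le_mul_of_nonpos_left hsum (by linarith)

theorem le_exp_mul_add_of_deriv_le {S S' : ℝ → ℝ} {a κ : ℝ} (ha : 0 < a)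
    (hS : ∀ t, 0 ≤ t → HasDerivAt S (S' t) t) (h : ∀ t, 0 ≤ t → S' t ≤ -a * S t + κ)
    (hκ : 0 ≤ κ) {t : ℝ} (ht : 0 ≤ t) : S t ≤ Real.exp (-a * t) * S 0 + κ / a := by
  have hd : ∀ t, 0 ≤ t → HasDerivAt (fun t => Real.exp (a * t) * (S t - κ / a))
      (Real.exp (a * t) * (a * S t - κ + S' t)) t := by
    intro t ht
    have h1 : HasDerivAt (fun t => Real.exp (a * t)) (Real.exp (a * t) * a) t := by
      simpa using ((hasDerivAt_id t).const_mul a).exp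
    refine (h1.mul ((hS t ht).sub_const (κ / a))).congr_deriv ?_
    field_simp
  have hanti : AntitoneOn (fun t => Real.exp (a * t) * (S t - κ / a)) (Ici 0) := by
    refine antitoneOn_of_deriv_nonpos (convex_Ici 0)
      (fun t ht => (hd t ht).continuousAt.continuousWithinAt) ?_ ?_
    · intro t ht
      rw [interior_Ici] at ht
      exact (hd t (le_of_lt ht)).differentiableAt.differentiableWithinAt
    · intro t ht
      rw [interior_Ici] at ht
      rw [(hd t (le_of_lt ht)).deriv]
      exact mul_nonpos_of_nonneg_of_nonpos (Real.exp_pos _).le (by linarith [h t (le_of_lt ht)])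
  have h1 := hanti (mem_Ici.2 le_rfl) (mem_Ici.2 ht) ht
  simp only [mul_zero, Real.exp_zero, one_mul] at h1
  have h2 : S t - κ / a ≤ Real.exp (-a * t) * (S 0 - κ / a) := by
    have h3 := mul_le_mul_of_nonneg_left h1 (Real.exp_pos (-a * t)).le
    rwa [← mul_assoc, ← Real.exp_add, (by ring : -a * t + a * t = 0), Real.exp_zero, one_mul] at h3
  have h4 : 0 ≤ Real.exp (-a * t) * (κ / a) := by positivity
  linarith

theorem GlobalSol.pad_gap_lower_bound {c C K : ℝ} {X : ℝ → ℝ → ℝ} (h : GlobalSol c C K X) {t : ℝ}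
    (ht : 0 ≤ t) {N : ℕ} (hN : 1 ≤ N) : ∀ i ≤ N, c / N ≤
      pad N (fun j => X t (grid N j)) (i + 1) - pad N (fun j => X t (grid N j)) i := by
  have hN0 : (0 : ℝ) < N := by exact_mod_cast hN
  have hN' : N ∈ Finset.Icc 1 N := Finset.mem_Icc.2 ⟨hN, le_rfl⟩
  have h1N : 1 ∈ Finset.Icc 1 N := Finset.mem_Icc.2 ⟨le_rfl, hN⟩
  have hw : (0 : ℝ) < 1 / N / 2 := by positivity
  have e : c / N = c * (1 / N) := by ring
  intro i hi
  rcases Nat.eq_zero_or_pos i with rfl | hi0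
  · rw [zero_add, pad_zero, pad_of_mem _ h1N]
    have g1 : grid N 1 = 1 / N / 2 := by simp only [grid]; push_cast; ring
    have hm := grid_mem h1N
    have := (h.slope_bounds ht le_rfl (y := grid N 1) (by linarith) (by linarith)).1
    rw [(h.bdry t ht).1, g1] at this
    rw [g1, e]
    linarith
  rcases hi.lt_or_eq with hlt | rfl
  · have h1 : i ∈ Finset.Icc 1 N := Finset.mem_Icc.2 ⟨hi0, hi⟩
    have h2 : i + 1 ∈ Finset.Icc 1 N := Finset.mem_Icc.2 ⟨by omega, hlt⟩
    have m1 := grid_mem h1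
    have m2 := grid_mem h2
    have s := grid_succ N i
    rw [pad_of_mem _ h1, pad_of_mem _ h2]
    have := (h.slope_bounds ht (x := grid N i) (y := grid N (i + 1)) (by linarith) (by linarith)
      (by linarith)).1
    rwa [s, add_sub_cancel_left, ← e, ← s] at this
  · rw [pad_succ_self, pad_of_mem _ hN']
    have gN : grid i i = 1 - 1 / i / 2 := by simp only [grid]; field_simp
    have hm := grid_mem hN'
    have := (h.slope_bounds ht (x := grid i i) (y := 1) (by linarith) (by linarith) le_rfl).1
    rw [(h.bdry t ht).2, gN] at this
    rw [gN, e]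
    linarith

/-- Two trajectories with spacings at least `c / N`, one of which solves the discrete flow up to an
error `ε`, stay close in mean square. -/
theorem mean_sq_sub_le {N : ℕ} (hN : 1 ≤ N) {c ε : ℝ} (hc : 0 < c) {x y : ℝ → ℕ → ℝ}
    {y' : ℝ → ℕ → ℝ}
    (hx : ∀ t, 0 ≤ t → ∀ i ∈ Finset.Icc 1 N, HasDerivAt (fun s => x s i)
      (((N : ℝ) ^ 3 / 4) * ((pad N (x t) (i + 1) - pad N (x t) i) ^ 2 -
        (pad N (x t) i - pad N (x t) (i - 1)) ^ 2)) t)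
    (hy : ∀ t, 0 ≤ t → ∀ i ∈ Finset.Icc 1 N, HasDerivAt (fun s => y s i) (y' t i) t)
    (hε : ∀ t, 0 ≤ t → ∀ i ∈ Finset.Icc 1 N, |y' t i - ((N : ℝ) ^ 3 / 4) *
      ((pad N (y t) (i + 1) - pad N (y t) i) ^ 2 -
        (pad N (y t) i - pad N (y t) (i - 1)) ^ 2)| ≤ ε)
    (gx : ∀ t, 0 ≤ t → ∀ i ≤ N, c / N ≤ pad N (x t) (i + 1) - pad N (x t) i)
    (gy : ∀ t, 0 ≤ t → ∀ i ≤ N, c / N ≤ pad N (y t) (i + 1) - pad N (y t) i)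
    {t : ℝ} (ht : 0 ≤ t) :
    (1 / (N : ℝ)) * ∑ i ∈ Finset.Icc 1 N, (x t i - y t i) ^ 2 ≤
      Real.exp (-(c / 4) * t) * ((1 / (N : ℝ)) * ∑ i ∈ Finset.Icc 1 N, (x 0 i - y 0 i) ^ 2) +
        16 / c ^ 2 * ε ^ 2 := by
  have hN0 : (0 : ℝ) < N := by exact_mod_cast hN
  set F : (ℕ → ℝ) → ℕ → ℝ := fun v i => ((N : ℝ) ^ 3 / 4) * ((pad N v (i + 1) - pad N v i) ^ 2 -
    (pad N v i - pad N v (i - 1)) ^ 2) with hF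
  have hS : ∀ t, 0 ≤ t → HasDerivAt (fun t => ∑ i ∈ Finset.Icc 1 N, (x t i - y t i) ^ 2)
      (∑ i ∈ Finset.Icc 1 N, 2 * (x t i - y t i) * (F (x t) i - y' t i)) t := fun t ht =>
    HasDerivAt.fun_sum fun i hi =>
      (((hx t ht i hi).sub (hy t ht i hi)).pow 2).congr_deriv (by simp [hF])
  have hmono : ∀ t, 0 ≤ t → ∑ i ∈ Finset.Icc 1 N, (x t i - y t i) * (F (x t) i - F (y t) i) ≤
      -(c / 4) * ∑ i ∈ Finset.Icc 1 N, (x t i - y t i) ^ 2 := by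
    intro t ht
    have key := sum_mul_field_sub_le hN hc (gx t ht) (gy t ht)
      (by
        have h1N : 1 ∈ Finset.Icc 1 N := Finset.mem_Icc.2 ⟨le_rfl, hN⟩
        rw [pad_zero, pad_zero, pad_of_mem _ h1N, pad_of_mem _ h1N]; ring)
      (by
        have hN' : N ∈ Finset.Icc 1 N := Finset.mem_Icc.2 ⟨hN, le_rfl⟩
        rw [pad_succ_self, pad_succ_self, pad_of_mem _ hN', pad_of_mem _ hN']; ring)
    rw [sum_Icc_one_eq, sum_Icc_one_eq]
    have hmem : ∀ i ∈ Finset.range N, i + 1 ∈ Finset.Icc 1 N := fun i hi =>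
      Finset.mem_Icc.2 ⟨by omega, Finset.mem_range.1 hi⟩
    convert key using 1
    · refine Finset.sum_congr rfl fun i hi => ?_
      simp only [hF, Nat.add_sub_cancel, pad_of_mem _ (hmem i hi)]
    · congr 1
      refine Finset.sum_congr rfl fun i hi => ?_
      rw [pad_of_mem _ (hmem i hi), pad_of_mem _ (hmem i hi)]
  have hle : ∀ t, 0 ≤ t → ∑ i ∈ Finset.Icc 1 N, 2 * (x t i - y t i) * (F (x t) i - y' t i) ≤
      -(c / 4) * ∑ i ∈ Finset.Icc 1 N, (x t i - y t i) ^ 2 + 4 / c * (N * ε ^ 2) := by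
    intro t ht
    have hterm : ∀ i ∈ Finset.Icc 1 N, 2 * (x t i - y t i) * (F (x t) i - y' t i) ≤
        2 * ((x t i - y t i) * (F (x t) i - F (y t) i)) + c / 4 * (x t i - y t i) ^ 2 +
          4 / c * ε ^ 2 := by
      intro i hi
      have h1 : (y' t i - F (y t) i) ^ 2 ≤ ε ^ 2 := sq_le_sq' (abs_le.1 (hε t ht i hi)).1
        (abs_le.1 (hε t ht i hi)).2
      have h2 : 4 / c * (y' t i - F (y t) i) ^ 2 ≤ 4 / c * ε ^ 2 :=
        mul_le_mul_of_nonneg_left h1 (by positivity)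
      have h3 : 0 ≤ c / 4 * ((x t i - y t i) + 4 / c * (y' t i - F (y t) i)) ^ 2 := by positivity
      have h4 : c / 4 * ((x t i - y t i) + 4 / c * (y' t i - F (y t) i)) ^ 2 =
          c / 4 * (x t i - y t i) ^ 2 + 2 * ((x t i - y t i) * (y' t i - F (y t) i)) +
            4 / c * (y' t i - F (y t) i) ^ 2 := by field_simp; ring
      linarith
    have hs := Finset.sum_le_sum hterm
    rw [Finset.sum_add_distrib, Finset.sum_add_distrib, ← Finset.mul_sum, ← Finset.mul_sum,
      Finset.sum_const, Nat.card_Icc, nsmul_eq_mul, Nat.add_sub_cancel] at hs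
    linarith [hmono t ht]
  have h1 := mul_le_mul_of_nonneg_left (le_exp_mul_add_of_deriv_le (by positivity) hS hle
    (by positivity) ht) (by positivity : 0 ≤ 1 / (N : ℝ))
  refine h1.trans_eq ?_
  field_simp
  ring

end

theorem L2_convergence_rho_one (c0 : ℝ) (hc0 : 0 < c0) :
    -- `c̄, C̄` depend only on `c0`
    ∃ cbar Cbar : ℝ, 0 < cbar ∧ 0 < Cbar ∧
      ∀ (C0 K α : ℝ), 0 < C0 → 0 < K → 0 < α →
        -- the consistency constant `Ĉ` depends only on `c0` and `‖X₀‖_{C^{4,α}}`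
        ∃ Chat : ℝ, 0 < Chat ∧
          ∀ (N : ℕ), 1 ≤ N → ∀ (x : ℝ → ℕ → ℝ) (X : ℝ → ℝ → ℝ),
            -- the rescaled discrete gradient flow
            (∀ t, 0 ≤ t → ∀ i ∈ Finset.Icc 1 N,
              HasDerivAt (fun s => x s i)
                (((N : ℝ) ^ 3 / 4) * ((pad N (x t) (i + 1) - pad N (x t) i) ^ 2
                  - (pad N (x t) i - pad N (x t) (i - 1)) ^ 2)) t) →
            -- spatial regularity of the continuous solution
            (∀ t, 0 ≤ t → ContDiff ℝ 2 (X t)) →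
            -- the PDE `∂ₜX = (1/2) ∂_θX ∂²_θθX`
            (∀ t, 0 ≤ t → ∀ θ ∈ Set.Icc (0 : ℝ) 1,
              HasDerivAt (fun s => X s θ)
                ((1 / 2) * deriv (X t) θ * deriv (deriv (X t)) θ) t) →
            -- boundary conditions
            (∀ t, 0 ≤ t → X t 0 = 0 ∧ X t 1 = 1) →
            -- `X₀ ∈ C^{4,α}` with norm bounded by `K`
            C4HolderBound α K (X 0) →
            -- initial spacing of the discrete points
            (∀ i ∈ Finset.Icc 1 (N + 1),
              c0 / N ≤ pad N (x 0) i - pad N (x 0) (i - 1) ∧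
                pad N (x 0) i - pad N (x 0) (i - 1) ≤ C0 / N) →
            -- monotonicity of the initial datum
            (∀ θ ∈ Set.Icc (0 : ℝ) 1, c0 ≤ deriv (X 0) θ ∧ deriv (X 0) θ ≤ C0) →
            -- `Ĉ` is the consistency constant
            (∀ t, 0 ≤ t → ∀ i ∈ Finset.Icc 1 N, ∀ D : ℝ,
              HasDerivAt (fun s => X s (grid N i)) D t →
              |D - ((N : ℝ) ^ 3 / 4) *
                  ((pad N (fun j => X t (grid N j)) (i + 1)
                      - pad N (fun j => X t (grid N j)) i) ^ 2
                    - (pad N (fun j => X t (grid N j)) i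
                        - pad N (fun j => X t (grid N j)) (i - 1)) ^ 2)| ≤
                Chat / (N : ℝ) ^ 2)
            -- conclusion: the L² convergence estimate
            ∧ ∀ t, 0 ≤ t →
                (1 / (N : ℝ)) * ∑ i ∈ Finset.Icc 1 N, (x t i - X t (grid N i)) ^ 2 ≤
                  Real.exp (-cbar * t) *
                    ((1 / (N : ℝ)) * ∑ i ∈ Finset.Icc 1 N, (x 0 i - X 0 (grid N i)) ^ 2)
                  + Cbar * (Chat / (N : ℝ) ^ 2) ^ 2 := by
  refine ⟨c0 / 4, 16 / c0 ^ 2, by positivity, by positivity, fun C0 K α hC0 hK _ => ?_⟩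
  by_cases hcC : c0 ≤ C0
  swap
  · refine ⟨1, one_pos, fun N _ x X _ _ _ _ _ _ hsl => absurd ?_ hcC⟩
    exact (hsl 0 ⟨le_rfl, zero_le_one⟩).1.trans (hsl 0 ⟨le_rfl, zero_le_one⟩).2
  obtain ⟨Chat, hChat, hcons⟩ := exists_consistency c0 C0 K hc0 hcC hK
  refine ⟨Chat, hChat, fun N hN x X hx hX hpde hbd hX0 hgap hsl => ?_⟩
  have hsol : GlobalSol c0 C0 K X := ⟨hX, hpde, hbd, hc0, hC0, hK, hsl, fun θ hθ => by
    simpa only [iteratedDeriv_succ, iteratedDeriv_zero] using hX0.2.1 2 (by norm_num) θ hθ⟩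
  have hgrid : ∀ i ∈ Finset.Icc 1 N, grid N i ∈ Set.Icc (0 : ℝ) 1 := by
    intro i hi
    have hw : (0 : ℝ) ≤ 1 / N / 2 := by positivity
    have hm := grid_mem hi
    exact ⟨by linarith, by linarith⟩
  have hbound := fun t ht => hcons X hsol hX0.1 hX0.2.1 t ht N hN
  refine ⟨fun t ht i hi D hD => ?_, fun t ht => ?_⟩
  · rw [hD.unique (hpde t ht _ (hgrid i hi))]
    exact hbound t ht i hi
  · refine mean_sq_sub_le (y := fun s j => X s (grid N j)) hN hc0 hx
      (fun t ht i hi => hpde t ht _ (hgrid i hi)) hbound ?_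
      (fun t ht => hsol.pad_gap_lower_bound ht hN) ht
    have hN0 : (0 : ℝ) < N := by exact_mod_cast hN
    exact gap_lower_bound hN (by positivity) hx fun i hi =>
      (hgap (i + 1) (Finset.mem_Icc.2 ⟨by omega, by omega⟩)).1
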